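/- arXiv:1909.00940 — 6 statements merged into one kernel-verified Lean document; each statement's English description precedes it below -/
import Mathlib

section
/- Let S be a geometric simplicial complex in ℝ^d and let S′ be a subdivision of S. Then the subdivision map on chains commutes with the boundary operators: for every m ≥ 1 and every m-chain α of S, one has ∂⟦α⟧ = ⟦∂α⟧ in C_{m−1}(S′). -/
open scoped Classical
open Finset

/-- A finite geometric simplicial complex in a real vector space `E`: a finite
collection of vertex sets of geometric simplices (finite affinely independent sets),
closed under passing to nonempty subsets (faces), such that the intersection of any two
of its geometric simplices (convex hulls of the vertex sets) is a face of each. -/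
structure GeomComplex (E : Type*) [AddCommGroup E] [Module ℝ E] where
  faces : Finset (Finset E)
  nonempty_of_mem : ∀ σ ∈ faces, σ.Nonempty
  indep : ∀ σ ∈ faces, AffineIndependent ℝ ((↑) : σ → E)
  down_closed : ∀ σ ∈ faces, ∀ τ ⊆ σ, τ.Nonempty → τ ∈ faces
  inter_face : ∀ σ ∈ faces, ∀ τ ∈ faces,
    convexHull ℝ (σ : Set E) ∩ convexHull ℝ (τ : Set E) =
      convexHull ℝ ((σ ∩ τ : Finset E) : Set E)

variable {E : Type*} [AddCommGroup E] [Module ℝ E]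

/-- `S'` is a subdivision of `S` if every simplex of `S'` is contained in a simplex of
`S` and every simplex of `S` is the union of the simplices of `S'` contained in it. -/
def IsSubdivision (S' S : GeomComplex E) : Prop :=
  (∀ σ' ∈ S'.faces, ∃ σ ∈ S.faces,
      convexHull ℝ (σ' : Set E) ⊆ convexHull ℝ (σ : Set E)) ∧
  ∀ σ ∈ S.faces, convexHull ℝ (σ : Set E) =
    ⋃ σ' ∈ S'.faces.filter (fun τ =>
        convexHull ℝ (τ : Set E) ⊆ convexHull ℝ (σ : Set E)),
      convexHull ℝ (σ' : Set E)

/-- An `𝔽₂`-chain is encoded as the finite set of the simplices occurring in it with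
coefficient `1`.  The boundary of a chain `α` consists of the finite sets `τ` that are
`(m-1)`-faces of an odd number of simplices of `α`. -/
noncomputable def geomBoundary {E : Type*} (α : Finset (Finset E)) :
    Finset (Finset E) :=
  (α.biUnion fun σ => σ.powerset).filter fun τ =>
    Odd (α.filter fun σ => τ ⊆ σ ∧ σ.card = τ.card + 1).card

/-- The subdivision `⟦α⟧` of a chain `α` with respect to a complex with set of faces
`F'`: a simplex `σ'` of `F'` occurs in `⟦α⟧` iff `σ'` is contained (as a geometric
simplex) in an odd number of simplices of `α` of the same dimension. -/
noncomputable def subdivChain (F' : Finset (Finset E)) (α : Finset (Finset E)) :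
    Finset (Finset E) :=
  F'.filter fun σ' =>
    Odd (α.filter fun σ : Finset E => σ'.card = σ.card ∧
      convexHull ℝ (σ' : Set E) ⊆ convexHull ℝ (σ : Set E)).card

/-- Uniqueness of affine coordinates with respect to an affinely independent finite set. -/
theorem AffineIndependent.eq_of_sum_smul_eq {s : Finset E}
    (hs : AffineIndependent ℝ ((↑) : s → E)) {w₁ w₂ : E → ℝ}
    (h : ∑ x ∈ s, w₁ x = ∑ x ∈ s, w₂ x)
    (h' : ∑ x ∈ s, w₁ x • x = ∑ x ∈ s, w₂ x • x) {x : E} (hx : x ∈ s) : w₁ x = w₂ x := by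
  have key := affineIndependent_iff.1 hs univ (fun y => w₁ y - w₂ y)
    (by rw [Finset.sum_coe_sort s (fun y => w₁ y - w₂ y), sum_sub_distrib, h, sub_self])
    (by
      rw [Finset.sum_coe_sort s (fun y => (w₁ y - w₂ y) • y)]
      simp only [sub_smul, sum_sub_distrib, h', sub_self])
  exact sub_eq_zero.1 (key ⟨x, hx⟩ (mem_univ _))

/-- The barycenter of a finite set of points. -/
noncomputable def barycenter (t : Finset E) : E := ∑ x ∈ t, (t.card : ℝ)⁻¹ • x

theorem barycenter_mem_convexHull {t : Finset E} (ht : t.Nonempty) :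
    barycenter t ∈ convexHull ℝ (t : Set E) := by
  have : (t.card : ℝ) ≠ 0 := by exact_mod_cast ht.card_pos.ne'
  exact Finset.mem_convexHull'.2 ⟨fun _ => (t.card : ℝ)⁻¹, fun _ _ => by positivity,
    by simp [this], rfl⟩

theorem map_barycenter {t : Finset E} (ht : t.Nonempty) (g : E →ₗ[ℝ] ℝ) {c : ℝ}
    (hg : ∀ x ∈ t, g x = c) : g (barycenter t) = c := by
  have : (t.card : ℝ) ≠ 0 := by exact_mod_cast ht.card_pos.ne'
  rw [barycenter, map_sum, sum_congr rfl fun x hx => by rw [map_smul, hg x hx]]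
  simp [this]

/-- The barycenter of a simplex lies in no proper face. -/
theorem eq_of_barycenter_mem_convexHull {s t : Finset E}
    (ht : AffineIndependent ℝ ((↑) : t → E)) (hst : s ⊆ t)
    (h : barycenter t ∈ convexHull ℝ (s : Set E)) : s = t := by
  refine hst.antisymm fun x hx => ?_
  by_contra hxs
  have hc : (t.card : ℝ) ≠ 0 := by exact_mod_cast (card_pos.2 ⟨x, hx⟩).ne'
  obtain ⟨w, -, hw1, hw⟩ := Finset.mem_convexHull'.1 h
  have hi : t ∩ s = s := inter_eq_right.2 hst
  have := ht.eq_of_sum_smul_eq (w₁ := fun y => if y ∈ s then w y else 0)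
    (w₂ := fun _ => (t.card : ℝ)⁻¹)
    (by rw [sum_ite_mem, hi, hw1]; simp [hc])
    (by simp only [ite_smul, zero_smul]; rw [sum_ite_mem, hi, hw]; rfl) hx
  simp only [hxs, if_false] at this
  exact inv_ne_zero hc this.symm

/-- Affinely independent sets of equal cardinality have the same affine span as soon as one is
contained in the span of the other. -/
theorem affineSpan_eq_of_subset_of_card_eq {s t : Finset E}
    (hs : AffineIndependent ℝ ((↑) : s → E)) (ht : AffineIndependent ℝ ((↑) : t → E))
    (hst : (s : Set E) ⊆ affineSpan ℝ (t : Set E)) (hc : s.card = t.card) (hn : t.Nonempty) :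
    affineSpan ℝ (s : Set E) = affineSpan ℝ (t : Set E) := by
  obtain ⟨n, hcn⟩ : ∃ n, t.card = n + 1 := ⟨t.card - 1, by have := hn.card_pos; omega⟩
  have hfr := ht.finrank_vectorSpan (n := n) (by simpa using hcn)
  have : FiniteDimensional ℝ (affineSpan ℝ (t : Set E)).direction := by
    rw [direction_affineSpan]
    exact finiteDimensional_vectorSpan_of_finite ℝ t.finite_toSet
  have h := hs.affineSpan_eq_of_le_of_card_eq_finrank_add_one (sp := affineSpan ℝ (t : Set E))
  have hr (u : Finset E) : Set.range ((↑) : u → E) = u := Subtype.range_coe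
  rw [hr] at h hfr
  refine h (affineSpan_le.2 hst) ?_
  rw [direction_affineSpan, hfr, Fintype.card_coe, hc, hcn]

theorem affineIndependent_insert {t : Finset E} (ht : AffineIndependent ℝ ((↑) : t → E)) {v : E}
    (hv : v ∉ affineSpan ℝ (t : Set E)) :
    AffineIndependent ℝ ((↑) : ↥(insert v t) → E) := by
  refine AffineIndependent.affineIndependent_of_notMem_span
    (i := (⟨v, mem_insert_self v t⟩ : (insert v t : Finset E))) ?_ ?_
  · let f : {y : (insert v t : Finset E) // y ≠ ⟨v, mem_insert_self v t⟩} ↪ t :=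
      ⟨fun y => ⟨y.1.1, (mem_insert.1 y.1.2).resolve_left fun h => y.2 (Subtype.ext h)⟩,
        fun y z h => Subtype.ext (Subtype.ext (Subtype.mk.inj h))⟩
    exact ht.comp_embedding f
  · refine fun h => hv (affineSpan_mono ℝ ?_ h)
    rintro _ ⟨y, hy, rfl⟩
    exact (mem_insert.1 y.2).resolve_left fun h => hy (Subtype.ext h)

theorem exists_weights_of_mem_affineSpan {t : Finset E} {v : E}
    (hv : v ∈ affineSpan ℝ (t : Set E)) :
    ∃ a : E → ℝ, ∑ x ∈ t, a x = 1 ∧ ∑ x ∈ t, a x • x = v := by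
  have hv' : v ∈ affineSpan ℝ (Set.range ((↑) : t → E)) := by simpa using hv
  obtain ⟨w, hw, rfl⟩ := eq_affineCombination_of_mem_affineSpan_of_fintype hv'
  refine ⟨fun x => if h : x ∈ t then w ⟨x, h⟩ else 0, ?_, ?_⟩
  · rw [← hw, ← Finset.sum_coe_sort t]
    simp
  · rw [affineCombination_eq_linear_combination _ _ _ hw, ← Finset.sum_coe_sort t]
    simp

/-- A linear functional which is constant on a simplex of codimension one in `s`, and
not constant on `s`. -/
theorem exists_linearMap_eq_const {s t : Finset E}
    (hs : AffineIndependent ℝ ((↑) : s → E)) (hc : s.card = t.card + 1) (hn : t.Nonempty) :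
    ∃ (g : E →ₗ[ℝ] ℝ) (c : ℝ), (∀ x ∈ t, g x = c) ∧ ∃ x ∈ s, g x ≠ c := by
  obtain ⟨x, hx, hxt⟩ : ∃ x ∈ s, x ∉ affineSpan ℝ (t : Set E) := by
    by_contra! h
    have := hs.card_le_card_of_subset_affineSpan (t := t) h
    omega
  obtain ⟨p, hp⟩ := hn
  have hpt : p ∈ affineSpan ℝ (t : Set E) := subset_affineSpan ℝ _ hp
  have hx' : x - p ∉ (affineSpan ℝ (t : Set E)).direction := fun h => hxt <| by
    simpa using AffineSubspace.vadd_mem_of_mem_direction h hpt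
  obtain ⟨g, hg, hk⟩ := Submodule.exists_le_ker_of_notMem hx'
  refine ⟨g, g p, fun y hy => ?_, x, hx, fun h => hg (by simp [h])⟩
  have : g (y - p) = 0 :=
    hk (AffineSubspace.vsub_mem_direction (subset_affineSpan ℝ _ hy) hpt)
  simpa [sub_eq_zero] using this

theorem map_eq_of_mem_affineSpan {t : Finset E} {g : E →ₗ[ℝ] ℝ} {c : ℝ}
    (hg : ∀ x ∈ t, g x = c) {v : E} (hv : v ∈ affineSpan ℝ (t : Set E)) : g v = c := by
  obtain ⟨a, ha, rfl⟩ := exists_weights_of_mem_affineSpan hv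
  rw [map_sum, sum_congr rfl fun x hx => by rw [map_smul, hg x hx, smul_eq_mul], ← sum_mul, ha,
    one_mul]

open Filter Topology in
/-- Points close to the barycenter of `t`, on the same side of `t` as `w`, lie in the
simplex spanned by `t` and `w`. -/
theorem eventually_lineMap_barycenter_mem {t : Finset E} (hn : t.Nonempty) {v w : E} (hw : w ∉ t)
    {a : E → ℝ} (ha : ∑ x ∈ insert w t, a x = 1) (hv : ∑ x ∈ insert w t, a x • x = v)
    (haw : 0 ≤ a w) :
    ∀ᶠ ε : ℝ in 𝓝[>] 0, (1 - ε) • barycenter t + ε • v ∈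
      convexHull ℝ ((insert w t : Finset E) : Set E) := by
  have hc : 0 < (t.card : ℝ) := by exact_mod_cast hn.card_pos
  have hbw : ∑ x ∈ insert w t, (if x ∈ t then (t.card : ℝ)⁻¹ else 0) = 1 := by
    rw [sum_ite_mem, inter_eq_right.2 (subset_insert _ _)]
    simp [hc.ne']
  have hb : ∑ x ∈ insert w t, (if x ∈ t then (t.card : ℝ)⁻¹ else 0) • x = barycenter t := by
    simp only [ite_smul, zero_smul]
    rw [sum_ite_mem, inter_eq_right.2 (subset_insert _ _), barycenter]
  have hev : ∀ᶠ ε : ℝ in 𝓝[>] 0, ∀ x ∈ insert w t,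
      0 ≤ (1 - ε) * (if x ∈ t then (t.card : ℝ)⁻¹ else 0) + ε * a x := by
    rw [eventually_all_finset]
    intro x hx
    by_cases hxt : x ∈ t
    · have hcont : Continuous fun ε : ℝ => (1 - ε) * (t.card : ℝ)⁻¹ + ε * a x := by fun_prop
      have : ∀ᶠ ε : ℝ in 𝓝 0, 0 < (1 - ε) * (t.card : ℝ)⁻¹ + ε * a x :=
        hcont.continuousAt.eventually (lt_mem_nhds (by simpa using hc))
      filter_upwards [this.filter_mono nhdsWithin_le_nhds] with ε hε
      simpa [hxt] using hε.le
    · obtain rfl : x = w := by simpa [hxt] using hx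
      filter_upwards [self_mem_nhdsWithin] with ε hε
      simpa [hxt] using mul_nonneg (le_of_lt hε) haw
  filter_upwards [hev] with ε hε
  refine Finset.mem_convexHull'.2 ⟨_, hε, ?_, ?_⟩
  · rw [sum_add_distrib, ← mul_sum, ← mul_sum, hbw, ha]; ring
  · simp only [add_smul, mul_smul]
    rw [sum_add_distrib, ← smul_sum, ← smul_sum, hb, hv]

/-- If `w` lies in the span of the simplex `s` and off the hyperplane through its
codimension-one subsimplex `t`, then `t` and `w` span the affine hull of `s`. -/
theorem affineSpan_insert_eq {s t : Finset E} (ht : AffineIndependent ℝ ((↑) : t → E))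
    (hs : AffineIndependent ℝ ((↑) : s → E)) (hc : s.card = t.card + 1)
    (hts : (t : Set E) ⊆ affineSpan ℝ (s : Set E)) {w : E}
    (hw : w ∈ affineSpan ℝ (s : Set E)) (hwt : w ∉ affineSpan ℝ (t : Set E)) :
    affineSpan ℝ ((insert w t : Finset E) : Set E) = affineSpan ℝ (s : Set E) := by
  refine affineSpan_eq_of_subset_of_card_eq (affineIndependent_insert ht hwt) hs ?_ ?_
    (card_pos.1 (by omega))
  · rw [coe_insert]; exact Set.insert_subset hw hts
  · rw [card_insert_of_notMem (fun h => hwt (subset_affineSpan ℝ _ h)), hc]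

/-- The simplices of `F'` inside the simplex `s`, of the same dimension as `s`, having `t` as a
facet. -/
noncomputable def cofacesIn (F' : Finset (Finset E)) (s t : Finset E) : Finset (Finset E) :=
  F'.filter fun ρ => (t ⊆ ρ ∧ ρ.card = t.card + 1) ∧
    ρ.card = s.card ∧ convexHull ℝ (ρ : Set E) ⊆ convexHull ℝ (s : Set E)

/-- The facets of the simplex `s` which contain the simplex `t`, of the same dimension. -/
noncomputable def facetsContaining (s t : Finset E) : Finset (Finset E) :=
  s.powerset.filter fun τ => t.card = τ.card ∧ convexHull ℝ (t : Set E) ⊆ convexHull ℝ (τ : Set E)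

theorem eq_of_insert_mem_faces (S' : GeomComplex E) {s t : Finset E}
    (ht : AffineIndependent ℝ ((↑) : t → E)) (hs : AffineIndependent ℝ ((↑) : s → E))
    (hn : t.Nonempty) (hc : s.card = t.card + 1) (hts : (t : Set E) ⊆ affineSpan ℝ (s : Set E))
    {g : E →ₗ[ℝ] ℝ} {c : ℝ} (hg : ∀ x ∈ t, g x = c) {v w : E}
    (hv : v ∈ affineSpan ℝ (s : Set E)) (hw : w ∈ affineSpan ℝ (s : Set E))
    (hgv : c < g v) (hgw : c < g w)
    (hvS : insert v t ∈ S'.faces) (hwS : insert w t ∈ S'.faces) : v = w := by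
  by_contra hvw
  have hvt : v ∉ t := fun h => hgv.ne' (hg v h)
  have hwt : w ∉ t := fun h => hgw.ne' (hg w h)
  have hv' : v ∈ affineSpan ℝ ((insert w t : Finset E) : Set E) := by
    rwa [affineSpan_insert_eq ht hs hc hts hw fun h => hgw.ne' (map_eq_of_mem_affineSpan hg h)]
  obtain ⟨a, ha, hav⟩ := exists_weights_of_mem_affineSpan hv'
  have haw : 0 ≤ a w := by
    have h1 : g v = a w * g w + (∑ x ∈ t, a x) * c := by
      rw [← hav, map_sum, sum_insert hwt, map_smul, smul_eq_mul, sum_mul]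
      congr 1
      exact sum_congr rfl fun x hx => by rw [map_smul, hg x hx, smul_eq_mul]
    rw [sum_insert hwt] at ha
    have h2 : ∑ x ∈ t, a x = 1 - a w := by linarith
    rw [h2] at h1
    have h3 : 0 < a w * (g w - c) := by linarith
    exact (pos_of_mul_pos_left h3 (by linarith)).le
  have hev := eventually_lineMap_barycenter_mem hn hwt ha hav haw
  have hlt : ∀ᶠ ε : ℝ in nhdsWithin 0 (Set.Ioi 0), ε < 1 :=
    nhdsWithin_le_nhds (Iio_mem_nhds zero_lt_one)
  obtain ⟨ε, ⟨hε, hε1⟩, hε0⟩ := ((hev.and hlt).and self_mem_nhdsWithin).exists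
  replace hε0 : 0 < ε := hε0
  have hmem : (1 - ε) • barycenter t + ε • v ∈ convexHull ℝ ((insert v t : Finset E) : Set E) :=
    convex_convexHull ℝ _ (convexHull_mono (by simp) (barycenter_mem_convexHull hn))
      (subset_convexHull ℝ _ (by simp)) (by linarith) hε0.le (by ring)
  have hi : insert v t ∩ insert w t = t := by
    ext x
    simp only [mem_inter, mem_insert]
    constructor
    · rintro ⟨rfl | h, rfl | h'⟩ <;> first | assumption | exact absurd rfl hvw
    · exact fun h => ⟨Or.inr h, Or.inr h⟩
  have hmem' := (S'.inter_face _ hvS _ hwS).subset ⟨hmem, hε⟩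
  rw [hi] at hmem'
  have h := map_eq_of_mem_affineSpan hg (convexHull_subset_affineSpan _ hmem')
  rw [map_add, map_smul, map_smul, map_barycenter hn g hg, smul_eq_mul, smul_eq_mul] at h
  have : 0 < ε * (g v - c) := mul_pos hε0 (by linarith)
  linarith

theorem IsSubdivision.exists_mem_faces {S S' : GeomComplex E} (hsub : IsSubdivision S' S)
    {s : Finset E} (hs : s ∈ S.faces) {x : E} (hx : x ∈ convexHull ℝ (s : Set E)) :
    ∃ ρ ∈ S'.faces, convexHull ℝ (ρ : Set E) ⊆ convexHull ℝ (s : Set E) ∧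
      x ∈ convexHull ℝ (ρ : Set E) := by
  rw [hsub.2 s hs, Set.mem_iUnion₂] at hx
  obtain ⟨u, hu, hxu⟩ := hx
  obtain ⟨hu, hus⟩ := mem_filter.1 hu
  simp only [Finset.bind_def, Finset.pure_def, sup_singleton_apply, mem_image] at hu
  obtain ⟨ρ, hρ, rfl⟩ := hu
  exact ⟨ρ, hρ, hus, hxu⟩

theorem exists_insert_mem_faces {F : Type*} [NormedAddCommGroup F] [NormedSpace ℝ F]
    {S S' : GeomComplex F} (hsub : IsSubdivision S' S) {s t : Finset F} (hs : s ∈ S.faces)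
    (ht : t ∈ S'.faces) (hc : s.card = t.card + 1)
    (hts : convexHull ℝ (t : Set F) ⊆ convexHull ℝ (s : Set F))
    {g : F →ₗ[ℝ] ℝ} {c : ℝ} (hg : ∀ x ∈ t, g x = c) {x : F} (hx : x ∈ s) (hgx : c < g x) :
    ∃ v, insert v t ∈ S'.faces ∧
      convexHull ℝ ((insert v t : Finset F) : Set F) ⊆ convexHull ℝ (s : Set F) ∧ c < g v := by
  have hn := S'.nonempty_of_mem t ht
  have hb := barycenter_mem_convexHull hn
  have hlt : ∀ᶠ ε : ℝ in nhdsWithin 0 (Set.Ioi 0), ε < 1 :=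
    nhdsWithin_le_nhds (Iio_mem_nhds zero_lt_one)
  set p : ℝ → F := fun ε => (1 - ε) • barycenter t + ε • x with hp
  have hpt : Filter.Tendsto p (nhdsWithin 0 (Set.Ioi 0)) (nhds (barycenter t)) := by
    have : Continuous p := by fun_prop
    have h0 : p 0 = barycenter t := by simp [hp]
    exact h0 ▸ (this.tendsto 0).mono_left nhdsWithin_le_nhds
  obtain ⟨ρ, hρ, hfreq⟩ : ∃ ρ : Finset F, ρ ∈ S'.faces.filter (fun τ : Finset F =>
        convexHull ℝ (τ : Set F) ⊆ convexHull ℝ (s : Set F)) ∧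
      ∃ᶠ ε in nhdsWithin 0 (Set.Ioi 0), p ε ∈ convexHull ℝ (ρ : Set F) := by
    by_contra! h
    rw [← Filter.eventually_all_finset] at h
    obtain ⟨ε, ⟨h1, h2⟩, h3⟩ := ((h.and hlt).and self_mem_nhdsWithin).exists
    replace h3 : 0 < ε := h3
    have hmem : p ε ∈ convexHull ℝ (s : Set F) :=
      convex_convexHull ℝ _ (hts hb) (subset_convexHull ℝ _ hx) (by linarith) h3.le (by ring)
    obtain ⟨ρ, hρ, hρs, hmem⟩ := hsub.exists_mem_faces hs hmem
    exact h1 ρ (mem_filter.2 ⟨hρ, hρs⟩) hmem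
  obtain ⟨hρS, hρs⟩ := mem_filter.1 hρ
  have hbρ : barycenter t ∈ convexHull ℝ (ρ : Set F) :=
    (ρ.finite_toSet.isClosed_convexHull ℝ).mem_of_frequently_of_tendsto hfreq hpt
  have htρ : t ⊆ ρ := inter_eq_left.1 <|
    eq_of_barycenter_mem_convexHull (S'.indep t ht) inter_subset_left
      ((S'.inter_face t ht ρ hρS).subset ⟨hb, hbρ⟩)
  obtain ⟨ε, hε, hε0⟩ := (hfreq.and_eventually self_mem_nhdsWithin).exists
  replace hε0 : 0 < ε := hε0
  have hgp : c < g (p ε) := by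
    have : g (p ε) = (1 - ε) * c + ε * g x := by
      simp [hp, map_barycenter hn g hg]
    have h2 : 0 < ε * (g x - c) := mul_pos hε0 (by linarith)
    linarith
  obtain ⟨v, hv, hgv⟩ : ∃ v ∈ ρ, c < g v := by
    by_contra! h
    exact hgp.not_ge (convexHull_min (s := (ρ : Set F)) (t := {y | g y ≤ c}) h
      (convex_halfSpace_le g.isLinear c) hε)
  have hvt : v ∉ t := fun h => hgv.ne' (hg v h)
  have hcard : ρ.card ≤ s.card := (S'.indep ρ hρS).card_le_card_of_subset_affineSpan fun y hy =>
    convexHull_subset_affineSpan _ (hρs (subset_convexHull ℝ _ hy))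
  have : insert v t = ρ := eq_of_subset_of_card_le (insert_subset hv htρ) (by
    rw [card_insert_of_notMem hvt]; omega)
  exact ⟨v, this ▸ hρS, this ▸ hρs, hgv⟩

/-- Exactly one coface of `t` inside `s` lies on each side of `t` that meets `s`. -/
theorem card_cofacesIn_filter {F : Type*} [NormedAddCommGroup F] [NormedSpace ℝ F]
    {S S' : GeomComplex F} (hsub : IsSubdivision S' S) {s t : Finset F} (hs : s ∈ S.faces)
    (ht : t ∈ S'.faces) (hc : s.card = t.card + 1)
    (hts : convexHull ℝ (t : Set F) ⊆ convexHull ℝ (s : Set F))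
    {g : F →ₗ[ℝ] ℝ} {c : ℝ} (hg : ∀ x ∈ t, g x = c) :
    ((cofacesIn S'.faces s t).filter fun ρ => ∃ v ∈ ρ, c < g v).card =
      if ∃ x ∈ s, c < g x then 1 else 0 := by
  have hts' : (t : Set F) ⊆ affineSpan ℝ (s : Set F) := fun y hy =>
    convexHull_subset_affineSpan _ (hts (subset_convexHull ℝ _ hy))
  have hform : ∀ ρ ∈ cofacesIn S'.faces s t, ∀ v ∈ ρ, c < g v →
      ρ = insert v t ∧ v ∈ convexHull ℝ (s : Set F) ∧ insert v t ∈ S'.faces := by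
    intro ρ hρ v hv hgv
    obtain ⟨hρS, ⟨htρ, hρc⟩, -, hρs⟩ := mem_filter.1 hρ
    have hvt : v ∉ t := fun h => hgv.ne' (hg v h)
    have : insert v t = ρ := eq_of_subset_of_card_le (insert_subset hv htρ) (by
      rw [card_insert_of_notMem hvt]; omega)
    exact ⟨this.symm, hρs (subset_convexHull ℝ _ hv), this ▸ hρS⟩
  split_ifs with h
  · obtain ⟨x, hx, hgx⟩ := h
    obtain ⟨v, hvS, hvs, hgv⟩ := exists_insert_mem_faces hsub hs ht hc hts hg hx hgx
    have hvt : v ∉ t := fun h => hgv.ne' (hg v h)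
    refine card_eq_one.2 ⟨insert v t, ?_⟩
    ext ρ
    rw [mem_filter, mem_singleton]
    constructor
    · rintro ⟨hρ, w, hw, hgw⟩
      obtain ⟨rfl, hws, hwS⟩ := hform ρ hρ w hw hgw
      rw [eq_of_insert_mem_faces S' (S'.indep t ht) (S.indep s hs) (S'.nonempty_of_mem t ht) hc hts'
        hg (convexHull_subset_affineSpan _ hws)
        (convexHull_subset_affineSpan _ (hvs (subset_convexHull ℝ _ (by simp)))) hgw hgv hwS hvS]
    · rintro rfl
      refine ⟨mem_filter.2 ⟨hvS, ⟨subset_insert _ _, card_insert_of_notMem hvt⟩, ?_, hvs⟩,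
        v, mem_insert_self _ _, hgv⟩
      rw [card_insert_of_notMem hvt, hc]
  · rw [card_eq_zero, filter_eq_empty_iff]
    rintro ρ hρ ⟨v, hv, hgv⟩
    push Not at h
    exact hgv.not_ge (convexHull_min (s := (s : Set F)) (t := {y | g y ≤ c}) h
      (convex_halfSpace_le g.isLinear c) (hform ρ hρ v hv hgv).2.1)

theorem card_cofacesIn {F : Type*} [NormedAddCommGroup F] [NormedSpace ℝ F]
    {S S' : GeomComplex F} (hsub : IsSubdivision S' S) {s t : Finset F} (hs : s ∈ S.faces)
    (ht : t ∈ S'.faces) (hc : s.card = t.card + 1)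
    (hts : convexHull ℝ (t : Set F) ⊆ convexHull ℝ (s : Set F))
    {g : F →ₗ[ℝ] ℝ} {c : ℝ} (hg : ∀ x ∈ t, g x = c) (hgs : ∃ x ∈ s, g x ≠ c) :
    (cofacesIn S'.faces s t).card =
      (if ∃ x ∈ s, c < g x then 1 else 0) + if ∃ x ∈ s, g x < c then 1 else 0 := by
  have hpos := card_cofacesIn_filter hsub hs ht hc hts hg
  have hneg := card_cofacesIn_filter hsub hs ht hc hts (g := -g) (c := -c) (by simpa using hg)
  simp only [LinearMap.neg_apply, neg_lt_neg_iff] at hneg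
  rw [← hpos, ← hneg, ← card_union_of_disjoint, ← filter_or, filter_true_of_mem]
  · intro ρ hρ
    obtain ⟨hρS, ⟨htρ, hρc⟩, -, hρs⟩ := mem_filter.1 hρ
    by_contra! h
    have heq : ∀ x ∈ ρ, g x = c := fun x hx => le_antisymm (h.1 x hx) (h.2 x hx)
    obtain ⟨x, hx, hgx⟩ := hgs
    refine hgx (map_eq_of_mem_affineSpan heq ?_)
    rw [affineSpan_eq_of_subset_of_card_eq (S'.indep ρ hρS) (S.indep s hs)
      (fun y hy => convexHull_subset_affineSpan _ (hρs (subset_convexHull ℝ _ hy)))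
      (by omega) ⟨x, hx⟩]
    exact subset_affineSpan ℝ _ hx
  · rw [disjoint_filter]
    rintro ρ hρ ⟨v, hv, hgv⟩ ⟨w, hw, hgw⟩
    obtain ⟨hρS, ⟨htρ, hρc⟩, -, hρs⟩ := mem_filter.1 hρ
    have hvt : v ∉ t := fun h => hgv.ne' (hg v h)
    have : insert v t = ρ := eq_of_subset_of_card_le (insert_subset hv htρ) (by
      rw [card_insert_of_notMem hvt]; omega)
    rw [← this, mem_insert] at hw
    obtain rfl | hw := hw
    · exact lt_asymm hgv hgw
    · exact hgw.ne (hg w hw)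

/-- A functional that is constant on `t` is constant on any facet containing `t`. -/
theorem map_eq_of_mem_facetsContaining {s t τ : Finset E}
    (hs : AffineIndependent ℝ ((↑) : s → E)) (ht : AffineIndependent ℝ ((↑) : t → E))
    {g : E →ₗ[ℝ] ℝ} {c : ℝ} (hg : ∀ x ∈ t, g x = c)
    (hτ : τ ∈ facetsContaining s t) {x : E} (hx : x ∈ τ) : g x = c := by
  obtain ⟨hτs, hτc, htτ⟩ := mem_filter.1 hτ
  have hτi : AffineIndependent ℝ ((↑) : τ → E) := hs.mono (mem_powerset.1 hτs)
  refine map_eq_of_mem_affineSpan hg ?_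
  rw [affineSpan_eq_of_subset_of_card_eq ht hτi
    (fun y hy => convexHull_subset_affineSpan _ (htτ (subset_convexHull ℝ _ hy))) hτc ⟨x, hx⟩]
  exact subset_affineSpan ℝ _ hx

/-- If `s` lies on one side of `t`, then precisely one facet of `s` contains `t`. -/
theorem card_facetsContaining_of_le {s t : Finset E}
    (hs : AffineIndependent ℝ ((↑) : s → E)) (ht : AffineIndependent ℝ ((↑) : t → E))
    (hc : s.card = t.card + 1)
    (hts : convexHull ℝ (t : Set E) ⊆ convexHull ℝ (s : Set E))
    {g : E →ₗ[ℝ] ℝ} {c : ℝ} (hg : ∀ x ∈ t, g x = c) (hgs : ∃ x ∈ s, g x ≠ c)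
    (hle : ∀ x ∈ s, c ≤ g x) : (facetsContaining s t).card = 1 := by
  set Z := s.filter fun x => g x = c with hZ
  have htZ : (t : Set E) ⊆ convexHull ℝ (Z : Set E) := by
    intro y hy
    obtain ⟨w, hw0, hw1, hwy⟩ := Finset.mem_convexHull'.1 (hts (subset_convexHull ℝ _ hy))
    have hsum : ∑ x ∈ s, w x * (g x - c) = 0 := by
      simp only [mul_sub, sum_sub_distrib, ← sum_mul, hw1]
      have := congrArg g hwy
      rw [map_sum, hg y hy] at this
      simp only [map_smul, smul_eq_mul] at this
      linarith
    have hzero : ∀ x ∈ s, w x ≠ 0 → g x = c := fun x hx hwx => by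
      have := (sum_eq_zero_iff_of_nonneg fun x hx =>
        mul_nonneg (hw0 x hx) (sub_nonneg.2 (hle x hx))).1 hsum x hx
      exact sub_eq_zero.1 ((mul_eq_zero.1 this).resolve_left hwx)
    refine Finset.mem_convexHull'.2 ⟨w, fun x hx => hw0 x (mem_filter.1 hx).1, ?_, ?_⟩
    · rw [hZ, sum_filter_of_ne hzero, hw1]
    · rw [hZ, sum_filter_of_ne fun x hx h => hzero x hx (left_ne_zero_of_smul h), hwy]
  have hZc : t.card = Z.card := by
    have h1 := ht.card_le_card_of_subset_affineSpan
      (htZ.trans (convexHull_subset_affineSpan _))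
    obtain ⟨x, hx, hgx⟩ := hgs
    have h2 : Z.card < s.card := card_lt_card (filter_ssubset.2 ⟨x, hx, hgx⟩)
    omega
  refine card_eq_one.2 ⟨Z, ?_⟩
  ext τ
  rw [mem_singleton]
  constructor
  · intro hτ
    have hτ' := mem_filter.1 hτ
    refine eq_of_subset_of_card_le (fun x hx => mem_filter.2 ⟨mem_powerset.1 hτ'.1 hx,
      map_eq_of_mem_facetsContaining hs ht hg hτ hx⟩) ?_
    rw [← hZc, hτ'.2.1]
  · rintro rfl
    exact mem_filter.2 ⟨mem_powerset.2 (filter_subset _ _), hZc,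
      convexHull_min htZ (convex_convexHull ℝ _)⟩

theorem odd_card_cofacesIn_iff {F : Type*} [NormedAddCommGroup F] [NormedSpace ℝ F]
    {S S' : GeomComplex F} (hsub : IsSubdivision S' S) {s t : Finset F} (hs : s ∈ S.faces)
    (ht : t ∈ S'.faces) (hc : s.card = t.card + 1) :
    Odd (cofacesIn S'.faces s t).card ↔ Odd (facetsContaining s t).card := by
  by_cases hts : convexHull ℝ (t : Set F) ⊆ convexHull ℝ (s : Set F)
  swap
  · have h1 : cofacesIn S'.faces s t = ∅ := filter_eq_empty_iff.2 fun ρ _ h =>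
      hts ((convexHull_mono (coe_subset.2 h.1.1)).trans h.2.2)
    have h2 : facetsContaining s t = ∅ := filter_eq_empty_iff.2 fun τ hτ h =>
      hts (h.2.trans (convexHull_mono (coe_subset.2 (mem_powerset.1 hτ))))
    rw [h1, h2]
  have hn := S'.nonempty_of_mem t ht
  have hsi := S.indep s hs
  have hti := S'.indep t ht
  obtain ⟨g, c, hg, hgs⟩ := exists_linearMap_eq_const hsi hc hn
  rw [card_cofacesIn hsub hs ht hc hts hg hgs]
  by_cases hP : ∃ x ∈ s, c < g x <;> by_cases hN : ∃ x ∈ s, g x < c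
  · have : facetsContaining s t = ∅ := by
      refine eq_empty_of_forall_notMem fun τ hτ => ?_
      obtain ⟨x, hx, hgx⟩ := hP
      obtain ⟨y, hy, hgy⟩ := hN
      have hτ' := mem_filter.1 hτ
      have hxτ : x ∉ τ := fun h => hgx.ne' (map_eq_of_mem_facetsContaining hsi hti hg hτ h)
      have hyτ : y ∉ τ := fun h => hgy.ne (map_eq_of_mem_facetsContaining hsi hti hg hτ h)
      have hxy : x ≠ y := by rintro rfl; exact lt_asymm hgx hgy
      have := card_le_card (insert_subset hx (insert_subset hy (mem_powerset.1 hτ'.1)))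
      rw [card_insert_of_notMem (by simp [hxy, hxτ]), card_insert_of_notMem hyτ] at this
      have := hτ'.2.1
      omega
    simp [hP, hN, this, Nat.odd_iff]
  · rw [card_facetsContaining_of_le hsi hti hc hts hg hgs (by simpa using hN)]
    simp only [hP, hN, if_true, if_false]
  · rw [card_facetsContaining_of_le hsi hti hc hts (g := -g) (c := -c) (by simpa using hg)
      (by simpa using hgs) (by simpa using hP)]
    simp only [hP, hN, if_true, if_false]
  · push Not at hP hN
    obtain ⟨x, hx, hgx⟩ := hgs
    exact absurd (le_antisymm (hP x hx) (hN x hx)) hgx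

/-- Double counting modulo two. -/
theorem odd_card_filter_odd_iff {ι κ : Type*} (A : Finset ι) (B : Finset κ) (Q : ι → Prop)
    (R : ι → κ → Prop) [DecidablePred Q] [∀ a, DecidablePred (R a)] :
    Odd ((A.filter fun a => Odd (B.filter (R a)).card).filter Q).card ↔
      Odd (∑ b ∈ B, (A.filter fun a => Q a ∧ R a b).card) := by
  rw [filter_comm, ← odd_sum_iff_odd_card_odd]
  have := sum_card_bipartiteAbove_eq_sum_card_bipartiteBelow (s := A.filter Q) (t := B) R
  simp only [bipartiteAbove, bipartiteBelow, filter_filter] at this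
  rw [this]

theorem mem_geomBoundary {V : Type*} {α : Finset (Finset V)} {τ : Finset V} :
    τ ∈ geomBoundary α ↔ Odd (α.filter fun σ => τ ⊆ σ ∧ σ.card = τ.card + 1).card := by
  refine ⟨fun h => (mem_filter.1 h).2, fun h => mem_filter.2 ⟨?_, h⟩⟩
  obtain ⟨σ, hσ⟩ := card_pos.1 h.pos
  obtain ⟨hσ, hτ, -⟩ := mem_filter.1 hσ
  exact mem_biUnion.2 ⟨σ, hσ, mem_powerset.2 hτ⟩

theorem odd_sum_congr {ι : Type*} {A : Finset ι} {f g : ι → ℕ}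
    (h : ∀ a ∈ A, (Odd (f a) ↔ Odd (g a))) : Odd (∑ a ∈ A, f a) ↔ Odd (∑ a ∈ A, g a) := by
  rw [odd_sum_iff_odd_card_odd, odd_sum_iff_odd_card_odd, filter_congr h]

/-- The subdivision map commutes with the boundary operators in any real normed space. -/
theorem geomBoundary_subdivChain_of_normedSpace {F : Type*} [NormedAddCommGroup F]
    [NormedSpace ℝ F] {S S' : GeomComplex F} (hsub : IsSubdivision S' S) {m : ℕ} (hm : 1 ≤ m)
    {α : Finset (Finset F)} (hα : ∀ σ ∈ α, σ ∈ S.faces ∧ σ.card = m + 1) :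
    geomBoundary (subdivChain S'.faces α) = subdivChain S'.faces (geomBoundary α) := by
  ext t
  by_cases ht : t ∈ S'.faces
  swap
  · refine iff_of_false (fun h => ?_) fun h => ht (mem_filter.1 h).1
    obtain ⟨ρ, hρ⟩ := card_pos.1 (mem_geomBoundary.1 h).pos
    obtain ⟨hρ, htρ, hc⟩ := mem_filter.1 hρ
    obtain ⟨hρS, hodd⟩ := mem_filter.1 hρ
    obtain ⟨σ, hσ⟩ := card_pos.1 hodd.pos
    obtain ⟨hσ, hρσ, -⟩ := mem_filter.1 hσ
    have := (hα σ hσ).2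
    exact ht (S'.down_closed ρ hρS t htρ (card_pos.1 (by omega)))
  rw [mem_geomBoundary, subdivChain, subdivChain, mem_filter, odd_card_filter_odd_iff, geomBoundary,
    odd_card_filter_odd_iff]
  simp only [ht, true_and]
  refine odd_sum_congr fun s hs => ?_
  have hfac : (((α.biUnion fun σ => σ.powerset).filter fun τ : Finset F =>
      (t.card = τ.card ∧ convexHull ℝ (t : Set F) ⊆
        convexHull ℝ (τ : Set F)) ∧
      τ ⊆ s ∧ s.card = τ.card + 1)) =
      if s.card = t.card + 1 then facetsContaining s t else ∅ := by
    ext τ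
    split_ifs with hc <;>
    simp only [facetsContaining, mem_filter, mem_biUnion, mem_powerset, notMem_empty]
    · exact ⟨fun h => ⟨h.2.2.1, h.2.1⟩, fun h => ⟨⟨s, hs, h.1⟩, h.2, h.1, by omega⟩⟩
    · exact iff_of_false (fun h => hc (by omega)) id
  rw [hfac]
  split_ifs with hc
  · exact odd_card_cofacesIn_iff hsub (hα s hs).1 ht hc
  · rw [filter_false_of_mem]
    rintro ρ - ⟨⟨-, h1⟩, h2, -⟩
    exact hc (by omega)

/-- The subdivision map on `𝔽₂`-chains commutes with the boundary operators:
`∂ ⟦α⟧ = ⟦∂ α⟧` for every `m ≥ 1` and every `m`-chain `α` of `S`. -/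
theorem geomBoundary_subdivChain (d : ℕ)
    (S S' : GeomComplex (EuclideanSpace ℝ (Fin d)))
    (hsub : IsSubdivision S' S) (m : ℕ) (hm : 1 ≤ m)
    (α : Finset (Finset (EuclideanSpace ℝ (Fin d))))
    (hα : ∀ σ ∈ α, σ ∈ S.faces ∧ σ.card = m + 1) :
    geomBoundary (subdivChain S'.faces α) = subdivChain S'.faces (geomBoundary α) := by
  exact geomBoundary_subdivChain_of_normedSpace hsub hm hα
end

section
/- Alexander's lemma: Let S be a geometric simplicial complex in ℝ^d, let S′ be a subdivision of S, and let φ: S′ → S be a pseudo-identical simplicial map. Then φ_*(⟦α⟧) = α for every m ≥ 0 and every m-chain α of S. -/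
open scoped Classical
open Finset

variable {E : Type*} [AddCommGroup E] [Module ℝ E]

/-- The map induced on `𝔽₂`-chains by a map `φ` of vertices: a simplex `ρ` occurs in
`φ_* α` iff `ρ` is the image, with the same number of vertices, of an odd number of
simplices of `α`. -/
noncomputable def geomPush {E : Type*} (φ : E → E) (α : Finset (Finset E)) :
    Finset (Finset E) :=
  (α.image fun σ => σ.image φ).filter fun ρ =>
    Odd (α.filter fun σ : Finset E => σ.image φ = ρ ∧ σ.card = ρ.card).card

/-- A simplicial map `φ : S' → S` is pseudo-identical if for every vertex `v` of `S'`
its image `φ v` is a vertex of the carrier of `v` in `S`; equivalently, `φ v` is a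
vertex of every simplex of `S` containing `v`. -/
def PseudoIdentical (S' S : GeomComplex E) (φ : E → E) : Prop :=
  ∀ v ∈ S'.faces.biUnion id, ∀ σ ∈ S.faces,
    v ∈ convexHull ℝ (σ : Set E) → φ v ∈ σ

section Geometry

variable {V : Type*} [NormedAddCommGroup V] [NormedSpace ℝ V]

theorem AffineMap.nonneg_of_mem_convexHull (f : V →ᵃ[ℝ] ℝ) {s : Set V}
    (hf : ∀ x ∈ s, 0 ≤ f x) {x : V} (hx : x ∈ convexHull ℝ s) : 0 ≤ f x :=
  convexHull_min (t := f ⁻¹' Set.Ici 0) hf ((convex_Ici 0).affine_preimage f) hx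

theorem AffineMap.eq_zero_of_mem_affineSpan (f : V →ᵃ[ℝ] ℝ) {s : Set V}
    (hf : ∀ x ∈ s, f x = 0) {x : V} (hx : x ∈ affineSpan ℝ s) : f x = 0 := by
  have := AffineMap.eqOn_affineSpan (f := f) (g := AffineMap.const ℝ V (0 : ℝ)) (s := s)
    (fun y hy => by simpa using hf y hy) hx
  simpa using this

theorem AffineMap.apply_add_smul_sub (f : V →ᵃ[ℝ] ℝ) (x p : V) (ε : ℝ) :
    f (x + ε • (p - x)) = f x + ε * (f p - f x) := by
  have := f.apply_lineMap x p ε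
  simp only [AffineMap.lineMap_apply, vsub_eq_sub, vadd_eq_add, smul_eq_mul] at this
  rw [add_comm, this]; ring

/-- A vertex of an affinely independent set can be separated from the others by an affine
functional. -/
theorem AffineIndependent.exists_coord {s : Finset V}
    (hs : AffineIndependent ℝ ((↑) : s → V)) {w : V} (hw : w ∈ s) :
    ∃ f : V →ᵃ[ℝ] ℝ, f w = 1 ∧ ∀ u ∈ s, u ≠ w → f u = 0 := by
  obtain ⟨t, hst, hti, htop⟩ :=
    exists_subset_affineIndependent_affineSpan_eq_top (s := (s : Set V)) hs
  let b : AffineBasis t ℝ V := ⟨fun p => p, hti, by simpa using htop⟩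
  refine ⟨b.coord ⟨w, hst hw⟩, b.coord_apply_eq ⟨w, hst hw⟩, fun u hu huw => ?_⟩
  exact b.coord_apply_ne (i := ⟨w, hst hw⟩) (j := ⟨u, hst hu⟩) (by simpa using huw.symm)

theorem AffineIndependent.insert_of_notMem_affineSpan {s : Finset V}
    (hs : AffineIndependent ℝ ((↑) : s → V)) {p : V} (hp : p ∉ affineSpan ℝ (s : Set V)) :
    AffineIndependent ℝ ((↑) : ↥(insert p s) → V) := by
  refine AffineIndependent.affineIndependent_of_notMem_span
    (i := (⟨p, mem_insert_self p s⟩ : ↥(insert p s))) ?_ ?_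
  · let g : {y : ↥(insert p s) // y ≠ ⟨p, mem_insert_self p s⟩} ↪ s :=
      ⟨fun y => ⟨y.1.1, by
        have h1 := y.1.2
        have h2 : y.1.1 ≠ p := fun h => y.2 (Subtype.ext h)
        exact (mem_insert.1 h1).resolve_left h2⟩, fun y z h => Subtype.ext (Subtype.ext (by simpa using h))⟩
    exact hs.comp_embedding g
  · refine fun h => hp (affineSpan_mono ℝ ?_ h)
    rintro _ ⟨y, hy, rfl⟩
    have h2 : y.1 ≠ p := fun h => hy (Subtype.ext h)
    exact (mem_insert.1 y.2).resolve_left h2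

/-- The affine span of a wall is cut out of the affine span of a simplex by an affine
functional. -/
theorem AffineIndependent.exists_wall_functional {ρ σ : Finset V}
    (hρ : AffineIndependent ℝ ((↑) : ρ → V)) (hσ : AffineIndependent ℝ ((↑) : σ → V))
    (hne : ρ.Nonempty) (hsub : (ρ : Set V) ⊆ affineSpan ℝ (σ : Set V))
    (hcard : ρ.card + 1 = σ.card) :
    ∃ f : V →ᵃ[ℝ] ℝ, ∀ q ∈ affineSpan ℝ (σ : Set V),
      f q = 0 ↔ q ∈ affineSpan ℝ (ρ : Set V) := by
  obtain ⟨p, hpσ, hp⟩ : ∃ p ∈ σ, p ∉ affineSpan ℝ (ρ : Set V) := by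
    by_contra! h
    have := hσ.card_le_card_of_subset_affineSpan (t := ρ) h
    omega
  have hpρ : p ∉ ρ := fun h => hp (subset_affineSpan ℝ _ h)
  have hins := hρ.insert_of_notMem_affineSpan hp
  obtain ⟨f, hfp, hf⟩ := hins.exists_coord (mem_insert_self p ρ)
  have hf0 : ∀ u ∈ (ρ : Set V), f u = 0 := fun u hu =>
    hf u (mem_insert_of_mem hu) fun h => hpρ (h ▸ hu)
  have hle : affineSpan ℝ ((insert p ρ : Finset V) : Set V) ≤ affineSpan ℝ (σ : Set V) := by
    rw [affineSpan_le, coe_insert]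
    exact Set.insert_subset (subset_affineSpan ℝ _ hpσ) hsub
  have heq : affineSpan ℝ ((insert p ρ : Finset V) : Set V) = affineSpan ℝ (σ : Set V) := by
    by_contra h
    have := hins.card_lt_card_of_affineSpan_lt_affineSpan (lt_of_le_of_ne hle h)
    rw [card_insert_of_notMem hpρ] at this
    omega
  refine ⟨f, fun q hq => ⟨fun hfq => ?_, fun h => f.eq_zero_of_mem_affineSpan hf0 h⟩⟩
  obtain ⟨c, hc⟩ := hne
  have hcs : c ∈ affineSpan ℝ (ρ : Set V) := subset_affineSpan ℝ _ hc
  rw [← heq, coe_insert, ← affineSpan_insert_affineSpan,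
    AffineSubspace.mem_affineSpan_insert_iff hcs] at hq
  obtain ⟨r, p0, hp0, rfl⟩ := hq
  have h0 := f.eq_zero_of_mem_affineSpan hf0 hp0
  have : f (r • (p -ᵥ c) +ᵥ p0) = r := by
    rw [AffineMap.map_vadd, h0, map_smul, AffineMap.linearMap_vsub, hfp, hf0 c hc]
    simp
  rw [this] at hfq
  simpa [hfq] using hp0

theorem exists_relative_interior_point [FiniteDimensional ℝ V] {ρ : Finset V}
    (hne : ρ.Nonempty) :
    ∃ x ∈ convexHull ℝ (ρ : Set V), ∀ p ∈ affineSpan ℝ (ρ : Set V),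
      ∀ᶠ ε in nhds (0 : ℝ), x + ε • (p - x) ∈ convexHull ℝ (ρ : Set V) := by
  obtain ⟨x, hx⟩ := Set.Nonempty.intrinsicInterior (convex_convexHull ℝ (ρ : Set V))
    (convexHull_nonempty_iff.2 hne)
  obtain ⟨y, hy, rfl⟩ := mem_intrinsicInterior.1 hx
  refine ⟨y, interior_subset (s := (Subtype.val ⁻¹' convexHull ℝ (ρ : Set V) : Set (affineSpan ℝ _))) hy, fun p hp => ?_⟩
  have hp' : p ∈ affineSpan ℝ (convexHull ℝ (ρ : Set V)) := by rwa [affineSpan_convexHull]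
  let g : ℝ → affineSpan ℝ (convexHull ℝ (ρ : Set V)) := fun ε =>
    ⟨y.1 + ε • (p - y.1), by
      have := AffineMap.lineMap_mem ε y.2 hp'
      simpa [AffineMap.lineMap_apply, add_comm] using this⟩
  have hg : Continuous g := Continuous.subtype_mk (by fun_prop) _
  have h0 : g 0 = y := Subtype.ext (by simp [g])
  have := hg.continuousAt.preimage_mem_nhds (x := 0)
    (by rw [h0]; exact mem_interior_iff_mem_nhds.1 hy)
  exact this

/-- A face of a simplex cut out by a supporting functional misses the vertices off it. -/
theorem mem_convexHull_erase_of_eq_zero {σ : Finset V} (f : V →ᵃ[ℝ] ℝ)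
    (hf : ∀ u ∈ σ, 0 ≤ f u) {v : V} (hv : v ∈ σ) (hfv : 0 < f v) {w : V}
    (hw : w ∈ convexHull ℝ (σ : Set V)) (hfw : f w = 0) :
    w ∈ convexHull ℝ ((σ.erase v : Finset V) : Set V) := by
  by_cases hne : (σ.erase v).Nonempty
  · rw [← insert_erase hv, coe_insert, convexHull_insert (by exact_mod_cast hne),
      mem_convexJoin] at hw
    obtain ⟨v', rfl, q, hq, hseg⟩ := hw
    obtain ⟨a, b, ha, hb, hab, rfl⟩ := hseg
    have hfq : 0 ≤ f q := f.nonneg_of_mem_convexHull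
      (fun u hu => hf u (mem_of_mem_erase hu)) hq
    have e : a • v' + b • q = q + a • (v' - q) := by
      rw [← sub_eq_iff_eq_add'.2 hab.symm] ; module
    rw [e, f.apply_add_smul_sub] at hfw
    have : a = 0 := by
      by_contra h
      have : 0 < a := lt_of_le_of_ne ha (Ne.symm h)
      have : a ≤ 1 := by linarith
      nlinarith [mul_nonneg hb hfq, mul_pos ‹0 < a› hfv]
    rw [e, this]; simpa using hq
  · have hσ : σ = {v} := by
      rw [not_nonempty_iff_eq_empty] at hne
      rw [← insert_erase hv, hne]
      rfl
    subst hσ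
    simp at hw
    subst hw
    linarith

end Geometry

section Subdivision

variable {V : Type*} [NormedAddCommGroup V] [NormedSpace ℝ V]

/-- `S'` covers the geometric simplex with vertex set `σ` by simplices contained in it. -/
def GeomComplex.CoversSimplex (S' : GeomComplex V) (σ : Finset V) : Prop :=
  ∀ x ∈ convexHull ℝ (σ : Set V), ∃ τ ∈ S'.faces,
    convexHull ℝ (τ : Set V) ⊆ convexHull ℝ (σ : Set V) ∧ x ∈ convexHull ℝ (τ : Set V)

theorem IsSubdivision.coversSimplex {S' S : GeomComplex V} (h : IsSubdivision S' S)
    {σ : Finset V} (hσ : σ ∈ S.faces) : S'.CoversSimplex σ := by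
  intro x hx
  rw [h.2 σ hσ] at hx
  simp only [mem_filter, Set.mem_iUnion, exists_prop] at hx
  obtain ⟨_, ⟨h1, h2⟩, h3⟩ := hx
  replace h1 := mem_sup.1 h1
  obtain ⟨τ, hτ, h1⟩ := h1
  obtain rfl := mem_singleton.1 h1
  exact ⟨τ, hτ, h2, h3⟩

/-- A simplex containing a relative interior point of another simplex has it as a face. -/
theorem GeomComplex.subset_of_relative_interior_point (S' : GeomComplex V) {ρ τ : Finset V}
    (hρ : ρ ∈ S'.faces) (hτ : τ ∈ S'.faces) {x : V} (hxρ : x ∈ convexHull ℝ (ρ : Set V))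
    (hrel : ∀ p ∈ affineSpan ℝ (ρ : Set V),
      ∀ᶠ ε in nhds (0 : ℝ), x + ε • (p - x) ∈ convexHull ℝ (ρ : Set V))
    (hxτ : x ∈ convexHull ℝ (τ : Set V)) : ρ ⊆ τ := by
  intro w hw
  by_contra hwτ
  obtain ⟨f, hfw, hf⟩ := (S'.indep ρ hρ).exists_coord hw
  have hx : x ∈ convexHull ℝ ((ρ ∩ τ : Finset V) : Set V) := by
    rw [← S'.inter_face ρ hρ τ hτ]; exact ⟨hxρ, hxτ⟩
  have hfx : f x = 0 := f.eq_zero_of_mem_affineSpan (fun u hu => by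
    have hu := mem_inter.1 hu
    exact hf u hu.1 fun h => hwτ (h ▸ hu.2)) (convexHull_subset_affineSpan _ hx)
  have h1 := (hrel w (subset_affineSpan ℝ _ hw)).filter_mono
    (nhdsWithin_le_nhds (s := Set.Iio 0))
  obtain ⟨ε, hε, hε0⟩ := (h1.and self_mem_nhdsWithin).exists
  have h2 : 0 ≤ f (x + ε • (w - x)) := f.nonneg_of_mem_convexHull (fun u hu => by
    by_cases h : u = w
    · rw [h, hfw]; exact zero_le_one
    · rw [hf u hu h]) hε
  rw [f.apply_add_smul_sub, hfx, hfw] at h2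
  have : ε < 0 := hε0
  linarith

variable [FiniteDimensional ℝ V]

/-- On each side of a wall which meets the simplex `σ` there is a top-dimensional simplex of the
subdivision having that wall as a face. -/
theorem GeomComplex.CoversSimplex.exists_coface {S' : GeomComplex V} {σ ρ : Finset V}
    (hcov : S'.CoversSimplex σ) (hρ : ρ ∈ S'.faces)
    (hρσ : convexHull ℝ (ρ : Set V) ⊆ convexHull ℝ (σ : Set V))
    (hcard : ρ.card + 1 = σ.card) {f : V →ᵃ[ℝ] ℝ} (hf : ∀ u ∈ ρ, f u = 0)
    (hv : ∃ v ∈ σ, 0 < f v) :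
    ∃ τ ∈ S'.faces, τ.card = σ.card ∧ convexHull ℝ (τ : Set V) ⊆ convexHull ℝ (σ : Set V) ∧
      ρ ⊆ τ ∧ ∃ a ∈ τ, 0 < f a := by
  obtain ⟨v, hvσ, hfv⟩ := hv
  obtain ⟨x, hxρ, hrel⟩ := exists_relative_interior_point (S'.nonempty_of_mem ρ hρ)
  have hfx : f x = 0 := f.eq_zero_of_mem_affineSpan hf (convexHull_subset_affineSpan _ hxρ)
  have hclosed : ∀ᶠ ε in nhds (0 : ℝ), ∀ τ ∈ S'.faces,
      x + ε • (v - x) ∈ convexHull ℝ (τ : Set V) → x ∈ convexHull ℝ (τ : Set V) := by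
    rw [Filter.eventually_all_finset]
    intro τ _
    by_cases hxτ : x ∈ convexHull ℝ (τ : Set V)
    · exact Filter.Eventually.of_forall fun _ _ => hxτ
    · have hc : Continuous fun ε : ℝ => x + ε • (v - x) := by fun_prop
      have := hc.continuousAt.eventually_mem (x := 0)
        ((τ.finite_toSet.isClosed_convexHull ℝ).isOpen_compl.mem_nhds (by simpa using hxτ))
      exact this.mono fun ε h h' => absurd h' h
  obtain ⟨ε, ⟨hε, hε1⟩, hε0⟩ := (((hclosed.and (eventually_lt_nhds (zero_lt_one' ℝ))).filter_mono
    (nhdsWithin_le_nhds (s := Set.Ioi 0))).and self_mem_nhdsWithin).exists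
  replace hε0 : 0 < ε := hε0
  have hyσ : x + ε • (v - x) ∈ convexHull ℝ (σ : Set V) :=
    (convex_convexHull ℝ _).add_smul_sub_mem (hρσ hxρ) (subset_convexHull ℝ _ hvσ)
      ⟨hε0.le, hε1.le⟩
  obtain ⟨τ, hτ, hτσ, hyτ⟩ := hcov _ hyσ
  have hρτ : ρ ⊆ τ := S'.subset_of_relative_interior_point hρ hτ hxρ hrel (hε τ hτ hyτ)
  obtain ⟨a, haτ, hfa⟩ : ∃ a ∈ τ, 0 < f a := by
    by_contra! h
    have h1 : 0 ≤ (-f) (x + ε • (v - x)) :=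
      (-f).nonneg_of_mem_convexHull (fun u hu => by simpa using h u hu) hyτ
    have h2 : 0 ≤ -(f (x + ε • (v - x))) := by simpa using h1
    rw [f.apply_add_smul_sub, hfx] at h2
    nlinarith [mul_pos hε0 hfv]
  refine ⟨τ, hτ, le_antisymm ?_ ?_, hτσ, hρτ, a, haτ, hfa⟩
  · exact (S'.indep τ hτ).card_le_card_of_subset_affineSpan
      ((subset_convexHull ℝ _).trans (hτσ.trans (convexHull_subset_affineSpan _)))
  · rw [← hcard]
    exact card_lt_card ⟨hρτ, fun h => by rw [hf a (h haτ)] at hfa; exact lt_irrefl _ hfa⟩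

/-- There is at most one top-dimensional simplex on each side of a wall. -/
theorem GeomComplex.coface_unique (S' : GeomComplex V) {σ ρ : Finset V} (hρ : ρ ∈ S'.faces)
    (hcard : ρ.card + 1 = σ.card) {f : V →ᵃ[ℝ] ℝ}
    (hf : ∀ q ∈ affineSpan ℝ (σ : Set V), f q = 0 ↔ q ∈ affineSpan ℝ (ρ : Set V))
    (hf0 : ∀ u ∈ ρ, f u = 0)
    {τ₁ τ₂ : Finset V} (h₁ : τ₁ ∈ S'.faces) (h₂ : τ₂ ∈ S'.faces)
    (hc₁ : τ₁.card = σ.card) (hc₂ : τ₂.card = σ.card)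
    (hσ₁ : convexHull ℝ (τ₁ : Set V) ⊆ convexHull ℝ (σ : Set V))
    (hσ₂ : convexHull ℝ (τ₂ : Set V) ⊆ convexHull ℝ (σ : Set V))
    (hρ₁ : ρ ⊆ τ₁) (hρ₂ : ρ ⊆ τ₂) (ha : ∃ a ∈ τ₁, 0 < f a) (hb : ∃ b ∈ τ₂, 0 < f b) :
    τ₁ = τ₂ := by
  obtain ⟨a, ha, hfa⟩ := ha
  obtain ⟨b, hb, hfb⟩ := hb
  have key : ∀ {τ : Finset V} {c : V}, ρ ⊆ τ → τ.card = σ.card → c ∈ τ → 0 < f c →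
      insert c ρ = τ := by
    intro τ c hρτ hcτ hc hfc
    have hcρ : c ∉ ρ := fun h => by rw [hf0 c h] at hfc; exact lt_irrefl _ hfc
    refine eq_of_subset_of_card_le (insert_subset hc hρτ) ?_
    rw [card_insert_of_notMem hcρ]; omega
  have e₁ := key hρ₁ hc₁ ha hfa
  have e₂ := key hρ₂ hc₂ hb hfb
  by_cases hab : a = b
  · rw [← e₁, ← e₂, hab]
  exfalso
  have hinter : τ₁ ∩ τ₂ ⊆ ρ := by
    rw [← e₁, ← e₂]
    intro u hu
    simp only [mem_inter, mem_insert] at hu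
    rcases hu with ⟨rfl | h, h' | h'⟩
    · exact absurd h' hab
    · exact h'
    · exact h
    · exact h
  obtain ⟨x, hxρ, hrel⟩ := exists_relative_interior_point (S'.nonempty_of_mem ρ hρ)
  have hfx : f x = 0 := f.eq_zero_of_mem_affineSpan hf0 (convexHull_subset_affineSpan _ hxρ)
  have hspan : ∀ {τ : Finset V} {c : V}, convexHull ℝ (τ : Set V) ⊆ convexHull ℝ (σ : Set V) →
      c ∈ convexHull ℝ (τ : Set V) → c ∈ affineSpan ℝ (σ : Set V) := fun h hc =>
    convexHull_subset_affineSpan _ (h hc)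
  have hx₁ : x ∈ convexHull ℝ (τ₁ : Set V) := convexHull_mono (by exact_mod_cast hρ₁) hxρ
  have hx₂ : x ∈ convexHull ℝ (τ₂ : Set V) := convexHull_mono (by exact_mod_cast hρ₂) hxρ
  have ha' := subset_convexHull ℝ (τ₁ : Set V) ha
  have hb' := subset_convexHull ℝ (τ₂ : Set V) hb
  set r : ℝ := f b / f a with hr
  have hr0 : 0 < r := div_pos hfb hfa
  set q : V := b - r • (a - x) with hq
  have hqσ : q ∈ affineSpan ℝ (σ : Set V) := by
    have := AffineSubspace.vadd_mem_of_mem_direction (Submodule.smul_mem _ (-r)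
      (AffineSubspace.vsub_mem_direction (hspan hσ₁ ha') (hspan hσ₁ hx₁))) (hspan hσ₂ hb')
    convert this using 1
    simp only [hq, vadd_eq_add, vsub_eq_sub]
    module
  have hfq : f q = 0 := by
    have e : q = (-r) • (a - x) +ᵥ b := by
      simp only [hq, vadd_eq_add]
      module
    have e' : a - x = a -ᵥ x := rfl
    rw [e, AffineMap.map_vadd, map_smul, e', AffineMap.linearMap_vsub, hfx]
    simp only [vsub_eq_sub, sub_zero, smul_eq_mul, vadd_eq_add, hr]
    field_simp
    ring
  have hqρ := (hf q hqσ).1 hfq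
  have hc2 : Filter.Tendsto (fun ε : ℝ => 2 * ε) (nhds 0) (nhds 0) := by
    have : Continuous fun ε : ℝ => 2 * ε := by fun_prop
    simpa using this.tendsto 0
  have hc2r : Filter.Tendsto (fun ε : ℝ => 2 * ε * r) (nhds 0) (nhds 0) := by
    have : Continuous fun ε : ℝ => 2 * ε * r := by fun_prop
    simpa using this.tendsto 0
  obtain ⟨ε, ⟨⟨hε, hεr⟩, hε1⟩, hε0⟩ := (((((hc2.eventually (hrel q hqρ)).and
    (hc2r.eventually (eventually_lt_nhds (zero_lt_one' ℝ)))).and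
    (eventually_lt_nhds (zero_lt_one' ℝ))).filter_mono
    (nhdsWithin_le_nhds (s := Set.Ioi 0))).and self_mem_nhdsWithin).exists
  replace hε0 : 0 < ε := hε0
  have hy₂ : x + ε • (b - x) ∈ convexHull ℝ (τ₂ : Set V) :=
    (convex_convexHull ℝ _).add_smul_sub_mem hx₂ hb' ⟨hε0.le, hε1.le⟩
  have hy₁ : x + ε • (b - x) ∈ convexHull ℝ (τ₁ : Set V) := by
    have h1 : x + (2 * ε) • (q - x) ∈ convexHull ℝ (τ₁ : Set V) :=
      convexHull_mono (by exact_mod_cast hρ₁) hε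
    have h2 : x + (2 * ε * r) • (a - x) ∈ convexHull ℝ (τ₁ : Set V) :=
      (convex_convexHull ℝ _).add_smul_sub_mem hx₁ ha' ⟨by positivity, hεr.le⟩
    have h3 := (convex_convexHull ℝ (τ₁ : Set V)) h1 h2 (a := 1 / 2) (b := 1 / 2)
      (by norm_num) (by norm_num) (by norm_num)
    convert h3 using 1
    rw [hq]
    module
  have hy : x + ε • (b - x) ∈ convexHull ℝ (ρ : Set V) :=
    convexHull_mono (by exact_mod_cast hinter)
      ((S'.inter_face τ₁ h₁ τ₂ h₂).subset ⟨hy₁, hy₂⟩)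
  have := f.eq_zero_of_mem_affineSpan hf0 (convexHull_subset_affineSpan _ hy)
  rw [f.apply_add_smul_sub, hfx] at this
  nlinarith [mul_pos hε0 hfb]

theorem GeomComplex.CoversSimplex.card_cofaces_pos {S' : GeomComplex V} {σ ρ : Finset V}
    (hcov : S'.CoversSimplex σ) (hρ : ρ ∈ S'.faces)
    (hρσ : convexHull ℝ (ρ : Set V) ⊆ convexHull ℝ (σ : Set V))
    (hcard : ρ.card + 1 = σ.card) {f : V →ᵃ[ℝ] ℝ}
    (hf : ∀ q ∈ affineSpan ℝ (σ : Set V), f q = 0 ↔ q ∈ affineSpan ℝ (ρ : Set V))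
    (hf0 : ∀ u ∈ ρ, f u = 0) :
    (S'.faces.filter fun τ : Finset V => (τ.card = σ.card ∧
      convexHull ℝ (τ : Set V) ⊆ convexHull ℝ (σ : Set V) ∧ ρ ⊆ τ) ∧ ∃ a ∈ τ, 0 < f a).card =
      if ∃ v ∈ σ, 0 < f v then 1 else 0 := by
  split_ifs with hv
  · obtain ⟨τ, hτ, h1, h2, h3, h4⟩ := hcov.exists_coface hρ hρσ hcard hf0 hv
    refine card_eq_one.2 ⟨τ, eq_singleton_iff_unique_mem.2
      ⟨mem_filter.2 ⟨hτ, ⟨h1, h2, h3⟩, h4⟩, fun τ' hτ' => ?_⟩⟩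
    obtain ⟨hτ', ⟨h1', h2', h3'⟩, h4'⟩ := mem_filter.1 hτ'
    exact S'.coface_unique hρ hcard hf hf0 hτ' hτ h1' h1 h2' h2 h3' h3 h4' h4
  · refine card_eq_zero.2 (filter_eq_empty_iff.2 ?_)
    rintro τ - ⟨⟨-, h2, -⟩, a, ha, hfa⟩
    push Not at hv
    have := (-f).nonneg_of_mem_convexHull (s := (σ : Set V)) (fun u hu => by simpa using hv u hu)
      (h2 (subset_convexHull ℝ _ ha))
    have h' : 0 ≤ -(f a) := by simpa using this
    linarith

/-- A wall is a face of an odd number of top-dimensional simplices of the subdivision of `σ` if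
and only if it lies in the boundary of `σ`. -/
theorem GeomComplex.CoversSimplex.odd_card_cofaces_iff {S' : GeomComplex V} {σ ρ : Finset V}
    (hσ : AffineIndependent ℝ ((↑) : σ → V)) (hcov : S'.CoversSimplex σ) (hρ : ρ ∈ S'.faces)
    (hρσ : convexHull ℝ (ρ : Set V) ⊆ convexHull ℝ (σ : Set V))
    (hcard : ρ.card + 1 = σ.card) :
    Odd (S'.faces.filter fun τ : Finset V => τ.card = σ.card ∧
      convexHull ℝ (τ : Set V) ⊆ convexHull ℝ (σ : Set V) ∧ ρ ⊆ τ).card ↔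
    ∃ v ∈ σ, convexHull ℝ (ρ : Set V) ⊆ convexHull ℝ ((σ.erase v : Finset V) : Set V) := by
  have hρi := S'.indep ρ hρ
  have hρs : (ρ : Set V) ⊆ convexHull ℝ (σ : Set V) := (subset_convexHull ℝ _).trans hρσ
  obtain ⟨f, hf⟩ := hρi.exists_wall_functional hσ (S'.nonempty_of_mem ρ hρ)
    (hρs.trans (convexHull_subset_affineSpan _)) hcard
  have hf0 : ∀ u ∈ ρ, f u = 0 := fun u hu =>
    (hf u (convexHull_subset_affineSpan _ (hρs hu))).2 (subset_affineSpan ℝ _ hu)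
  have hpos := hcov.card_cofaces_pos hρ hρσ hcard hf hf0
  have hneg := hcov.card_cofaces_pos hρ hρσ hcard (f := -f) (by simpa using hf)
    (by simpa using hf0)
  have hsplit : S'.faces.filter (fun τ : Finset V => τ.card = σ.card ∧
      convexHull ℝ (τ : Set V) ⊆ convexHull ℝ (σ : Set V) ∧ ρ ⊆ τ) =
      S'.faces.filter (fun τ : Finset V => (τ.card = σ.card ∧
        convexHull ℝ (τ : Set V) ⊆ convexHull ℝ (σ : Set V) ∧ ρ ⊆ τ) ∧ ∃ a ∈ τ, 0 < f a) ∪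
      S'.faces.filter (fun τ : Finset V => (τ.card = σ.card ∧
        convexHull ℝ (τ : Set V) ⊆ convexHull ℝ (σ : Set V) ∧ ρ ⊆ τ) ∧
          ∃ a ∈ τ, 0 < (-f) a) := by
    rw [← filter_or]
    refine filter_congr fun τ hτ => ⟨fun h => ?_, fun h => h.elim And.left And.left⟩
    obtain ⟨a, ha, hfa⟩ : ∃ a ∈ τ, f a ≠ 0 := by
      by_contra! h0
      have : (τ : Set V) ⊆ affineSpan ℝ (ρ : Set V) := fun a ha =>
        (hf a (convexHull_subset_affineSpan _ (h.2.1 (subset_convexHull ℝ _ ha)))).1 (h0 a ha)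
      have := (S'.indep τ hτ).card_le_card_of_subset_affineSpan this
      omega
    rcases lt_or_gt_of_ne hfa with h' | h'
    · exact Or.inr ⟨h, a, ha, by simpa using h'⟩
    · exact Or.inl ⟨h, a, ha, h'⟩
  have hdisj : Disjoint
      (S'.faces.filter (fun τ : Finset V => (τ.card = σ.card ∧
        convexHull ℝ (τ : Set V) ⊆ convexHull ℝ (σ : Set V) ∧ ρ ⊆ τ) ∧ ∃ a ∈ τ, 0 < f a))
      (S'.faces.filter (fun τ : Finset V => (τ.card = σ.card ∧
        convexHull ℝ (τ : Set V) ⊆ convexHull ℝ (σ : Set V) ∧ ρ ⊆ τ) ∧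
          ∃ a ∈ τ, 0 < (-f) a)) := by
    refine disjoint_filter.2 ?_
    rintro τ - ⟨⟨h1, -, h3⟩, a, ha, hfa⟩ ⟨-, b, hb, hfb⟩
    have hfb : f b < 0 := by simpa using hfb
    have haρ : a ∉ ρ := fun h => by rw [hf0 a h] at hfa; exact lt_irrefl _ hfa
    have hbρ : b ∉ insert a ρ := fun h => by
      rcases mem_insert.1 h with rfl | h
      · linarith
      · rw [hf0 b h] at hfb; exact lt_irrefl _ hfb
    have := card_le_card (insert_subset hb (insert_subset ha h3))
    rw [card_insert_of_notMem hbρ, card_insert_of_notMem haρ] at this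
    omega
  rw [hsplit, card_union_of_disjoint hdisj, hpos, hneg]
  have boundary : ∀ g : V →ᵃ[ℝ] ℝ, (∀ u ∈ ρ, g u = 0) → (∀ u ∈ σ, 0 ≤ g u) →
      (∃ v ∈ σ, 0 < g v) →
      ∃ v ∈ σ, convexHull ℝ (ρ : Set V) ⊆ convexHull ℝ ((σ.erase v : Finset V) : Set V) := by
    rintro g hg0 hg ⟨v, hv, hgv⟩
    exact ⟨v, hv, convexHull_min (fun w hw =>
      mem_convexHull_erase_of_eq_zero g hg hv hgv (hρs hw) (hg0 w hw)) (convex_convexHull ℝ _)⟩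
  by_cases hP : ∃ v ∈ σ, 0 < f v <;> by_cases hN : ∃ v ∈ σ, 0 < (-f) v
  · rw [if_pos hP, if_pos hN]
    refine iff_of_false (by decide) ?_
    rintro ⟨v, hv, hρv⟩
    have hle : affineSpan ℝ (ρ : Set V) ≤ affineSpan ℝ ((σ.erase v : Finset V) : Set V) := by
      rw [affineSpan_le]
      exact ((subset_convexHull ℝ _).trans hρv).trans (convexHull_subset_affineSpan _)
    have heq : affineSpan ℝ (ρ : Set V) = affineSpan ℝ ((σ.erase v : Finset V) : Set V) := by
      by_contra h
      have := hρi.card_lt_card_of_affineSpan_lt_affineSpan (lt_of_le_of_ne hle h)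
      rw [card_erase_of_mem hv] at this
      omega
    have h0 : ∀ u ∈ σ, u ≠ v → f u = 0 := fun u hu huv =>
      (hf u (subset_affineSpan ℝ _ hu)).2
        (heq ▸ subset_affineSpan ℝ _ (mem_coe.2 (mem_erase.2 ⟨huv, hu⟩)))
    obtain ⟨a, ha, hfa⟩ := hP
    obtain ⟨b, hb, hfb⟩ := hN
    have hfb : f b < 0 := by simpa using hfb
    have hav : a = v := by
      by_contra h
      rw [h0 a ha h] at hfa; exact lt_irrefl _ hfa
    have hbv : b = v := by
      by_contra h
      rw [h0 b hb h] at hfb; exact lt_irrefl _ hfb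
    subst hav
    subst hbv
    linarith
  · rw [if_pos hP, if_neg hN]
    push Not at hN
    exact iff_of_true (by decide) (boundary f hf0 (fun u hu => by simpa using hN u hu) hP)
  · rw [if_neg hP, if_pos hN]
    push Not at hP
    exact iff_of_true (by decide) (boundary (-f) (fun u hu => by simpa using hf0 u hu)
      (fun u hu => by simpa using hP u hu) hN)
  · exfalso
    push Not at hP hN
    have : (σ : Set V) ⊆ affineSpan ℝ (ρ : Set V) := fun u hu =>
      (hf u (subset_affineSpan ℝ _ hu)).1
        (le_antisymm (hP u hu) (by simpa using hN u hu))
    have := hσ.card_le_card_of_subset_affineSpan this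
    omega

end Subdivision

section Combinatorics

/-- A labelled set uses all labels of `t` if and only if an odd number of its facets use exactly
the labels other than a given one. -/
theorem odd_card_filter_image_erase_iff {ι κ : Type*} (φ : ι → κ) {s : Finset ι}
    {t : Finset κ} (hcard : s.card = t.card) (hst : s.image φ ⊆ t) {v : κ} (hv : v ∈ t) :
    Odd (s.filter fun a => (s.erase a).image φ = t.erase v).card ↔ s.image φ = t := by
  by_cases h : s.image φ = t
  · refine iff_of_true ?_ h
    have hinj : Set.InjOn φ s := card_image_iff.1 (by rw [h, hcard])
    obtain ⟨a, ha, rfl⟩ := mem_image.1 (h.symm ▸ hv)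
    have : s.filter (fun b => (s.erase b).image φ = t.erase (φ a)) = {a} := by
      refine eq_singleton_iff_unique_mem.2 ⟨mem_filter.2 ⟨ha, ?_⟩, fun b hb => ?_⟩
      · ext c
        simp only [mem_image, mem_erase, ← h]
        constructor
        · rintro ⟨b, ⟨hba, hb⟩, rfl⟩
          exact ⟨fun e => hba (hinj hb ha e), b, hb, rfl⟩
        · rintro ⟨hc, b, hb, rfl⟩
          exact ⟨b, ⟨fun e => hc (e ▸ rfl), hb⟩, rfl⟩
      · obtain ⟨hb, hb'⟩ := mem_filter.1 hb
        by_contra hba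
        have : φ a ∈ (s.erase b).image φ := mem_image_of_mem φ (mem_erase.2 ⟨Ne.symm hba, ha⟩)
        rw [hb'] at this
        exact notMem_erase _ _ this
    rw [this]
    simp
  · refine iff_of_false ?_ h
    rw [Nat.not_odd_iff_even]
    by_cases ht : s.image φ = t.erase v
    · have hc : (s.image φ).card + 1 = s.card := by
        rw [ht, card_erase_of_mem hv, hcard]
        have := card_pos.2 ⟨v, hv⟩
        omega
      obtain ⟨a, ha, b, hb, hab, hφ⟩ := exists_ne_map_eq_of_card_lt_of_maps_to
        (s := s) (t := s.image φ) (by omega) (fun x hx => mem_image_of_mem φ hx)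
      have key : ∀ x ∈ s, ∀ y ∈ s, x ≠ y → φ x = φ y → (s.erase x).image φ = t.erase v := by
        intro x hx y hy hxy hxy'
        rw [← ht]
        refine (image_subset_image (erase_subset _ _)).antisymm ?_
        intro c hc
        obtain ⟨z, hz, rfl⟩ := mem_image.1 hc
        by_cases hzx : z = x
        · rw [hzx, hxy']
          exact mem_image_of_mem φ (mem_erase.2 ⟨hxy.symm, hy⟩)
        · exact mem_image_of_mem φ (mem_erase.2 ⟨hzx, hz⟩)
      have : s.filter (fun c => (s.erase c).image φ = t.erase v) = {a, b} := by
        ext c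
        simp only [mem_filter, mem_insert, mem_singleton]
        constructor
        · rintro ⟨hcs, hc'⟩
          by_contra! hne
          have hcc : ((s.erase c).image φ).card = (s.erase c).card := by
            rw [hc', ← ht, card_erase_of_mem hcs]
            omega
          exact hab (card_image_iff.1 hcc (mem_coe.2 (mem_erase.2 ⟨hne.1.symm, ha⟩))
            (mem_coe.2 (mem_erase.2 ⟨hne.2.symm, hb⟩)) hφ)
        · rintro (rfl | rfl)
          · exact ⟨ha, key _ ha _ hb hab hφ⟩
          · exact ⟨hb, key _ hb _ ha hab.symm hφ.symm⟩
      rw [this, card_pair hab]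
      exact even_two
    · have : s.filter (fun c => (s.erase c).image φ = t.erase v) = ∅ := by
        refine filter_eq_empty_iff.2 fun c hc hc' => ?_
        have h1 : t.erase v ⊆ s.image φ := hc' ▸ image_subset_image (erase_subset _ _)
        by_cases hvs : v ∈ s.image φ
        · refine h (hst.antisymm ?_)
          rw [← insert_erase hv]
          exact insert_subset hvs h1
        · exact ht ((subset_erase.2 ⟨hst, hvs⟩).antisymm h1)
      rw [this]
      simp

end Combinatorics

section Sperner

theorem PseudoIdentical.image_subset {V : Type*} [AddCommGroup V] [Module ℝ V]
    {S' S : GeomComplex V} {φ : V → V} (h : PseudoIdentical S' S φ) {τ σ : Finset V}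
    (hτ : τ ∈ S'.faces) (hσ : σ ∈ S.faces)
    (hτσ : convexHull ℝ (τ : Set V) ⊆ convexHull ℝ (σ : Set V)) : τ.image φ ⊆ σ := by
  intro y hy
  obtain ⟨v, hv, rfl⟩ := mem_image.1 hy
  exact h v (mem_biUnion.2 ⟨τ, hτ, hv⟩) σ hσ (hτσ (subset_convexHull ℝ _ hv))

variable {V : Type*} [NormedAddCommGroup V] [NormedSpace ℝ V] [FiniteDimensional ℝ V]

/-- Sperner's lemma for subdivisions of a simplex: an odd number of simplices of the subdivision
of `σ` are mapped onto `σ` by a pseudo-identical map. -/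
theorem odd_card_faces_image_eq {S' S : GeomComplex V} (hsub : IsSubdivision S' S) {φ : V → V}
    (hpi : PseudoIdentical S' S φ) (n : ℕ) {σ : Finset V} (hσ : σ ∈ S.faces)
    (hn : σ.card = n + 1) :
    Odd (S'.faces.filter fun τ : Finset V => (τ.card = σ.card ∧
      convexHull ℝ (τ : Set V) ⊆ convexHull ℝ (σ : Set V)) ∧ τ.image φ = σ).card := by
  induction n generalizing σ with
  | zero =>
    obtain ⟨v, rfl⟩ := card_eq_one.1 hn
    have hsing : ∀ τ ∈ S'.faces,
        convexHull ℝ (τ : Set V) ⊆ convexHull ℝ (({v} : Finset V) : Set V) → τ = {v} := by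
      intro τ hτ h
      refine (S'.nonempty_of_mem τ hτ).subset_singleton_iff.1 fun u hu => ?_
      simpa using h (subset_convexHull ℝ _ hu)
    obtain ⟨τ, hτ, hτv, -⟩ := hsub.coversSimplex hσ v (by simp)
    obtain rfl := hsing τ hτ hτv
    have himage : ({v} : Finset V).image φ = {v} :=
      ((S'.nonempty_of_mem _ hτ).image φ).subset_singleton_iff.1
        (hpi.image_subset hτ hσ subset_rfl)
    rw [card_eq_one.2 ⟨{v}, eq_singleton_iff_unique_mem.2
      ⟨mem_filter.2 ⟨hτ, ⟨rfl, subset_rfl⟩, himage⟩, fun τ' h => ?_⟩⟩]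
    · exact odd_one
    · obtain ⟨h1, ⟨-, h2⟩, -⟩ := mem_filter.1 h
      exact hsing τ' h1 h2
  | succ n ih =>
    obtain ⟨v, hv⟩ := S.nonempty_of_mem σ hσ
    have hcv : (σ.erase v).card = n + 1 := by rw [card_erase_of_mem hv]; omega
    have herase : ∀ u ∈ σ, σ.erase u ∈ S.faces := fun u hu =>
      S.down_closed σ hσ _ (erase_subset _ _) (card_pos.1 (by rw [card_erase_of_mem hu]; omega))
    set A := S'.faces.filter fun τ : Finset V => τ.card = σ.card ∧
      convexHull ℝ (τ : Set V) ⊆ convexHull ℝ (σ : Set V) with hA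
    set B := S'.faces.filter fun ρ : Finset V => ρ.card + 1 = σ.card ∧
      convexHull ℝ (ρ : Set V) ⊆ convexHull ℝ (σ : Set V) ∧ ρ.image φ = σ.erase v with hB
    have hdc := sum_card_bipartiteAbove_eq_sum_card_bipartiteBelow (s := B) (t := A)
      (fun ρ τ => ρ ⊆ τ)
    have hleft : Odd (∑ ρ ∈ B, (A.bipartiteAbove (fun ρ τ => ρ ⊆ τ) ρ).card) := by
      rw [odd_sum_iff_odd_card_odd]
      convert ih (herase v hv) hcv using 2
      rw [hB, filter_filter]
      ext ρ
      simp only [mem_filter]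
      refine and_congr_right fun hρ => ?_
      have hcount : ρ.card + 1 = σ.card → convexHull ℝ (ρ : Set V) ⊆ convexHull ℝ (σ : Set V) →
          (Odd (A.bipartiteAbove (fun ρ τ => ρ ⊆ τ) ρ).card ↔
            ∃ v ∈ σ, convexHull ℝ (ρ : Set V) ⊆
              convexHull ℝ ((σ.erase v : Finset V) : Set V)) := by
        intro hc hρσ
        rw [← (hsub.coversSimplex hσ).odd_card_cofaces_iff (S.indep σ hσ) hρ hρσ hc,
          bipartiteAbove, hA, filter_filter]
        simp only [and_assoc]
      constructor
      · rintro ⟨⟨hc, hρσ, himage⟩, hodd⟩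
        obtain ⟨u, hu, hρu⟩ := (hcount hc hρσ).1 hodd
        have h1 := hpi.image_subset hρ (herase u hu) hρu
        rw [himage] at h1
        have huv : u = v := by
          by_contra h
          exact notMem_erase u σ (h1 (mem_erase.2 ⟨h, hu⟩))
        subst huv
        exact ⟨⟨by omega, hρu⟩, himage⟩
      · rintro ⟨⟨hc, hρv⟩, himage⟩
        have hc' : ρ.card + 1 = σ.card := by omega
        have hρσ : convexHull ℝ (ρ : Set V) ⊆ convexHull ℝ (σ : Set V) :=
          hρv.trans (convexHull_mono (by exact_mod_cast erase_subset v σ))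
        exact ⟨⟨hc', hρσ, himage⟩, (hcount hc' hρσ).2 ⟨v, hv, hρv⟩⟩
    rw [hdc, odd_sum_iff_odd_card_odd] at hleft
    convert hleft using 2
    rw [← filter_filter, ← hA]
    refine filter_congr fun τ hτ => ?_
    obtain ⟨hτS, hτc, hτσ⟩ := mem_filter.1 hτ
    rw [← odd_card_filter_image_erase_iff φ hτc (hpi.image_subset hτS hσ hτσ) hv]
    have : B.bipartiteBelow (fun ρ τ => ρ ⊆ τ) τ =
        (τ.filter fun a => (τ.erase a).image φ = σ.erase v).image τ.erase := by
      ext ρ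
      simp only [bipartiteBelow, hB, mem_filter, mem_image]
      constructor
      · rintro ⟨⟨hρ, hc, -, himage⟩, hρτ⟩
        obtain ⟨a, haτ, haρ⟩ := exists_mem_notMem_of_card_lt_card
          (s := ρ) (t := τ) (by omega)
        have : ρ = τ.erase a := eq_of_subset_of_card_le (subset_erase.2 ⟨hρτ, haρ⟩)
          (by rw [card_erase_of_mem haτ]; omega)
        exact ⟨a, ⟨haτ, this ▸ himage⟩, this.symm⟩
      · rintro ⟨a, ⟨haτ, himage⟩, rfl⟩
        have hc : (τ.erase a).card + 1 = σ.card := by rw [card_erase_of_mem haτ]; omega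
        refine ⟨⟨S'.down_closed τ hτS _ (erase_subset _ _) (card_pos.1 (by omega)), hc, ?_, himage⟩,
          erase_subset _ _⟩
        exact (convexHull_mono (by exact_mod_cast erase_subset a τ)).trans hτσ
    rw [this, card_image_of_injOn]
    exact (erase_injOn τ).mono fun a ha => (mem_filter.1 ha).1

theorem geomPush_subdivChain {S' S : GeomComplex V} (hsub : IsSubdivision S' S) {φ : V → V}
    (hpi : PseudoIdentical S' S φ) (m : ℕ) {α : Finset (Finset V)}
    (hα : ∀ σ ∈ α, σ ∈ S.faces ∧ σ.card = m + 1) :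
    geomPush φ (subdivChain S'.faces α) = α := by
  have mem_of_odd : ∀ {τ ρ}, τ ∈ S'.faces → τ.image φ = ρ → τ.card = ρ.card →
      ∀ σ ∈ α, τ.card = σ.card → convexHull ℝ (τ : Set V) ⊆
        convexHull ℝ (σ : Set V) → σ = ρ := by
    rintro τ ρ hτ rfl hc σ hσ hcσ hτσ
    exact (eq_of_subset_of_card_le (hpi.image_subset hτ (hα σ hσ).1 hτσ) (by omega)).symm
  have hiff : ∀ ρ, Odd ((subdivChain S'.faces α).filter fun σ => σ.image φ = ρ ∧
      σ.card = ρ.card).card ↔ ρ ∈ α := by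
    intro ρ
    by_cases hρ : ρ ∈ α
    · refine iff_of_true ?_ hρ
      convert odd_card_faces_image_eq hsub hpi m (hα ρ hρ).1 (hα ρ hρ).2 using 2
      rw [subdivChain, filter_filter]
      refine filter_congr fun τ hτ => ⟨?_, ?_⟩
      · rintro ⟨hodd, himage, hc⟩
        obtain ⟨σ, hσ⟩ := card_pos.1 hodd.pos
        obtain ⟨hσ, hcσ, hτσ⟩ := mem_filter.1 hσ
        obtain rfl := mem_of_odd hτ himage hc σ hσ hcσ hτσ
        exact ⟨⟨hc, hτσ⟩, himage⟩
      · rintro ⟨⟨hc, hτρ⟩, himage⟩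
        refine ⟨?_, himage, hc⟩
        rw [card_eq_one.2 ⟨ρ, eq_singleton_iff_unique_mem.2
          ⟨mem_filter.2 ⟨hρ, hc, hτρ⟩, fun σ hσ => ?_⟩⟩]
        · exact odd_one
        · obtain ⟨hσ, hcσ, hτσ⟩ := mem_filter.1 hσ
          exact mem_of_odd hτ himage hc σ hσ hcσ hτσ
    · refine iff_of_false (fun hodd => hρ ?_) hρ
      obtain ⟨τ, hτ⟩ := card_pos.1 hodd.pos
      obtain ⟨hτ, himage, hc⟩ := mem_filter.1 hτ
      obtain ⟨hτ, hodd⟩ := mem_filter.1 hτ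
      obtain ⟨σ, hσ⟩ := card_pos.1 hodd.pos
      obtain ⟨hσ, hcσ, hτσ⟩ := mem_filter.1 hσ
      exact mem_of_odd hτ himage hc σ hσ hcσ hτσ ▸ hσ
  ext ρ
  rw [geomPush, mem_filter, hiff, and_iff_right_iff_imp]
  intro hρ
  obtain ⟨τ, hτ⟩ := card_pos.1 ((hiff ρ).2 hρ).pos
  obtain ⟨hτ, himage, -⟩ := mem_filter.1 hτ
  exact mem_image.2 ⟨τ, hτ, himage⟩

end Sperner

/-- Alexander's lemma: if `S'` is a subdivision of `S` and `φ : S' → S` is a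
pseudo-identical simplicial map, then `φ_* ⟦α⟧ = α` for every `m ≥ 0` and every
`m`-chain `α` of `S`. -/
theorem alexander_lemma (d : ℕ) (S S' : GeomComplex (EuclideanSpace ℝ (Fin d)))
    (hsub : IsSubdivision S' S)
    (φ : EuclideanSpace ℝ (Fin d) → EuclideanSpace ℝ (Fin d))
    (hφ : ∀ σ ∈ S'.faces, σ.image φ ∈ S.faces)
    (hpi : PseudoIdentical S' S φ)
    (m : ℕ) (α : Finset (Finset (EuclideanSpace ℝ (Fin d))))
    (hα : ∀ σ ∈ α, σ ∈ S.faces ∧ σ.card = m + 1) :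
    geomPush φ (subdivChain S'.faces α) = α := by
  exact geomPush_subdivChain hsub hpi m hα
end

section
/- Lebesgue–Sperner theorem: Let δ ⊆ ℝ^d be a geometric n-simplex with vertices v_0, …, v_n, and for each i ∈ {0, …, n} let δ_i be the (n−1)-face of δ opposite to v_i. Let F_0, …, F_n be closed subsets of ℝ^d whose union contains δ, such that v_i ∈ F_i and F_i ∩ δ_i = ∅ for every i. Then the intersection F_0 ∩ F_1 ∩ ⋯ ∩ F_n is nonempty. -/
section Scarf

open Finset

variable {I X α : Type*} [LinearOrder α]

/-- A finite set `S` is dominant for a family of rankings `r` if every element is ranked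
below all of `S` by at least one of the rankings. -/
def Dominant (r : I → X → α) (S : Finset X) : Prop :=
  ∀ y, ∃ i, ∀ x ∈ S, r i y ≤ r i x

/-- `x` has the largest `j`-rank among the elements which, for every `i ≠ j`, are ranked
strictly above `m i` by the `i`-th ranking. -/
def IsTopAbove (r : I → X → α) (m : I → X) (j : I) (x : X) : Prop :=
  (∀ i, i ≠ j → r i (m i) < r i x) ∧
    ∀ y, (∀ i, i ≠ j → r i (m i) < r i y) → r j y ≤ r j x

variable {r : I → X → α} {τ : Finset X} {m : I → X} {j k : I}

theorem Dominant.mono {σ : Finset X} (h : Dominant r σ) (hτ : τ ⊆ σ) : Dominant r τ :=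
  fun y => (h y).imp fun _ hi x hx => hi x (hτ hx)

theorem IsTopAbove.eq (hr : ∀ i, Function.Injective (r i)) {x y : X}
    (hx : IsTopAbove r m j x) (hy : IsTopAbove r m j y) : x = y :=
  hr j (le_antisymm (hy.2 x hx.1) (hx.2 y hy.1))

theorem exists_isTopAbove [Fintype X] {z : X} (hz : ∀ i, i ≠ j → r i (m i) < r i z) :
    ∃ x, IsTopAbove r m j x := by
  classical
  obtain ⟨x, hx, hmax⟩ := exists_max_image
    (univ.filter fun x => ∀ i, i ≠ j → r i (m i) < r i x) (r j) ⟨z, by simpa using hz⟩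
  exact ⟨x, by simpa using hx, fun y hy => hmax y (by simpa using hy)⟩

theorem IsTopAbove.notMem (hτ : Dominant r τ) (hm : ∀ i, m i ∈ τ) (hjk : j ≠ k)
    (hmjk : m j = m k) (hr : ∀ i, Function.Injective (r i))
    (hmin : ∀ i, ∀ x ∈ τ, r i (m i) ≤ r i x) {x : X} (hx : IsTopAbove r m j x) : x ∉ τ := by
  intro hxτ
  obtain ⟨i, hi⟩ := hτ x
  have hxi : x = m i := hr i (le_antisymm (hi _ (hm i)) (hmin i x hxτ))
  by_cases hij : i = j
  · subst hij
    have := hx.1 k hjk.symm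
    rw [← hmjk, ← hxi] at this
    exact this.false
  · have := hx.1 i hij
    rw [← hxi] at this
    exact this.false

variable [DecidableEq X]

theorem IsTopAbove.dominant_insert (hτ : Dominant r τ) (hm : ∀ i, m i ∈ τ)
    (hmin : ∀ i, ∀ x ∈ τ, r i (m i) ≤ r i x) {x : X} (hx : IsTopAbove r m j x) :
    Dominant r (insert x τ) := by
  intro y
  by_cases hy : ∀ i, i ≠ j → r i (m i) < r i y
  · refine ⟨j, fun z hz => ?_⟩
    obtain ⟨i, hi⟩ := hτ y
    obtain rfl : i = j := by
      by_contra h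
      exact (hy i h).not_ge (hi _ (hm i))
    rcases mem_insert.1 hz with rfl | hz
    · exact hx.2 y hy
    · exact hi z hz
  · push Not at hy
    obtain ⟨i, hij, hi⟩ := hy
    refine ⟨i, fun z hz => hi.trans ?_⟩
    rcases mem_insert.1 hz with rfl | hz
    · exact (hx.1 i hij).le
    · exact hmin i z hz

theorem notMem_and_dominant_insert_iff (hr : ∀ i, Function.Injective (r i))
    (hτ : Dominant r τ) (hjk : j ≠ k) (hm : ∀ i, m i ∈ τ)
    (hmin : ∀ i, ∀ x ∈ τ, r i (m i) ≤ r i x) (hmjk : m j = m k)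
    (hpair : ∀ i l, i ≠ l → m i = m l → (i = j ∧ l = k) ∨ (i = k ∧ l = j)) (x : X) :
    (x ∉ τ ∧ Dominant r (insert x τ)) ↔ IsTopAbove r m j x ∨ IsTopAbove r m k x := by
  constructor
  · rintro ⟨hxτ, hdom⟩
    obtain ⟨i₀, hi₀⟩ := hdom x
    have hlt : r i₀ x < r i₀ (m i₀) := lt_of_le_of_ne (hi₀ _ (mem_insert_of_mem (hm i₀)))
      fun h => hxτ (hr i₀ h ▸ hm i₀)
    have key : ∀ i, ∃ l, l ≠ i₀ ∧ m l = m i ∧ r l (m l) < r l x := by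
      intro i
      obtain ⟨l, hl⟩ := hdom (m i)
      have hml : m l = m i := hr l (le_antisymm (hmin l _ (hm i))
        (hl _ (mem_insert_of_mem (hm l))))
      have hle := hl x (mem_insert_self _ _)
      rw [← hml] at hle
      refine ⟨l, ?_, hml, lt_of_le_of_ne hle fun h => hxτ (hr l h ▸ hm l)⟩
      rintro rfl
      exact hle.not_gt hlt
    have hi₀jk : i₀ = j ∨ i₀ = k := by
      obtain ⟨l, hl, hml, -⟩ := key i₀
      rcases hpair l i₀ hl hml with h | h
      · exact Or.inr h.2
      · exact Or.inl h.2
    have habove : ∀ i, i ≠ i₀ → r i (m i) < r i x := by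
      intro i hi
      obtain ⟨l, hl, hml, hlx⟩ := key i
      by_cases hli : l = i
      · exact hli ▸ hlx
      · have := hpair l i hli hml
        grind
    have htop : IsTopAbove r m i₀ x := by
      refine ⟨habove, fun y hy => ?_⟩
      obtain ⟨i, hi⟩ := hdom y
      by_cases h : i = i₀
      · exact h ▸ hi x (mem_insert_self _ _)
      · exact absurd (hi _ (mem_insert_of_mem (hm i))) (hy i h).not_ge
    rcases hi₀jk with rfl | rfl
    · exact Or.inl htop
    · exact Or.inr htop
  · rintro (h | h)
    · exact ⟨h.notMem hτ hm hjk hmjk hr hmin, h.dominant_insert hτ hm hmin⟩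
    · exact ⟨h.notMem hτ hm hjk.symm hmjk.symm hr hmin, h.dominant_insert hτ hm hmin⟩

variable [Fintype I] [DecidableEq I]

/-- In a dominant set with one element less than there are rankings, exactly two rankings
share their minimum. -/
theorem Dominant.exists_minima (hr : ∀ i, Function.Injective (r i)) (hτ : Dominant r τ)
    (hcard : #τ + 1 = Fintype.card I) (hne : τ.Nonempty) :
    ∃ (m : I → X) (j k : I), j ≠ k ∧ (∀ i, m i ∈ τ) ∧ (∀ i, ∀ x ∈ τ, r i (m i) ≤ r i x) ∧
      m j = m k ∧ ∀ i l, i ≠ l → m i = m l → (i = j ∧ l = k) ∨ (i = k ∧ l = j) := by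
  choose m hm hmin using fun i => exists_min_image τ (r i) hne
  have hsurj : ∀ x ∈ τ, ∃ i, m i = x := fun x hx => by
    obtain ⟨i, hi⟩ := hτ x
    exact ⟨i, hr i (le_antisymm (hmin i x hx) (hi _ (hm i)))⟩
  obtain ⟨j, -, k, -, hjk, hmjk⟩ := exists_ne_map_eq_of_card_lt_of_maps_to
    (s := (univ : Finset I)) (t := τ) (f := m) (by rw [card_univ]; omega) (fun i _ => hm i)
  have hinj : ∀ j k : I, j ≠ k → m j = m k → Set.InjOn m (univ.erase j : Finset I) := by
    intro j k hjk hmjk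
    rw [← card_image_iff, card_erase_of_mem (mem_univ j), card_univ, ← hcard]
    congr 1
    ext x
    simp only [mem_image, mem_erase, mem_univ, and_true]
    refine ⟨fun ⟨i, _, hi⟩ => hi ▸ hm i, fun hx => ?_⟩
    obtain ⟨i, rfl⟩ := hsurj x hx
    by_cases hij : i = j
    · exact ⟨k, hjk.symm, by rw [hij, hmjk]⟩
    · exact ⟨i, hij, rfl⟩
  refine ⟨m, j, k, hjk, hm, hmin, hmjk, fun i l hil hml => ?_⟩
  have h1 : i = j ∨ l = j := by
    by_contra! h
    exact hil (hinj j k hjk hmjk (by simpa using h.1) (by simpa using h.2) hml)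
  have h2 : i = k ∨ l = k := by
    by_contra! h
    exact hil (hinj k j hjk.symm hmjk.symm (by simpa using h.1) (by simpa using h.2) hml)
  grind

variable [Fintype X] {a : I → X}

/-- A dominant set missing one element that is not made of the vertices `a i` can be completed
to a dominant set of full size in exactly two ways. -/
theorem Dominant.exists_two_insert (hr : ∀ i, Function.Injective (r i))
    (ha : ∀ i x, r i (a i) ≤ r i x)
    (ha' : ∀ i l x, i ≠ l → x ∉ Set.range a → r i x < r i (a l))
    (hainj : Function.Injective a)
    (hτ : Dominant r τ) (hcard : #τ + 1 = Fintype.card I) {t : X} (ht : t ∈ τ)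
    (hta : t ∉ Set.range a) :
    ∃ x y, x ≠ y ∧ ∀ z, (z ∉ τ ∧ Dominant r (insert z τ)) ↔ z = x ∨ z = y := by
  obtain ⟨m, j, k, hjk, hm, hmin, hmjk, hpair⟩ := hτ.exists_minima hr hcard ⟨t, ht⟩
  have hlt : ∀ l i, i ≠ l → r i (m i) < r i (a l) := by
    intro l i hil
    by_cases hmi : m i ∈ Set.range a
    · obtain ⟨p, hp⟩ := hmi
      have hpi : p = i := by
        by_contra h
        exact (ha' i p t (Ne.symm h) hta).not_ge (hp ▸ hmin i t ht)
      rw [← hp, hpi]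
      exact lt_of_le_of_ne (ha i _) fun h => hil (hainj (hr i h))
    · exact ha' i l _ hil hmi
  obtain ⟨x, hx⟩ := exists_isTopAbove (hlt j)
  obtain ⟨y, hy⟩ := exists_isTopAbove (hlt k)
  refine ⟨x, y, ?_, fun z => ?_⟩
  · rintro rfl
    obtain ⟨i, hi⟩ := hτ x
    by_cases hij : i = j
    · exact (hy.1 i (hij ▸ hjk)).not_ge (hi _ (hm i))
    · exact (hx.1 i hij).not_ge (hi _ (hm i))
  · rw [notMem_and_dominant_insert_iff hr hτ hjk hm hmin hmjk hpair]
    refine or_congr ⟨fun h => h.eq hr hx, fun h => h ▸ hx⟩ ⟨fun h => h.eq hr hy, fun h => h ▸ hy⟩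

/-- The set of all vertices but one can be completed to a dominant set of full size in exactly
one way. -/
theorem exists_unique_insert_image_erase [Nontrivial I] (hr : ∀ i, Function.Injective (r i))
    (ha : ∀ i x, r i (a i) ≤ r i x)
    (ha' : ∀ i l x, i ≠ l → x ∉ Set.range a → r i x < r i (a l))
    (hainj : Function.Injective a) (i₀ : I) :
    ∃ x, ∀ z, (z ∉ (univ.erase i₀).image a ∧ Dominant r (insert z ((univ.erase i₀).image a))) ↔
      z = x := by
  set τ := (univ.erase i₀).image a with hτdef
  have hmem : ∀ i, i ≠ i₀ → a i ∈ τ := fun i hi => mem_image_of_mem a (by simpa using hi)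
  have hτ : Dominant r τ := by
    intro y
    by_cases hy : y ∈ Set.range a
    · obtain ⟨i, rfl⟩ := hy
      exact ⟨i, fun x _ => ha i x⟩
    · refine ⟨i₀, fun x hx => ?_⟩
      obtain ⟨i, hi, rfl⟩ := mem_image.1 hx
      exact (ha' i₀ i y (ne_of_mem_erase hi).symm hy).le
  have hcard : #τ + 1 = Fintype.card I := by
    rw [card_image_of_injective _ hainj, card_erase_of_mem (mem_univ _), card_univ]
    have := Fintype.card_pos (α := I)
    omega
  obtain ⟨l, hl⟩ := exists_ne i₀
  obtain ⟨m, j, k, hjk, hm, hmin, hmjk, hpair⟩ := hτ.exists_minima hr hcard ⟨a l, hmem l hl⟩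
  have hma : ∀ i, i ≠ i₀ → m i = a i := fun i hi =>
    hr i (le_antisymm (hmin i _ (hmem i hi)) (ha i _))
  wlog hj : j = i₀ generalizing j k
  · have hk : k = i₀ := by
      by_contra hk
      exact hjk (hainj (by rw [← hma j hj, ← hma k hk, hmjk]))
    exact this k j hjk.symm hmjk.symm (fun i l hil h => (hpair i l hil h).symm) hk
  subst hj
  have hk := hma k hjk.symm
  obtain ⟨x, hx⟩ := exists_isTopAbove (r := r) (m := m) (j := j) (z := a j) fun i hi => by
    rw [hma i hi]
    exact lt_of_le_of_ne (ha i _) fun h => hi (hainj (hr i h))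
  refine ⟨x, fun z => ?_⟩
  rw [notMem_and_dominant_insert_iff hr hτ hjk hm hmin hmjk hpair]
  refine ⟨fun h => ?_, fun h => Or.inl (h ▸ hx)⟩
  rcases h with h | h
  · exact h.eq hr hx
  · exfalso
    have hjz := h.1 j hjk
    rw [hmjk, hk] at hjz
    by_cases hz : z ∈ Set.range a
    · obtain ⟨p, rfl⟩ := hz
      by_cases hpj : p = j
      · exact hjz.not_ge (hpj ▸ ha j _)
      · by_cases hpk : p = k
        · exact (hpk ▸ hjz).false
        · have := h.1 p hpk
          rw [hma p hpj] at this
          exact this.false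
    · exact hjz.not_gt (ha' j k z hjk hz)

/-- A coloured family of rankings has a dominant set on which all colours appear. -/
theorem exists_dominant_image_eq_univ [Nontrivial I] (hr : ∀ i, Function.Injective (r i))
    (ha : ∀ i x, r i (a i) ≤ r i x)
    (ha' : ∀ i l x, i ≠ l → x ∉ Set.range a → r i x < r i (a l))
    (hainj : Function.Injective a) (c : X → I) (hc : ∀ i, c (a i) = i) :
    ∃ σ : Finset X, #σ = Fintype.card I ∧ Dominant r σ ∧ σ.image c = univ := by
  classical
  obtain ⟨i₀⟩ : Nonempty I := inferInstance
  by_contra! hno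
  set P : Finset (Finset X × X) := univ.filter fun p =>
    p.2 ∈ p.1 ∧ (#p.1 = Fintype.card I ∧ Dominant r p.1) ∧
      (p.1.erase p.2).image c = univ.erase i₀ with hP
  have heven : Even #P := by
    rw [card_eq_sum_card_fiberwise (f := Prod.fst) (t := univ) (fun _ _ => by simp)]
    refine even_sum _ fun σ _ => ?_
    rcases eq_empty_or_nonempty (P.filter fun p => p.1 = σ) with h | ⟨⟨σ', x⟩, hx⟩
    · simp [h]
    simp only [hP, mem_filter, mem_univ, true_and] at hx
    obtain ⟨⟨hxσ, ⟨hσc, hσ⟩, him⟩, rfl⟩ := hx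
    have hcx : c x ≠ i₀ := by
      intro h
      apply hno σ' hσc hσ
      rw [← insert_erase hxσ, image_insert, him, h, insert_erase (mem_univ _)]
    have : c x ∈ (σ'.erase x).image c := by rw [him]; simpa using hcx
    obtain ⟨y, hy, hyx⟩ := mem_image.1 this
    have hyne := ne_of_mem_erase hy
    have hinj : Set.InjOn c (σ'.erase x : Finset X) := by
      rw [← card_image_iff, him, card_erase_of_mem (mem_univ _), card_erase_of_mem hxσ, hσc,
        card_univ]
    have hset : (P.filter fun p => p.1 = σ') = {(σ', x), (σ', y)} := by
      ext ⟨ρ, z⟩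
      simp only [hP, mem_filter, mem_univ, true_and, mem_insert, mem_singleton, Prod.mk.injEq]
      constructor
      · rintro ⟨⟨hz, -, hz'⟩, rfl⟩
        by_contra! hne
        have hzx : z ≠ x := hne.1 rfl
        have hzy : z ≠ y := hne.2 rfl
        have hcz : c z ∈ (ρ.erase z).image c := by
          rw [hz', ← him]
          exact mem_image_of_mem c (mem_erase.2 ⟨hzx, hz⟩)
        obtain ⟨w, hw, hwz⟩ := mem_image.1 hcz
        have hwne := ne_of_mem_erase hw
        have hwρ := mem_of_mem_erase hw
        by_cases hwx : w = x
        · subst hwx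
          exact hzy (hinj (mem_erase.2 ⟨hzx, hz⟩) hy (by rw [hyx, hwz]))
        · exact hwne (hinj (mem_erase.2 ⟨hwx, hwρ⟩) (mem_erase.2 ⟨hzx, hz⟩) hwz)
      · rintro (⟨rfl, rfl⟩ | ⟨rfl, rfl⟩)
        · exact ⟨⟨hxσ, ⟨hσc, hσ⟩, him⟩, rfl⟩
        · refine ⟨⟨mem_of_mem_erase hy, ⟨hσc, hσ⟩, ?_⟩, rfl⟩
          rw [← him]
          ext i
          simp only [mem_image, mem_erase]
          constructor
          · rintro ⟨w, ⟨hwz, hw⟩, rfl⟩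
            by_cases hwx : w = x
            · exact ⟨z, ⟨hyne, mem_of_mem_erase hy⟩, by rw [hyx, hwx]⟩
            · exact ⟨w, ⟨hwx, hw⟩, rfl⟩
          · rintro ⟨w, ⟨hwx, hw⟩, rfl⟩
            by_cases hwz : w = z
            · exact ⟨x, ⟨hyne.symm, hxσ⟩, by rw [hwz, hyx]⟩
            · exact ⟨w, ⟨hwz, hw⟩, rfl⟩
    rw [hset, card_pair (by simpa using hyne.symm)]
    exact even_two
  have hfiber : ∀ τ : Finset X, #τ + 1 = Fintype.card I → τ.image c = univ.erase i₀ →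
      ∀ ρ z, (ρ, z) ∈ (P.filter fun p => p.1.erase p.2 = τ) ↔
        (z ∉ τ ∧ Dominant r (insert z τ)) ∧ ρ = insert z τ := by
    intro τ hτ hτc ρ z
    simp only [hP, mem_filter, mem_univ, true_and]
    constructor
    · rintro ⟨⟨hz, ⟨-, hρ⟩, -⟩, rfl⟩
      rw [insert_erase hz]
      exact ⟨⟨notMem_erase _ _, hρ⟩, rfl⟩
    · rintro ⟨⟨hz, hd⟩, rfl⟩
      rw [erase_insert hz]
      exact ⟨⟨mem_insert_self _ _, ⟨by rw [card_insert_of_notMem hz, hτ], hd⟩, hτc⟩, rfl⟩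
  set τ₀ := (univ.erase i₀).image a with hτ₀
  have hodd : Odd #P := by
    rw [card_eq_sum_card_fiberwise (f := fun p : Finset X × X => p.1.erase p.2) (t := univ)
      (fun _ _ => by simp), ← add_sum_erase univ _ (mem_univ τ₀)]
    refine Odd.add_even ?_ (even_sum _ fun τ hτ => ?_)
    · obtain ⟨x, hx⟩ := exists_unique_insert_image_erase hr ha ha' hainj i₀
      have : (P.filter fun p => p.1.erase p.2 = τ₀) = {(insert x τ₀, x)} := by
        ext ⟨ρ, z⟩
        rw [hfiber τ₀ ?_ ?_, hx, mem_singleton, Prod.mk.injEq]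
        · grind
        · rw [card_image_of_injective _ hainj, card_erase_of_mem (mem_univ _), card_univ]
          have := Fintype.card_pos (α := I)
          omega
        · rw [hτ₀, image_image]
          simp [Function.comp_def, hc]
      rw [this, card_singleton]
      exact odd_one
    · rcases eq_empty_or_nonempty (P.filter fun p => p.1.erase p.2 = τ) with h | ⟨⟨σ, x⟩, hx⟩
      · simp [h]
      simp only [hP, mem_filter, mem_univ, true_and] at hx
      obtain ⟨⟨hxσ, ⟨hσc, hσ⟩, him⟩, hστ⟩ := hx
      rw [hστ] at him
      have hτcard : #τ + 1 = Fintype.card I := by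
        rw [← hστ, card_erase_add_one hxσ, hσc]
      have hτd : Dominant r τ := hσ.mono (hστ ▸ erase_subset _ _)
      obtain ⟨t, ht, hta⟩ : ∃ t ∈ τ, t ∉ Set.range a := by
        by_contra! hall
        refine ne_of_mem_erase hτ (eq_of_subset_of_card_le (fun t ht => ?_) ?_)
        · obtain ⟨i, rfl⟩ := hall t ht
          have := mem_image_of_mem c ht
          rw [him, hc] at this
          exact mem_image_of_mem a this
        · rw [card_image_of_injective _ hainj, card_erase_of_mem (mem_univ _), card_univ]
          omega
      obtain ⟨y, z, hyz, hiff⟩ := hτd.exists_two_insert hr ha ha' hainj hτcard ht hta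
      have : (P.filter fun p => p.1.erase p.2 = τ) = {(insert y τ, y), (insert z τ, z)} := by
        ext ⟨ρ, w⟩
        rw [hfiber τ hτcard him, hiff, mem_insert, mem_singleton, Prod.mk.injEq, Prod.mk.injEq]
        grind
      rw [this, card_pair (by simp [hyz])]
      exact even_two
  exact (Nat.not_even_iff_odd.2 hodd) heven

/-- **Scarf's lemma**. -/
theorem exists_finset_forall_exists_le {T : Type*} [Fintype T] [Nontrivial I]
    (u : I → T → ℝ) (c : T → I) :
    ∃ S : Finset T, ∀ y, ∃ i ∈ S.image c, ∀ x ∈ S, u i y ≤ u i x := by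
  classical
  let e := Fintype.equivFin (T ⊕ I)
  let w : I → T ⊕ I → EReal := fun i => Sum.elim (fun t => (u i t : EReal))
    fun l => if l = i then ⊥ else ⊤
  let r : I → T ⊕ I → EReal ×ₗ Fin (Fintype.card (T ⊕ I)) := fun i x => toLex (w i x, e x)
  have hlt : ∀ i x y, w i x < w i y → r i x < r i y := fun i x y h =>
    Prod.Lex.toLex_lt_toLex.2 (Or.inl h)
  have hle : ∀ i x y, r i x ≤ r i y → w i x ≤ w i y := fun i x y h =>
    le_of_not_gt fun h' => (hlt i y x h').not_ge h
  have hr : ∀ i, Function.Injective (r i) := fun i x y h =>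
    e.injective (congrArg Prod.snd (toLex.injective h))
  have hbot : ∀ i, w i (Sum.inr i) = ⊥ := fun i => by simp [w]
  have ha : ∀ i x, r i (Sum.inr i) ≤ r i x := by
    intro i x
    by_cases hx : x = Sum.inr i
    · rw [hx]
    · refine (hlt i _ _ ?_).le
      rw [hbot]
      rcases x with t | l
      · exact EReal.bot_lt_coe _
      · have : l ≠ i := fun h => hx (by rw [h])
        simp [w, this]
  have ha' : ∀ (i l : I) (x : T ⊕ I), i ≠ l → x ∉ Set.range (Sum.inr : I → T ⊕ I) →
      r i x < r i (Sum.inr l) := by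
    intro i l x hil hx
    rcases x with t | p
    · refine hlt i _ _ ?_
      simp [w, hil.symm, EReal.coe_lt_top]
    · exact absurd ⟨p, rfl⟩ hx
  obtain ⟨σ, -, hσ, hσc⟩ := exists_dominant_image_eq_univ hr ha ha' Sum.inr_injective
    (Sum.elim c id) fun i => rfl
  refine ⟨univ.filter fun t => Sum.inl t ∈ σ, fun y => ?_⟩
  obtain ⟨i, hi⟩ := hσ (Sum.inl y)
  refine ⟨i, ?_, fun x hx => ?_⟩
  · obtain ⟨x, hx, hxi⟩ := mem_image.1 (hσc ▸ mem_univ i)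
    rcases x with t | l
    · exact mem_image.2 ⟨t, by simpa using hx, hxi⟩
    · obtain rfl : l = i := hxi
      have := hle l _ _ (hi _ hx)
      rw [hbot, le_bot_iff] at this
      exact absurd this (EReal.coe_ne_bot _)
  · exact EReal.coe_le_coe_iff.1 (hle i _ _ (hi (Sum.inl x) (by simpa using hx)))

end Scarf

section KKM

variable {I : Type*} [Fintype I]

theorem exists_mem_stdSimplex_forall_dist_le [Nontrivial I] {G : I → Set (I → ℝ)}
    (hcov : stdSimplex ℝ I ⊆ ⋃ i, G i) (hface : ∀ i, ∀ x ∈ stdSimplex ℝ I, x i = 0 → x ∈ G i)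
    {ε : ℝ} (hε : 0 < ε) :
    ∃ x ∈ stdSimplex ℝ I, ∀ i, ∃ q ∈ G i, dist x q ≤ Fintype.card I * ε := by
  classical
  obtain ⟨t, htΔ, htfin, ht⟩ := (isCompact_stdSimplex ℝ I).finite_cover_balls hε
  have := htfin.fintype
  have hc : ∀ x : t, ∃ i, (x : I → ℝ) ∈ G i := fun x => Set.mem_iUnion.1 (hcov (htΔ x.2))
  choose c hc using hc
  obtain ⟨S, hS⟩ := exists_finset_forall_exists_le (fun i (x : t) => (x : I → ℝ) i) c
  obtain ⟨i₁⟩ : Nonempty I := inferInstance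
  have hy₀ : ∃ y, y ∈ t := by
    obtain ⟨y, hy, -⟩ := Set.mem_iUnion₂.1 (ht (single_mem_stdSimplex ℝ i₁))
    exact ⟨y, hy⟩
  obtain ⟨y₀, hy₀⟩ := hy₀
  have hCne : (S.image c).Nonempty := (hS ⟨y₀, hy₀⟩).imp fun _ h => h.1
  have hSne : S.Nonempty := by simpa using hCne
  set C := S.image c
  choose m hmS hm using fun i => S.exists_min_image (fun x => (x : I → ℝ) i) hSne
  set μ : I → ℝ := fun i => (m i : I → ℝ) i
  have hμ0 : ∀ i, 0 ≤ μ i := fun i => (htΔ (m i).2).1 i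
  have hCpos : (0 : ℝ) < C.card := by exact_mod_cast hCne.card_pos
  have hCcard : (C.card : ℝ) ≤ Fintype.card I := by exact_mod_cast C.card_le_univ
  have hsum : 1 - C.card * ε < ∑ i ∈ C, μ i := by
    by_contra! hle
    set η := (1 - ∑ i ∈ C, μ i) / C.card
    have hη : ε ≤ η := by
      rw [le_div_iff₀ hCpos]
      linarith
    have hz : (fun i => if i ∈ C then μ i + η else 0) ∈ stdSimplex ℝ I := by
      refine ⟨fun i => ?_, ?_⟩
      · dsimp only
        split_ifs
        · linarith [hμ0 i]
        · exact le_rfl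
      · rw [Finset.sum_ite_mem, Finset.univ_inter, Finset.sum_add_distrib, Finset.sum_const,
          nsmul_eq_mul, mul_div_cancel₀ _ hCpos.ne']
        ring
    obtain ⟨y, hy, hyz⟩ := Set.mem_iUnion₂.1 (ht hz)
    obtain ⟨i, hi, hiS⟩ := hS ⟨y, hy⟩
    have h1 : y i ≤ μ i := hiS (m i) (hmS i)
    have h2 := (dist_le_pi_dist _ _ i).trans_lt (Metric.mem_ball.1 hyz)
    simp only [hi, if_true, Real.dist_eq] at h2
    linarith [(abs_lt.1 h2).2]
  have hbound : ∀ x ∈ S, ∀ i, (if i ∈ C then μ i else 0) ≤ (x : I → ℝ) i ∧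
      (x : I → ℝ) i ≤ (if i ∈ C then μ i else 0) + Fintype.card I * ε := by
    intro x hx
    have hlow : ∀ i, (if i ∈ C then μ i else 0) ≤ (x : I → ℝ) i := by
      intro i
      split_ifs
      · exact hm i x hx
      · exact (htΔ x.2).1 i
    refine fun i => ⟨hlow i, ?_⟩
    have h1 := Finset.single_le_sum (f := fun i => (x : I → ℝ) i - if i ∈ C then μ i else 0)
      (fun i _ => sub_nonneg.2 (hlow i)) (Finset.mem_univ i)
    rw [Finset.sum_sub_distrib, (htΔ x.2).2, Finset.sum_ite_mem, Finset.univ_inter] at h1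
    have h2 := mul_le_mul_of_nonneg_right hCcard hε.le
    linarith
  have hKε : 0 ≤ (Fintype.card I : ℝ) * ε := by positivity
  obtain ⟨x, hx⟩ := hSne
  refine ⟨x, htΔ x.2, fun i => ?_⟩
  by_cases hi : i ∈ C
  · obtain ⟨p, hp, rfl⟩ := Finset.mem_image.1 hi
    refine ⟨p, hc p, (dist_pi_le_iff hKε).2 fun l => ?_⟩
    rw [Real.dist_eq, abs_le]
    constructor <;> linarith [hbound x hx l, hbound p hp l]
  · obtain ⟨j, hj⟩ := exists_ne i
    have hxi := hbound x hx i
    rw [if_neg hi] at hxi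
    have hxΔ := htΔ x.2
    refine ⟨(x : I → ℝ) + (Pi.single j ((x : I → ℝ) i) - Pi.single i ((x : I → ℝ) i)),
      hface i _ ⟨fun l => ?_, ?_⟩ ?_, (dist_pi_le_iff hKε).2 fun l => ?_⟩
    · have := hxΔ.1 l
      by_cases hli : l = i
      · subst hli
        simp [hj.symm]
      · by_cases hlj : l = j
        · subst hlj
          simp [hli]
          linarith
        · simpa [hli, hlj] using this
    · simp [Finset.sum_add_distrib, hxΔ.2]
    · simp [hj.symm]
    · rw [Pi.add_apply, dist_self_add_right, Real.norm_eq_abs, abs_le]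
      by_cases hli : l = i
      · subst hli
        simp [hj.symm]
        constructor <;> linarith
      · by_cases hlj : l = j
        · subst hlj
          simp [hli]
          constructor <;> linarith
        · simp [hli, hlj, hKε]

/-- The dual form of the **Knaster–Kuratowski–Mazurkiewicz lemma**: closed sets that cover the
standard simplex, the `i`-th of which contains the `i`-th facet, have a common point. -/
theorem exists_mem_stdSimplex_forall_mem [Nontrivial I] {G : I → Set (I → ℝ)}
    (hG : ∀ i, IsClosed (G i)) (hcov : stdSimplex ℝ I ⊆ ⋃ i, G i)
    (hface : ∀ i, ∀ x ∈ stdSimplex ℝ I, x i = 0 → x ∈ G i) :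
    ∃ x ∈ stdSimplex ℝ I, ∀ i, x ∈ G i := by
  classical
  have hne : ∀ i, (G i).Nonempty := fun i => by
    obtain ⟨j, hj⟩ := exists_ne i
    exact ⟨_, hface i _ (single_mem_stdSimplex ℝ j) (by simp [hj.symm])⟩
  have hΔ : (stdSimplex ℝ I).Nonempty := ⟨_, single_mem_stdSimplex ℝ (Classical.arbitrary I)⟩
  obtain ⟨x, hx, hmin⟩ := (isCompact_stdSimplex ℝ I).exists_isMinOn hΔ
    (f := fun x => ∑ i, Metric.infDist x (G i))
    (continuous_finsetSum _ fun i _ => Metric.continuous_infDist_pt _).continuousOn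
  have hN : (0 : ℝ) < Fintype.card I := by exact_mod_cast Fintype.card_pos
  have hzero : ∑ i, Metric.infDist x (G i) ≤ 0 := by
    refine le_of_forall_pos_le_add fun ε hε => ?_
    obtain ⟨y, hy, hyq⟩ := exists_mem_stdSimplex_forall_dist_le hcov hface
      (ε := ε / (Fintype.card I * Fintype.card I)) (by positivity)
    calc ∑ i, Metric.infDist x (G i) ≤ ∑ i, Metric.infDist y (G i) := hmin hy
      _ ≤ ∑ _i : I, Fintype.card I * (ε / (Fintype.card I * Fintype.card I)) :=
        Finset.sum_le_sum fun i _ => by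
          obtain ⟨q, hq, hyq⟩ := hyq i
          exact (Metric.infDist_le_dist_of_mem hq).trans hyq
      _ = 0 + ε := by
        rw [Finset.sum_const, Finset.card_univ, nsmul_eq_mul]
        field_simp
        ring
  refine ⟨x, hx, fun i => ((hG i).mem_iff_infDist_zero (hne i)).2
    (le_antisymm ?_ Metric.infDist_nonneg)⟩
  exact (Finset.single_le_sum (f := fun i => Metric.infDist x (G i))
    (fun _ _ => Metric.infDist_nonneg) (Finset.mem_univ i)).trans hzero

end KKM

/-- Lebesgue–Sperner theorem: if closed sets `F 0, …, F n` cover the geometric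
`n`-simplex `δ` with vertices `v 0, …, v n`, the vertex `v i` belongs to `F i`, and
`F i` is disjoint from the face `δ_i` of `δ` opposite to `v i`, then the sets
`F 0, …, F n` have a common point. -/
theorem lebesgue_sperner (d n : ℕ) (v : Fin (n + 1) → EuclideanSpace ℝ (Fin d))
    (hv : AffineIndependent ℝ v)
    (F : Fin (n + 1) → Set (EuclideanSpace ℝ (Fin d)))
    (hFc : ∀ i, IsClosed (F i))
    (hcov : convexHull ℝ (Set.range v) ⊆ ⋃ i, F i)
    (hvF : ∀ i, v i ∈ F i)
    (hdisj : ∀ i, F i ∩ convexHull ℝ (v '' {i}ᶜ) = ∅) :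
    (⋂ i, F i).Nonempty := by
  rcases n with _ | n
  · exact ⟨v 0, Set.mem_iInter.2 fun i => Fin.fin_one_eq_zero i ▸ hvF i⟩
  let φ : (Fin (n + 2) → ℝ) → EuclideanSpace ℝ (Fin d) := fun w => ∑ i, w i • v i
  have hφ : Continuous φ := by fun_prop
  let D : Fin (n + 2) → (Fin (n + 2) → ℝ) → ℝ := fun i w => Metric.infDist (φ w) (F i)
  have hD : ∀ i, Continuous (D i) := fun i => (Metric.continuous_infDist_pt _).comp hφ
  have hD0 : ∀ i w, 0 ≤ D i w := fun _ _ => Metric.infDist_nonneg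
  have hsum : ∀ w ∈ stdSimplex ℝ (Fin (n + 2)), ∑ i, w i * ∑ j, D j w = ∑ i, D i w :=
    fun w hw => by rw [← Finset.sum_mul, hw.2, one_mul]
  obtain ⟨w, hw, hwG⟩ := exists_mem_stdSimplex_forall_mem
    (G := fun i => {w | w i * ∑ j, D j w ≤ D i w})
    (fun i => isClosed_le (by fun_prop) (hD i))
    (fun w hw => by
      obtain ⟨i, -, hi⟩ := Finset.exists_le_of_sum_le Finset.univ_nonempty (hsum w hw).le
      exact Set.mem_iUnion.2 ⟨i, hi⟩)
    (fun i w _ hwi => by simpa [hwi] using hD0 i w)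
  have heq : ∀ i, w i * ∑ j, D j w = D i w := fun i =>
    (Finset.sum_eq_sum_iff_of_le fun i _ => hwG i).1 (hsum w hw) i (Finset.mem_univ i)
  have hmem : φ w ∈ convexHull ℝ (Set.range v) :=
    (convex_convexHull ℝ _).sum_mem (fun i _ => hw.1 i) hw.2
      fun i _ => subset_convexHull ℝ _ (Set.mem_range_self i)
  obtain ⟨j, hj⟩ := Set.mem_iUnion.1 (hcov hmem)
  have hwj : w j ≠ 0 := by
    intro hwj
    have hface : φ w ∈ convexHull ℝ (v '' {j}ᶜ) := by
      have hφw : φ w = ∑ i ∈ Finset.univ.erase j, w i • v i := by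
        rw [Finset.sum_erase _ (by simp [hwj])]
      rw [hφw]
      refine (convex_convexHull ℝ _).sum_mem (fun i _ => hw.1 i) ?_ fun i hi =>
        subset_convexHull ℝ _ (Set.mem_image_of_mem v (by simpa using hi))
      rw [Finset.sum_erase _ hwj, hw.2]
    exact (Set.ext_iff.1 (hdisj j) (φ w)).1 ⟨hj, hface⟩
  have hDj : D j w = 0 := Metric.infDist_zero_of_mem hj
  have hzero : ∑ i, D i w = 0 :=
    (mul_eq_zero.1 ((heq j).trans hDj)).resolve_left hwj
  refine ⟨φ w, Set.mem_iInter.2 fun i => ?_⟩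
  refine ((hFc i).mem_iff_infDist_zero ⟨v i, hvF i⟩).2 ?_
  have := heq i
  rw [hzero, mul_zero] at this
  exact this.symm
end

section
/- Brouwer's invariance of dimension theorem: If m < n, then no subset of ℝ^n with nonempty interior is homeomorphic to a subset of ℝ^m. That is, for A ⊆ ℝ^n with nonempty interior and any B ⊆ ℝ^m, the topological spaces A and B (with their subspace topologies) are not homeomorphic. In particular, ℝ^n and ℝ^m are not homeomorphic for n ≠ m. -/
open Equiv Matrix Set Filter Topology

/-- The `j`-th vertex of the simplex of the Freudenthal triangulation of `ℤ^n` that starts at `v`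
and adds the unit vectors in the order prescribed by `π`. -/
def chainVertex {n : ℕ} (v : Fin n → ℤ) (π : Perm (Fin n)) (j : Fin (n + 1)) : Fin n → ℤ :=
  fun a => v a + if (π.symm a).castSucc < j then 1 else 0

theorem le_chainVertex {n : ℕ} (v : Fin n → ℤ) (π : Perm (Fin n)) (j : Fin (n + 1)) (a : Fin n) :
    v a ≤ chainVertex v π j a := by
  unfold chainVertex; split_ifs <;> omega

theorem chainVertex_le {n : ℕ} (v : Fin n → ℤ) (π : Perm (Fin n)) (j : Fin (n + 1)) (a : Fin n) :
    chainVertex v π j a ≤ v a + 1 := by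
  unfold chainVertex; split_ifs <;> omega

theorem chainVertex_mul_swap {d : ℕ} (v : Fin (d + 1) → ℤ) (π : Perm (Fin (d + 1))) (k : Fin d)
    {l : Fin (d + 2)} (hl : l ≠ k.succ.castSucc) :
    chainVertex v (π * swap k.castSucc k.succ) l = chainVertex v π l := by
  ext a
  unfold chainVertex
  have h : (π * swap k.castSucc k.succ).symm a = swap k.castSucc k.succ (π.symm a) := rfl
  rw [h]
  congr 1
  refine if_congr ?_ rfl rfl
  generalize π.symm a = b
  have hl' : (l : ℕ) ≠ k + 1 := fun h => hl (Fin.ext h)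
  rcases eq_or_ne b k.castSucc with rfl | h1
  · simp only [swap_apply_left, Fin.lt_def, Fin.val_castSucc, Fin.val_succ]; omega
  rcases eq_or_ne b k.succ with rfl | h2
  · simp only [swap_apply_right, Fin.lt_def, Fin.val_castSucc, Fin.val_succ]; omega
  rw [swap_apply_of_ne_of_ne h1 h2]

theorem chainVertex_mul_finRotate {d : ℕ} (v : Fin (d + 1) → ℤ) (π : Perm (Fin (d + 1)))
    (l : Fin (d + 1)) :
    chainVertex (v + Pi.single (π 0) 1) (π * finRotate (d + 1)) l.castSucc =
      chainVertex v π l.succ := by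
  ext a
  obtain ⟨c, rfl⟩ := (π * finRotate (d + 1)).surjective a
  unfold chainVertex
  rw [Equiv.symm_apply_apply]
  simp only [Perm.mul_apply, Equiv.symm_apply_apply, Pi.add_apply]
  induction c using Fin.lastCases with
  | last => simp [Fin.lt_def]; omega
  | cast c => simp [Fin.lt_def, Fin.ext_iff]

/-- The boundary of the sum of all the (oriented) simplices of the Freudenthal triangulation
vanishes. -/
theorem finsum_facets_eq_zero {d : ℕ} (c : (Fin (d + 1) → Fin (d + 1) → ℤ) → ℤ)
    (hc : ∀ π j, (Function.support fun v => c (chainVertex v π ∘ Fin.succAbove j)).Finite) :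
    ∑ᶠ v, ∑ π : Perm (Fin (d + 1)), (Perm.sign π : ℤ) *
      ∑ j : Fin (d + 2), (-1) ^ (j : ℕ) * c (chainVertex v π ∘ j.succAbove) = 0 := by
  set I : Perm (Fin (d + 1)) → Fin (d + 2) → ℤ :=
    fun π j => ∑ᶠ v, c (chainVertex v π ∘ j.succAbove) with hI
  have hsum : ∑ᶠ v, ∑ π : Perm (Fin (d + 1)), (Perm.sign π : ℤ) *
      ∑ j : Fin (d + 2), (-1) ^ (j : ℕ) * c (chainVertex v π ∘ j.succAbove) =
      ∑ j : Fin (d + 2), (-1) ^ (j : ℕ) * ∑ π, (Perm.sign π : ℤ) * I π j := by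
    simp only [Finset.mul_sum]
    rw [Finset.sum_comm]
    have hfin (π : Perm (Fin (d + 1))) (j : Fin (d + 2)) : (Function.support fun v =>
        (Perm.sign π : ℤ) * ((-1) ^ (j : ℕ) * c (chainVertex v π ∘ j.succAbove))).Finite := by
      refine (hc π j).subset fun v hv h => hv ?_
      simp only at h ⊢
      rw [h]; ring
    rw [finsum_sum_comm]
    · refine Finset.sum_congr rfl fun π _ => ?_
      rw [finsum_sum_comm _ _ fun j _ => hfin π j]
      refine Finset.sum_congr rfl fun j _ => ?_
      simp only [hI, ← mul_assoc]
      rw [← smul_eq_mul _ (finsum _), smul_finsum, mul_comm]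
      simp only [smul_eq_mul]
    · intro π _
      refine (Set.finite_iUnion (hfin π)).subset fun v hv => ?_
      by_contra h
      refine hv (Finset.sum_eq_zero fun j _ => ?_)
      by_contra h'
      exact h (Set.mem_iUnion.2 ⟨j, h'⟩)
  have hmid (k : Fin d) : ∑ π, (Perm.sign π : ℤ) * I π k.succ.castSucc = 0 := by
    have h := Equiv.sum_comp (Equiv.mulRight (swap k.castSucc k.succ))
      fun π => (Perm.sign π : ℤ) * I π k.succ.castSucc
    have h1 (π : Perm (Fin (d + 1))) :
        I (π * swap k.castSucc k.succ) k.succ.castSucc = I π k.succ.castSucc := by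
      simp only [hI]
      congr 1; ext v; congr 1; ext1 l
      exact chainVertex_mul_swap v π k (Fin.succAbove_ne _ _)
    have h2 : Perm.sign (swap k.castSucc k.succ) = -1 :=
      Perm.sign_swap (Fin.castSucc_lt_succ).ne
    simp only [Equiv.coe_mulRight, h1, Perm.sign_mul, h2, mul_neg, mul_one, Units.val_neg, neg_mul,
      Finset.sum_neg_distrib] at h
    omega
  have hend : ∑ π, (Perm.sign π : ℤ) * I π 0 =
      (-1) ^ d * ∑ π, (Perm.sign π : ℤ) * I π (Fin.last (d + 1)) := by
    rw [← Equiv.sum_comp (Equiv.mulRight (finRotate (d + 1)))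
      fun π => (Perm.sign π : ℤ) * I π (Fin.last (d + 1)), Finset.mul_sum]
    refine Finset.sum_congr rfl fun π _ => ?_
    have h1 : I (π * finRotate (d + 1)) (Fin.last (d + 1)) = I π 0 := by
      simp only [hI]
      rw [← finsum_comp_equiv (Equiv.addRight (Pi.single (π 0) 1 : Fin (d + 1) → ℤ))]
      congr 1; ext v; congr 1; ext1 l
      simpa using chainVertex_mul_finRotate v π l
    have h2 : ((-1 : ℤ) ^ d) * (-1) ^ d = 1 := by rw [← mul_pow]; simp
    simp only [Equiv.coe_mulRight, h1, Perm.sign_mul, sign_finRotate]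
    push_cast
    linear_combination (-(Perm.sign π : ℤ) * I π 0) * h2
  rw [hsum, Fin.sum_univ_succ, Fin.sum_univ_castSucc]
  simp only [Fin.succ_castSucc, Fin.succ_last, hmid, mul_zero, Finset.sum_const_zero, hend]
  simp [pow_succ]

theorem det_eq_zero_of_row_eq_smul {n : Type*} [Fintype n] [DecidableEq n] {R : Type*} [CommRing R]
    {M : Matrix n n R} {i j : n} (hij : i ≠ j) (b : R) (h : M i = b • M j) : M.det = 0 := by
  rw [← M.updateRow_eq_self i, h, det_updateRow_smul,
    det_zero_of_row_eq hij (by rw [updateRow_self, updateRow_ne hij.symm]), mul_zero]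

/-- Up to a factor `n!`, the signed volume of the image under the affine extension of `s` of a
simplex of the Freudenthal triangulation. -/
def cellDet {n : ℕ} (s : Fin n → (Fin n → ℤ) → ℤ) (v : Fin n → ℤ) (π : Perm (Fin n)) : ℤ :=
  det (.of fun a j : Fin (n + 1) =>
    (Fin.cons 1 s : Fin (n + 1) → (Fin n → ℤ) → ℤ) a (chainVertex v π j))

theorem cellDet_eq_zero {n : ℕ} {s : Fin n → (Fin n → ℤ) → ℤ} {v : Fin n → ℤ}
    {π : Perm (Fin n)} (i : Fin n) (b : ℤ) (h : ∀ j, s i (chainVertex v π j) = b) :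
    cellDet s v π = 0 :=
  det_eq_zero_of_row_eq_smul (Fin.succ_ne_zero i) b (by ext j; simp [h])

theorem finite_support_of_box {n : ℕ} {β : Type*} [Zero β] (N : ℤ) (F : (Fin n → ℤ) → β)
    (h0 : ∀ v i, v i < 0 → F v = 0) (h1 : ∀ v i, N ≤ v i → F v = 0) :
    (Function.support F).Finite := by
  refine (Set.finite_Icc (0 : Fin n → ℤ) (fun _ => N)).subset fun v hv => ⟨fun i => ?_, fun i => ?_⟩
  · by_contra h
    exact hv (h0 v i (not_le.1 h))
  · by_contra h
    exact hv (h1 v i (not_le.1 h).le)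

theorem finite_support_cellDet {n : ℕ} {N : ℤ} {s : Fin n → (Fin n → ℤ) → ℤ} {b : Fin n → ℤ}
    (h0 : ∀ i x, x i ≤ 0 → s i x = 0) (h1 : ∀ i x, N ≤ x i → s i x = b i) :
    (Function.support fun v => ∑ π, (Perm.sign π : ℤ) * cellDet s v π).Finite := by
  refine finite_support_of_box N _ (fun v i hv => ?_) (fun v i hv => ?_) <;>
  refine Finset.sum_eq_zero fun π _ => ?_
  · rw [cellDet_eq_zero i 0 fun j => h0 i _ ?_, mul_zero]
    have := chainVertex_le v π j i
    omega
  · rw [cellDet_eq_zero i (b i) fun j => h1 i _ ?_, mul_zero]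
    exact hv.trans (le_chainVertex v π j i)

theorem finsum_cellDet_eq_zero {n : ℕ} {N : ℤ} {s : Fin n → (Fin n → ℤ) → ℤ} {b : Fin n → ℤ}
    (h0 : ∀ i x, x i ≤ 0 → s i x = 0) (h1 : ∀ i x, N ≤ x i → s i x = b i) (k : Fin n)
    (hk : b k = 0) :
    ∑ᶠ v, ∑ π, (Perm.sign π : ℤ) * cellDet s v π = 0 := by
  obtain _ | d := n
  · exact k.elim0
  set r : Fin (d + 2) → (Fin (d + 1) → ℤ) → ℤ := Fin.cons 1 s with hr
  let m (u : Fin (d + 1) → Fin (d + 1) → ℤ) : ℤ :=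
    det (.of fun a l => r (k.succ.succAbove a) (u l))
  let c (u : Fin (d + 1) → Fin (d + 1) → ℤ) : ℤ := (∑ l, s k (u l)) * m u
  have hr0 : r (k.succ.succAbove 0) = 1 := by rw [Fin.succ_succAbove_zero]; rfl
  have hm (w : Fin (d + 2) → Fin (d + 1) → ℤ) :
      ∑ j : Fin (d + 2), (-1) ^ (j : ℕ) * m (w ∘ j.succAbove) = 0 := by
    let M : Matrix (Fin (d + 2)) (Fin (d + 2)) ℤ :=
      .of fun a j => (Fin.cons 1 fun a => r (k.succ.succAbove a) :
        Fin (d + 2) → (Fin (d + 1) → ℤ) → ℤ) a (w j)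
    have hM : M.det = 0 := det_zero_of_row_eq (i := 0) (j := Fin.succ 0) (Fin.succ_ne_zero 0).symm
      (by ext j; simp only [M, of_apply, Fin.cons_zero, Fin.cons_succ, hr0])
    rw [det_succ_row_zero] at hM
    rw [← hM]
    refine Finset.sum_congr rfl fun j _ => ?_
    simp only [M, of_apply, Fin.cons_zero, Pi.one_apply, mul_one]
    rfl
  have hcell (v : Fin (d + 1) → ℤ) (π : Perm (Fin (d + 1))) : cellDet s v π =
      (-1) ^ (k : ℕ) * ∑ j : Fin (d + 2), (-1) ^ (j : ℕ) * c (chainVertex v π ∘ j.succAbove) := by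
    have hc (j : Fin (d + 2)) : c (chainVertex v π ∘ j.succAbove) =
        ((∑ l, s k (chainVertex v π l)) - s k (chainVertex v π j)) *
          m (chainVertex v π ∘ j.succAbove) := by
      rw [Fin.sum_univ_succAbove _ j]; simp [c]
    have h : ∑ j : Fin (d + 2), (-1) ^ (j : ℕ) * c (chainVertex v π ∘ j.succAbove) =
        -∑ j : Fin (d + 2), (-1) ^ (j : ℕ) *
          (s k (chainVertex v π j) * m (chainVertex v π ∘ j.succAbove)) := by
      rw [← sub_eq_zero, sub_neg_eq_add, ← Finset.sum_add_distrib,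
        ← mul_zero (∑ l, s k (chainVertex v π l)), ← hm (chainVertex v π), Finset.mul_sum]
      refine Finset.sum_congr rfl fun j _ => ?_
      rw [hc]; ring
    rw [h, cellDet, det_succ_row _ k.succ, mul_neg, ← neg_mul, Finset.mul_sum]
    refine Finset.sum_congr rfl fun j _ => ?_
    simp only [of_apply, Fin.cons_succ, Fin.val_succ, pow_add, pow_one]
    have : m (chainVertex v π ∘ j.succAbove) = det (submatrix (.of fun a j : Fin (d + 2) =>
      (Fin.cons 1 s : Fin (d + 2) → (Fin (d + 1) → ℤ) → ℤ) a (chainVertex v π j))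
        k.succ.succAbove j.succAbove) := rfl
    rw [this]; ring
  have hc0 (u : Fin (d + 1) → Fin (d + 1) → ℤ) (i : Fin (d + 1)) (t : ℤ) (hik : i = k → t = 0)
      (h : ∀ l, s i (u l) = t) : c u = 0 := by
    by_cases hik' : i = k
    · subst hik'; simp [c, h, hik rfl]
    · obtain ⟨a, ha⟩ := Fin.exists_succAbove_eq (x := i.succ) (y := k.succ) (by simpa using hik')
      have ha0 : a ≠ 0 := by
        rintro rfl
        rw [Fin.succ_succAbove_zero] at ha
        exact Fin.succ_ne_zero _ ha.symm
      have : m u = 0 := det_eq_zero_of_row_eq_smul ha0 t (by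
        ext l
        simp only [of_apply, ha, Pi.smul_apply, hr0]
        simp [hr, h])
      simp [c, this]
  simp only [hcell, mul_left_comm _ ((-1 : ℤ) ^ (k : ℕ)), ← Finset.mul_sum]
  have hfin : ∀ π j, (Function.support fun v => c (chainVertex v π ∘ Fin.succAbove j)).Finite := by
    intro π j
    refine finite_support_of_box N _ (fun v i hv => ?_) (fun v i hv => ?_)
    · refine hc0 _ i 0 (fun _ => rfl) fun l => h0 i _ ?_
      have := chainVertex_le v π (j.succAbove l) i
      simp only [Function.comp_apply]; omega
    · refine hc0 _ i (b i) (fun h => h ▸ hk) fun l => h1 i _ ?_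
      exact hv.trans (le_chainVertex v π _ i)
  have key := finsum_facets_eq_zero c hfin
  have hsmul := smul_finsum ((-1 : ℤ) ^ (k : ℕ)) fun v =>
    ∑ π : Perm (Fin (d + 1)), (Perm.sign π : ℤ) *
      ∑ j : Fin (d + 2), (-1) ^ (j : ℕ) * c (chainVertex v π ∘ j.succAbove)
  rw [key, smul_zero] at hsmul
  exact hsmul.symm

theorem finsum_cellDet_update {n : ℕ} {N : ℤ} {s : Fin n → (Fin n → ℤ) → ℤ}
    (h0 : ∀ i x, x i ≤ 0 → s i x = 0) (h1 : ∀ i x, N ≤ x i → s i x = 1) (k : Fin n)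
    {t : (Fin n → ℤ) → ℤ} (ht0 : ∀ x, x k ≤ 0 → t x = 0) (ht1 : ∀ x, N ≤ x k → t x = 1) :
    ∑ᶠ v, ∑ π, (Perm.sign π : ℤ) * cellDet (Function.update s k t) v π =
      ∑ᶠ v, ∑ π, (Perm.sign π : ℤ) * cellDet s v π := by
  have hadd (v : Fin n → ℤ) (π : Perm (Fin n)) : cellDet (Function.update s k (t - s k)) v π =
      cellDet (Function.update s k t) v π - cellDet s v π := by
    have h (g : (Fin n → ℤ) → ℤ) : cellDet (Function.update s k g) v π =
        det (updateRow (.of fun a j : Fin (n + 1) =>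
          (Fin.cons 1 s : Fin (n + 1) → (Fin n → ℤ) → ℤ) a (chainVertex v π j)) k.succ
          fun j => g (chainVertex v π j)) := by
      unfold cellDet
      congr 1
      ext a j
      rw [updateRow_apply, of_apply, Fin.cons_update]
      split_ifs with h
      · rw [h, Function.update_self]
      · rw [Function.update_of_ne h, of_apply]
    have h' : cellDet s v π = cellDet (Function.update s k (s k)) v π := by
      rw [Function.update_eq_self]
    rw [h', h, h, h, eq_sub_iff_add_eq, ← det_updateRow_add]
    congr 2
    ext j
    simp
  have hs := finite_support_cellDet h0 h1
  have hupd {g : (Fin n → ℤ) → ℤ} (hg0 : ∀ x, x k ≤ 0 → g x = 0) (i : Fin n) (x : Fin n → ℤ)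
      (hx : x i ≤ 0) : Function.update s k g i x = 0 := by
    by_cases hi : i = k
    · subst hi; rw [Function.update_self]; exact hg0 x hx
    · rw [Function.update_of_ne hi]; exact h0 i x hx
  have hupd' {g : (Fin n → ℤ) → ℤ} {c : ℤ} (hg1 : ∀ x, N ≤ x k → g x = c) (i : Fin n)
      (x : Fin n → ℤ) (hx : N ≤ x i) :
      Function.update s k g i x = Function.update (1 : Fin n → ℤ) k c i := by
    by_cases hi : i = k
    · subst hi; rw [Function.update_self, Function.update_self]; exact hg1 x hx
    · rw [Function.update_of_ne hi, Function.update_of_ne hi]; exact h1 i x hx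
  have key := finsum_cellDet_eq_zero
    (hupd (g := t - s k) fun x hx => by simp [ht0 x hx, h0 k x hx])
    (hupd' (g := t - s k) (c := 0) fun x hx => by simp [ht1 x hx, h1 k x hx]) k (by simp)
  simp only [hadd, mul_sub, Finset.sum_sub_distrib] at key
  rw [finsum_sub_distrib (finite_support_cellDet (hupd ht0) (hupd' ht1)) hs] at key
  exact sub_eq_zero.1 key

theorem finsum_cellDet_indicator (n : ℕ) :
    ∑ᶠ v, ∑ π, (Perm.sign π : ℤ) *
      cellDet (fun (i : Fin n) x => if x i ≤ 0 then 0 else 1) v π = n.factorial := by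
  rw [finsum_eq_single _ 0]
  · have h (π : Perm (Fin n)) :
        cellDet (fun (i : Fin n) x => if x i ≤ 0 then 0 else 1) 0 π = Perm.sign π := by
      let U : Matrix (Fin (n + 1)) (Fin (n + 1)) ℤ := .of fun a j => if a ≤ j then 1 else 0
      have hU : U.det = 1 := by
        rw [det_of_isUpperTriangular]
        · simp [U]
        · intro a j haj
          exact if_neg (not_le.2 haj)
      have h := det_permute (Perm.decomposeFin.symm (0, π.symm)) U
      rw [hU, mul_one, Perm.decomposeFin.symm_sign] at h
      simp only [if_pos, one_mul, Perm.sign_symm] at h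
      refine Eq.trans ?_ h
      unfold cellDet
      congr 1
      ext a j
      refine Fin.cases ?_ (fun i => ?_) a
      · simp [U]
      · simp only [of_apply, Fin.cons_succ, chainVertex, submatrix_apply, U, id,
          Perm.decomposeFin_symm_apply_succ, Pi.zero_apply, zero_add, swap_self, refl_apply,
          ← Fin.castSucc_lt_iff_succ_le]
        split_ifs <;> simp_all
    simp only [h]
    simp [← Units.val_mul, Fintype.card_perm]
  · intro v hv
    obtain ⟨i, hi⟩ := Function.ne_iff.1 hv
    refine Finset.sum_eq_zero fun π _ => ?_
    rcases lt_or_gt_of_ne hi with hi | hi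
    · have h (j) : chainVertex v π j i ≤ 0 := (chainVertex_le v π j i).trans hi
      rw [cellDet_eq_zero i 0 fun j => by rw [if_pos (h j)], mul_zero]
    · have h (j) : ¬ chainVertex v π j i ≤ 0 := not_le.2 (hi.trans_le (le_chainVertex v π j i))
      rw [cellDet_eq_zero i 1 fun j => by rw [if_neg (h j)], mul_zero]

theorem finsum_cellDet {n : ℕ} {N : ℤ} (hN : 0 < N) {s : Fin n → (Fin n → ℤ) → ℤ}
    (h0 : ∀ i x, x i ≤ 0 → s i x = 0) (h1 : ∀ i x, N ≤ x i → s i x = 1) :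
    ∑ᶠ v, ∑ π, (Perm.sign π : ℤ) * cellDet s v π = n.factorial := by
  let t : Fin n → (Fin n → ℤ) → ℤ := fun i x => if x i ≤ 0 then 0 else 1
  have ht0 (i x) (hx : x i ≤ 0) : t i x = 0 := if_pos hx
  have ht1 (i x) (hx : N ≤ x i) : t i x = 1 := if_neg (by omega)
  have key (K : Finset (Fin n)) : ∑ᶠ v, ∑ π, (Perm.sign π : ℤ) * cellDet (K.piecewise t s) v π =
      ∑ᶠ v, ∑ π, (Perm.sign π : ℤ) * cellDet s v π := by
    induction K using Finset.induction_on with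
    | empty => simp
    | insert k K _ ih =>
      rw [Finset.piecewise_insert, finsum_cellDet_update (N := N) _ _ k (ht0 k) (ht1 k), ih] <;>
      intro i x hx <;> by_cases hi : i ∈ K <;> simp [hi, h0, h1, ht0, ht1, hx]
  rw [← key Finset.univ, Finset.piecewise_univ]
  exact finsum_cellDet_indicator n

/-- A cubical Sperner lemma: if `s i` vanishes below the face `x i = 0` and equals one above the
face `x i = N`, then there is a unit cube on which no `s i` is constant. -/
theorem exists_unit_cube_not_constant {n : ℕ} {N : ℤ} (hN : 0 < N)
    {s : Fin n → (Fin n → ℤ) → ℤ} (h0 : ∀ i x, x i ≤ 0 → s i x = 0)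
    (h1 : ∀ i x, N ≤ x i → s i x = 1) :
    ∃ v : Fin n → ℤ, (∀ i, 0 ≤ v i ∧ v i < N) ∧
      ∀ i b, ∃ x, v ≤ x ∧ x ≤ v + 1 ∧ s i x ≠ b := by
  by_contra! H
  have : ∑ᶠ v, ∑ π, (Perm.sign π : ℤ) * cellDet s v π = 0 := by
    refine (finsum_congr fun v => Finset.sum_eq_zero fun π _ => ?_).trans finsum_zero
    have hle (j) : chainVertex v π j ≤ v + 1 := chainVertex_le v π j
    have hge (j) : v ≤ chainVertex v π j := le_chainVertex v π j
    by_cases hv : ∀ i, 0 ≤ v i ∧ v i < N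
    · obtain ⟨i, b, h⟩ := H v hv
      rw [cellDet_eq_zero i b fun j => h _ (hge j) (hle j), mul_zero]
    · push Not at hv
      obtain ⟨i, hi⟩ := hv
      by_cases hvi : 0 ≤ v i
      · rw [cellDet_eq_zero i 1 fun j => h1 i _ ((hi hvi).trans (hge j i)), mul_zero]
      · rw [cellDet_eq_zero i 0 fun j => h0 i _ ?_, mul_zero]
        have := hle j i
        simp only [Pi.add_apply, Pi.one_apply] at this
        omega
  rw [finsum_cellDet hN h0 h1] at this
  exact n.factorial_ne_zero (by exact_mod_cast this)

/-- The **Poincaré–Miranda theorem**. -/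
theorem poincare_miranda {n : ℕ} {f : (Fin n → ℝ) → Fin n → ℝ} (hf : ContinuousOn f (Icc 0 1))
    (h0 : ∀ x ∈ Icc (0 : Fin n → ℝ) 1, ∀ i, x i = 0 → f x i ≤ 0)
    (h1 : ∀ x ∈ Icc (0 : Fin n → ℝ) 1, ∀ i, x i = 1 → 0 ≤ f x i) :
    ∃ x ∈ Icc (0 : Fin n → ℝ) 1, f x = 0 := by
  by_contra! H
  obtain ⟨x₀, hx₀, hmin⟩ := isCompact_Icc.exists_isMinOn
    (nonempty_Icc.2 (zero_le_one (α := Fin n → ℝ))) hf.norm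
  have hε : 0 < ‖f x₀‖ := norm_pos_iff.2 (H x₀ hx₀)
  obtain ⟨δ, hδ, hfδ⟩ := Metric.uniformContinuousOn_iff.1
    (isCompact_Icc.uniformContinuousOn_of_continuous hf) _ hε
  obtain ⟨N, hN⟩ := exists_nat_one_div_lt hδ
  have hN0 : (0 : ℝ) < N + 1 := by positivity
  let p (x : Fin n → ℤ) : Fin n → ℝ := fun i => x i / (N + 1)
  have hp {x : Fin n → ℤ} (hx : ∀ i, 0 ≤ x i ∧ x i ≤ N + 1) : p x ∈ Icc (0 : Fin n → ℝ) 1 :=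
    ⟨fun i => div_nonneg (Int.cast_nonneg (hx i).1) hN0.le,
      fun i => (div_le_one hN0).2 (by exact_mod_cast (hx i).2)⟩
  classical
  obtain ⟨v, hv, hs⟩ := exists_unit_cube_not_constant (N := N + 1) (by omega)
    (s := fun i x => if x i ≤ 0 then 0 else if N + 1 ≤ x i then 1 else if f (p x) i ≤ 0 then 0
      else 1) (fun i x hx => if_pos hx)
    (fun i x hx => by rw [if_neg (by omega), if_pos hx])
  have hcube {x : Fin n → ℤ} (hvx : v ≤ x) (hxv : x ≤ v + 1) (i : Fin n) :
      0 ≤ x i ∧ x i ≤ N + 1 := by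
    have h1 := hv i
    have h2 : v i ≤ x i := hvx i
    have h3 : x i ≤ v i + 1 := hxv i
    omega
  have hpv := hp (hcube le_rfl (by simp))
  have hclose {x : Fin n → ℤ} (hvx : v ≤ x) (hxv : x ≤ v + 1) (i : Fin n) :
      |f (p v) i - f (p x) i| < ‖f x₀‖ := by
    have hdist : dist (p v) (p x) < δ := by
      refine ((dist_pi_le_iff (by positivity)).2 fun i => ?_).trans_lt hN
      have h2 : v i ≤ x i := hvx i
      have h3 : x i ≤ v i + 1 := hxv i
      rw [Real.dist_eq, ← sub_div, abs_div, abs_of_pos hN0]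
      gcongr
      have : |v i - x i| ≤ 1 := abs_le.2 (by omega)
      exact_mod_cast this
    exact (dist_le_pi_dist (f (p v)) (f (p x)) i).trans_lt (hfδ _ hpv _ (hp (hcube hvx hxv)) hdist)
  refine (isMinOn_iff.1 hmin _ hpv).not_gt ((pi_norm_lt_iff hε).2 fun i => ?_)
  obtain ⟨x, hvx, hxv, hx⟩ := hs i 1
  obtain ⟨y, hvy, hyv, hy⟩ := hs i 0
  have hx' : f (p x) i ≤ 0 := by
    have hc := hcube hvx hxv
    rcases (hc i).1.eq_or_lt with h | h
    · exact h0 _ (hp hc) i (by simp [p, ← h])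
    · by_contra h'
      simp [h', h.not_ge] at hx
  have hy' : 0 ≤ f (p y) i := by
    have hc := hcube hvy hyv
    rcases (hc i).2.eq_or_lt with h | h
    · exact h1 _ (hp hc) i (by simp [p, h, hN0.ne'])
    · by_contra h'
      simp [(not_le.1 h').le, h.not_ge] at hy
  have hvx := abs_lt.1 (hclose hvx hxv i)
  have hvy := abs_lt.1 (hclose hvy hyv i)
  exact abs_lt.2 ⟨by linarith, by linarith⟩

/-- Two sets at distance more than `ε` are separated by a function whose zeros lie in the walls of
any given grid of mesh `ε`. -/
theorem exists_continuous_zeros_in_grid {m : ℕ} {ε : ℝ} (hε : 0 < ε) (τ : ℝ)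
    {A B : Set (Fin m → ℝ)} (hA : A.Nonempty) (hB : B.Nonempty)
    (hAB : ∀ a ∈ A, ∀ b ∈ B, ε < dist a b) :
    ∃ g : (Fin m → ℝ) → ℝ, Continuous g ∧ (∀ a ∈ A, g a ≤ 0) ∧ (∀ b ∈ B, 0 ≤ g b) ∧
      ∀ y, g y = 0 → ∃ j, ∃ z : ℤ, y j / ε - τ = z := by
  let cell (y : Fin m → ℝ) : Fin m → ℤ := fun j => ⌊y j / ε - τ⌋
  let U : Set (Fin m → ℝ) := {y | ∃ a ∈ A, cell a = cell y}
  have hAU : A ⊆ U := fun a ha => ⟨a, ha, rfl⟩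
  have hBU : B ⊆ Uᶜ := by
    rintro b hb ⟨a, ha, hab⟩
    refine (hAB a ha b hb).not_ge ((dist_pi_le_iff hε.le).2 fun j => ?_)
    have h := Int.abs_sub_lt_one_of_floor_eq_floor (congrFun hab j)
    rw [sub_sub_sub_cancel_right, ← sub_div, abs_div, abs_of_pos hε, div_lt_one hε] at h
    exact h.le
  refine ⟨fun y => Metric.infDist y U - Metric.infDist y Uᶜ,
    (Metric.continuous_infDist_pt _).sub (Metric.continuous_infDist_pt _), fun a ha => ?_,
    fun b hb => ?_, fun y hy => ?_⟩
  · simp only [Metric.infDist_zero_of_mem (hAU ha), zero_sub, neg_nonpos]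
    exact Metric.infDist_nonneg
  · simp only [Metric.infDist_zero_of_mem (hBU hb), sub_zero]
    exact Metric.infDist_nonneg
  · by_contra! H
    have hloc : ∀ᶠ y' in 𝓝 y, cell y' = cell y := by
      have h (j : Fin m) : ∀ᶠ y' : Fin m → ℝ in 𝓝 y, cell y' j = cell y j := by
        have hc : Continuous (fun y' : Fin m → ℝ => y' j / ε - τ) := by
          simp only [div_eq_mul_inv]
          fun_prop
        have hlt : (⌊y j / ε - τ⌋ : ℝ) < y j / ε - τ :=
          lt_of_le_of_ne (Int.floor_le _) (H j _).symm
        filter_upwards [hc.continuousAt.eventually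
          (Ioo_mem_nhds hlt (Int.lt_floor_add_one _))] with y' hy'
        exact Int.floor_eq_iff.2 ⟨hy'.1.le, hy'.2⟩
      filter_upwards [eventually_all.2 h] with y' hy' using funext hy'
    have hsub := sub_eq_zero.1 hy
    by_cases hyU : y ∈ U
    · rw [Metric.infDist_zero_of_mem hyU, eq_comm,
        ← Metric.mem_closure_iff_infDist_zero (hB.mono hBU), mem_closure_iff_frequently] at hsub
      obtain ⟨y', hy'U, hy'⟩ := (hsub.and_eventually hloc).exists
      obtain ⟨a, ha, hay⟩ := hyU
      exact hy'U ⟨a, ha, hay.trans hy'.symm⟩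
    · rw [Metric.infDist_zero_of_mem (s := Uᶜ) hyU,
        ← Metric.mem_closure_iff_infDist_zero (hA.mono hAU), mem_closure_iff_frequently] at hsub
      obtain ⟨y', ⟨a, ha, hay⟩, hy'⟩ := (hsub.and_eventually hloc).exists
      exact hyU ⟨a, ha, hay.trans hy'⟩

/-- The `n`-cube does not embed into `ℝ^m` for `m < n`. -/
theorem not_injOn_cube {n m : ℕ} (hmn : m < n) {φ : (Fin n → ℝ) → Fin m → ℝ}
    (hφ : ContinuousOn φ (Icc 0 1)) : ¬ InjOn φ (Icc 0 1) := by
  intro hinj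
  let face (t : ℝ) (i : Fin n) : Set (Fin n → ℝ) := Icc 0 1 ∩ {x | x i = t}
  have hcpt (t : ℝ) (i : Fin n) : IsCompact (φ '' face t i) :=
    (isCompact_Icc.inter_right (isClosed_eq (continuous_apply i)
      continuous_const)).image_of_continuousOn (hφ.mono inter_subset_left)
  have hne0 (i : Fin n) : (φ '' face 0 i).Nonempty :=
    ⟨_, 0, ⟨⟨le_rfl, zero_le_one⟩, rfl⟩, rfl⟩
  have hne1 (i : Fin n) : (φ '' face 1 i).Nonempty :=
    ⟨_, 1, ⟨⟨zero_le_one, le_rfl⟩, rfl⟩, rfl⟩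
  have hdisj (i : Fin n) : Disjoint (φ '' face 0 i) (φ '' face 1 i) := by
    refine disjoint_left.2 ?_
    rintro _ ⟨x, hx, rfl⟩ ⟨y, hy, hxy⟩
    have hyi : y i = 1 := hy.2
    rw [hinj hy.1 hx.1 hxy, hx.2] at hyi
    exact zero_ne_one hyi
  have hsep (i : Fin n) : ∀ᶠ ε in 𝓝[>] (0 : ℝ),
      ∀ a ∈ φ '' face 0 i, ∀ b ∈ φ '' face 1 i, ε < dist a b := by
    obtain ⟨δ, hδ, h⟩ := (hdisj i).exists_thickenings (hcpt 0 i) (hcpt 1 i).isClosed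
    filter_upwards [Ioo_mem_nhdsGT hδ] with ε hε a ha b hb
    by_contra! hab
    exact disjoint_left.1 h (Metric.mem_thickening_iff.2 ⟨a, ha, by simpa using hδ⟩ :
      a ∈ Metric.thickening δ _) (Metric.mem_thickening_iff.2 ⟨b, hb, hab.trans_lt hε.2⟩)
  obtain ⟨ε, hsepε, hε⟩ := ((eventually_all.2 hsep).and self_mem_nhdsWithin).exists
  choose g hg hg0 hg1 hgz using fun i : Fin n => exists_continuous_zeros_in_grid hε
    ((i : ℝ) / n) (hne0 i) (hne1 i) (hsepε i)
  obtain ⟨x, -, hx⟩ := poincare_miranda (f := fun x i => g i (φ x))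
    (continuousOn_pi.2 fun i => (hg i).comp_continuousOn hφ)
    (fun x hx i hi => hg0 i _ ⟨x, ⟨hx, hi⟩, rfl⟩) (fun x hx i hi => hg1 i _ ⟨x, ⟨hx, hi⟩, rfl⟩)
  choose j z hz using fun i => hgz i (φ x) (congrFun hx i)
  obtain ⟨i, i', hne, hij⟩ := Fintype.exists_ne_map_eq_of_card_lt j (by simpa using hmn)
  have hn : (n : ℝ) ≠ 0 := by exact_mod_cast (Nat.zero_lt_of_lt hmn).ne'
  have h : ((i : ℕ) : ℝ) - (i' : ℕ) = (z i' - z i) * n := by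
    rw [← hz, ← hz, hij]
    field_simp
    ring
  have h' : ((i : ℕ) : ℤ) - (i' : ℕ) = n * (z i' - z i) := by
    rw [mul_comm]; exact_mod_cast h
  have h0 := Int.eq_zero_of_abs_lt_dvd ⟨_, h'⟩ (abs_lt.2 (by omega))
  exact hne (Fin.ext (by omega))

theorem isEmpty_homeomorph_of_interior_nonempty {n m : ℕ} (hmn : m < n)
    {A : Set (EuclideanSpace ℝ (Fin n))} (hA : (interior A).Nonempty)
    (B : Set (EuclideanSpace ℝ (Fin m))) : IsEmpty (A ≃ₜ B) := by
  refine ⟨fun h => ?_⟩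
  obtain ⟨p, hp⟩ := hA
  obtain ⟨ρ, hρ, hball⟩ := Metric.isOpen_iff.1 isOpen_interior p hp
  obtain ⟨C, hC, hbound⟩ := ((isCompact_Icc (a := (0 : Fin n → ℝ)) (b := 1)).image
    (PiLp.continuous_toLp 2 _)).isBounded.exists_pos_norm_lt
  let e (x : Fin n → ℝ) : EuclideanSpace ℝ (Fin n) := p + (ρ / C) • WithLp.toLp 2 x
  have he : Continuous e := by fun_prop
  have heA {x : Fin n → ℝ} (hx : x ∈ Icc (0 : Fin n → ℝ) 1) : e x ∈ A := by
    refine interior_subset (hball ?_)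
    rw [mem_ball_iff_norm, add_sub_cancel_left, norm_smul, Real.norm_of_nonneg (by positivity),
      div_mul_eq_mul_div, div_lt_iff₀ hC]
    exact mul_lt_mul_of_pos_left (hbound _ (mem_image_of_mem _ hx)) hρ
  classical
  let φ (x : Fin n → ℝ) : Fin m → ℝ := if hx : e x ∈ A then (h ⟨e x, hx⟩).1.ofLp else 0
  have hφ : (Icc (0 : Fin n → ℝ) 1).domRestrict φ =
      fun x : Icc (0 : Fin n → ℝ) 1 => (h ⟨e x, heA x.2⟩).1.ofLp :=
    funext fun x => dif_pos (heA x.2)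
  refine not_injOn_cube hmn (φ := φ) ?_ ?_
  · rw [continuousOn_iff_continuous_domRestrict, hφ]
    exact (PiLp.continuous_ofLp 2 _).comp (continuous_subtype_val.comp
      (h.continuous.comp ((he.comp continuous_subtype_val).subtype_mk _)))
  · rw [injOn_iff_injective, hφ]
    intro x y hxy
    have := congrArg Subtype.val (h.injective (Subtype.ext (WithLp.ofLp_injective 2 hxy)))
    have hne : ρ / C ≠ 0 := by positivity
    exact Subtype.ext (WithLp.toLp_injective 2 (smul_right_injective _ hne (add_left_cancel this)))

/-- Brouwer's invariance of dimension theorem: if `m < n`, then no subset of `ℝ^n`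
with nonempty interior is homeomorphic to a subset of `ℝ^m`.  In particular, `ℝ^n`
and `ℝ^m` are not homeomorphic whenever `n ≠ m`. -/
theorem invariance_of_dimension (n m : ℕ) (hmn : m < n) :
    (∀ A : Set (EuclideanSpace ℝ (Fin n)), (interior A).Nonempty →
      ∀ B : Set (EuclideanSpace ℝ (Fin m)), IsEmpty (↥A ≃ₜ ↥B)) ∧
    ∀ n' m' : ℕ, n' ≠ m' →
      IsEmpty (EuclideanSpace ℝ (Fin n') ≃ₜ EuclideanSpace ℝ (Fin m')) := by
  refine ⟨fun A hA B => isEmpty_homeomorph_of_interior_nonempty hmn hA B, fun n' m' hne => ?_⟩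
  have key {a b : ℕ} (hab : a < b) :
      IsEmpty (EuclideanSpace ℝ (Fin b) ≃ₜ EuclideanSpace ℝ (Fin a)) := by
    refine ⟨fun h => (isEmpty_homeomorph_of_interior_nonempty hab (A := Set.univ) ?_
      Set.univ).false (((Homeomorph.Set.univ _).trans h).trans (Homeomorph.Set.univ _).symm)⟩
    simp
  rcases hne.lt_or_gt with h | h
  · exact ⟨fun e => (key h).false e.symm⟩
  · exact key h
end

section
/- Invariance of dimension for polyhedra: Let S and Q be geometric simplicial complexes (in ℝ^d and ℝ^e) of dimensions n and m respectively. If n ≠ m, then the polyhedra |S| and |Q| are not homeomorphic. -/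
open scoped Classical
open Finset

variable {E : Type*} [AddCommGroup E] [Module ℝ E]

/-- The polyhedron of a geometric simplicial complex: the union of its simplices. -/
def GeomComplex.space (S : GeomComplex E) : Set E :=
  ⋃ σ ∈ S.faces, convexHull ℝ (σ : Set E)

/-- A geometric simplicial complex has dimension `n` if it contains an `n`-simplex
(a simplex with `n + 1` vertices) and no simplex of larger dimension. -/
def GeomComplex.HasDim (S : GeomComplex E) (n : ℕ) : Prop :=
  (∃ σ ∈ S.faces, σ.card = n + 1) ∧ ∀ σ ∈ S.faces, σ.card ≤ n + 1

open Set Metric MeasureTheory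

/-- Lagrange interpolation of the polynomial `s ↦ det (1 + s • A)` at the nodes `t i`, evaluated
at `1`. -/
theorem exists_weights_det_one_add_smul (n : ℕ) {t : ℕ → ℝ} (ht : Function.Injective t) :
    ∃ w : ℕ → ℝ, ∑ i ∈ Finset.range (n + 1), w i = 1 ∧
      ∀ A : Matrix (Fin n) (Fin n) ℝ,
        (1 + A).det = ∑ i ∈ Finset.range (n + 1), w i * (1 + t i • A).det := by
  have hinj : Set.InjOn t (Finset.range (n + 1) : Set ℕ) := ht.injOn
  refine ⟨fun i => (Lagrange.basis (Finset.range (n + 1)) t i).eval 1, ?_, fun A => ?_⟩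
  · rw [← Polynomial.eval_finsetSum, Lagrange.sum_basis hinj ⟨0, by simp⟩, Polynomial.eval_one]
  · set p : Polynomial ℝ := ((Polynomial.X : Polynomial ℝ) • A.map Polynomial.C +
      (1 : Matrix (Fin n) (Fin n) ℝ).map Polynomial.C).det with hp
    have heval (s : ℝ) : p.eval s = (1 + s • A).det := by
      rw [hp, ← Polynomial.coe_evalRingHom, RingHom.map_det]
      congr 1
      ext i j
      rcases eq_or_ne i j with rfl | hij
      · simp [Matrix.map_apply]; ring
      · simp [Matrix.one_apply_ne hij, Matrix.map_apply]; ring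
    have hdeg : p.degree < (Finset.range (n + 1)).card := by
      refine Polynomial.degree_le_natDegree.trans_lt ?_
      have := Polynomial.natDegree_det_X_add_C_le A 1
      rw [Fintype.card_fin] at this
      rw [Finset.card_range]
      exact_mod_cast Nat.lt_succ_of_le this
    have h1 := heval 1
    rw [one_smul] at h1
    rw [← h1, Lagrange.eq_interpolate hinj hdeg, Lagrange.interpolate_apply,
      Polynomial.eval_finsetSum]
    refine Finset.sum_congr rfl fun i _ => ?_
    rw [Polynomial.eval_mul, Polynomial.eval_C, heval, mul_comm]

theorem exists_weights_continuousLinearMap_det (V : Type*) [NormedAddCommGroup V]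
    [InnerProductSpace ℝ V] [FiniteDimensional ℝ V] {t : ℕ → ℝ} (ht : Function.Injective t) :
    ∃ (N : ℕ) (w : ℕ → ℝ), ∑ i ∈ Finset.range N, w i = 1 ∧
      ∀ A : V →L[ℝ] V, (1 + A).det = ∑ i ∈ Finset.range N, w i * (1 + t i • A).det := by
  obtain ⟨w, hw, h⟩ := exists_weights_det_one_add_smul (Module.finrank ℝ V) ht
  refine ⟨_, w, hw, fun A => ?_⟩
  have hdet (B : V →L[ℝ] V) :
      B.det = (LinearMap.toMatrix (Module.finBasis ℝ V) (Module.finBasis ℝ V) B).det :=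
    (LinearMap.det_toMatrix _ _).symm
  simpa [hdet, LinearMap.toMatrix_one] using
    h (LinearMap.toMatrix (Module.finBasis ℝ V) (Module.finBasis ℝ V) A)

section Retraction

variable {V : Type*} [NormedAddCommGroup V] [InnerProductSpace ℝ V]

/-- Extending by zero a Lipschitz function on the unit ball that vanishes on the sphere. -/
theorem lipschitzWith_indicator_closedBall {u : V → V} {L : NNReal}
    (hu : LipschitzOnWith L u (closedBall 0 1)) (h0 : ∀ x ∈ sphere (0 : V) 1, u x = 0) :
    LipschitzWith L ((closedBall 0 1).indicator u) := by
  have key : ∀ x ∈ closedBall (0 : V) 1, ∀ y ∉ closedBall (0 : V) 1,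
      dist (u x) 0 ≤ L * dist x y := by
    intro x hx y hy
    obtain ⟨s, hs, hz⟩ : ∃ s ∈ Icc (0 : ℝ) 1, ‖AffineMap.lineMap x y s‖ = 1 := by
      have hc : ContinuousOn (fun s : ℝ => ‖(AffineMap.lineMap x y s : V)‖) (Icc 0 1) := by
        fun_prop
      refine intermediate_value_Icc zero_le_one hc ⟨?_, ?_⟩
      · simpa using hx
      · simpa using (not_le.1 (by simpa using hy)).le
    set z : V := AffineMap.lineMap x y s
    have hzs : z ∈ sphere (0 : V) 1 := by simpa using hz
    calc dist (u x) 0 = dist (u x) (u z) := by rw [h0 z hzs]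
      _ ≤ L * dist x z := hu.dist_le_mul x hx z (sphere_subset_closedBall hzs)
      _ = L * (s * dist x y) := by
        rw [dist_left_lineMap, Real.norm_of_nonneg hs.1]
      _ ≤ L * dist x y := by
        gcongr
        exact mul_le_of_le_one_left dist_nonneg hs.2
  refine LipschitzWith.of_dist_le_mul fun x y => ?_
  by_cases hx : x ∈ closedBall (0 : V) 1 <;> by_cases hy : y ∈ closedBall (0 : V) 1
  · simpa only [indicator_of_mem hx, indicator_of_mem hy] using hu.dist_le_mul x hx y hy
  · simpa only [indicator_of_mem hx, indicator_of_notMem hy] using key x hx y hy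
  · simpa only [indicator_of_notMem hx, indicator_of_mem hy, dist_comm] using key y hy x hx
  · simp only [indicator_of_notMem hx, indicator_of_notMem hy, dist_self]
    positivity

variable [FiniteDimensional ℝ V]

/-- A small Lipschitz perturbation of the identity supported in the unit ball permutes the open
unit ball. -/
theorem bijOn_ball_id_add {g : V → V} {c : NNReal} (hg : LipschitzWith c g) (hc : c < 1)
    (h0 : ∀ x ∉ ball (0 : V) 1, g x = 0) :
    BijOn (fun x => x + g x) (ball 0 1) (ball 0 1) := by
  have happ : ApproximatesLinearOn (fun x => x + g x)
      ((ContinuousLinearEquiv.refl ℝ V : V ≃L[ℝ] V) : V →L[ℝ] V) univ c := by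
    rw [ApproximatesLinearOn.approximatesLinearOn_iff_lipschitzOnWith]
    refine LipschitzWith.lipschitzOnWith ?_
    convert hg using 1
    ext x
    simp
  have hc' : Subsingleton V ∨
      c < ‖((ContinuousLinearEquiv.refl ℝ V).symm : V →L[ℝ] V)‖₊⁻¹ := by
    rcases subsingleton_or_nontrivial V with h | h
    · exact .inl h
    · right
      have : ((ContinuousLinearEquiv.refl ℝ V).symm : V →L[ℝ] V) = ContinuousLinearMap.id ℝ V :=
        rfl
      rw [this, ContinuousLinearMap.nnnorm_id, inv_one]
      exact hc
  have hinj : Function.Injective fun x => x + g x := injOn_univ.1 (happ.injOn hc')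
  have hsurj : Function.Surjective fun x => x + g x := happ.surjective hc'
  have hfix : ∀ x ∉ ball (0 : V) 1, x + g x = x := fun x hx => by rw [h0 x hx, add_zero]
  refine ⟨fun x hx => ?_, hinj.injOn, fun y hy => ?_⟩
  · by_contra hy
    exact hy (by rwa [hinj (hfix _ hy)])
  · obtain ⟨x, hx⟩ := hsurj y
    refine ⟨x, ?_, hx⟩
    by_contra hxn
    exact hxn (by rw [← hfix x hxn]; simpa only [← hx] using hy)

/-- There is no `C¹` retraction of the closed unit ball onto the unit sphere. -/
theorem not_contDiff_retraction_sphere {r : V → V} (hr : ContDiff ℝ 1 r)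
    (hr1 : ∀ x ∈ closedBall (0 : V) 1, ‖r x‖ = 1) (hrid : ∀ x ∈ sphere (0 : V) 1, r x = x) :
    False := by
  let _ : MeasurableSpace V := borel V
  have : BorelSpace V := ⟨rfl⟩
  set u : V → V := fun x => r x - x with hu
  have hud : ContDiff ℝ 1 u := hr.sub contDiff_id
  obtain ⟨L, hL⟩ := hud.contDiffOn.exists_lipschitzOnWith one_ne_zero
    (convex_closedBall (0 : V) 1) (isCompact_closedBall 0 1)
  have hu0 : ∀ x ∈ sphere (0 : V) 1, u x = 0 := fun x hx => by rw [hu]; simp [hrid x hx]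
  have hLip := lipschitzWith_indicator_closedBall hL hu0
  have hg0 : ∀ x ∉ ball (0 : V) 1, (closedBall (0 : V) 1).indicator u x = 0 := by
    intro x hx
    by_cases h : x ∈ closedBall (0 : V) 1
    · rw [indicator_of_mem h]
      refine hu0 x (le_antisymm h ?_)
      simpa using hx
    · exact indicator_of_notMem h _
  have hder (x : V) : HasFDerivAt u (fderiv ℝ u x) x :=
    (hud.differentiable one_ne_zero x).hasFDerivAt
  have hcont : Continuous (fderiv ℝ u) := hud.continuous_fderiv one_ne_zero
  have hbound : ∀ x ∈ ball (0 : V) 1, ‖fderiv ℝ u x‖ ≤ L := fun x hx =>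
    (hder x).le_of_lipschitzOn (mem_nhds_iff.2 ⟨_, ball_subset_closedBall, isOpen_ball, hx⟩) hL
  obtain ⟨δ, hδ, hdet⟩ : ∃ δ > 0, ∀ T : V →L[ℝ] V, dist T 1 < δ → 0 < T.det := by
    have h1 : (0 : ℝ) < (1 : V →L[ℝ] V).det := by
      rw [ContinuousLinearMap.det, ContinuousLinearMap.toLinearMap_one, map_one]
      exact one_pos
    obtain ⟨δ, hδ, h⟩ := Metric.eventually_nhds_iff.1
      ((ContinuousLinearMap.continuous_det.tendsto (1 : V →L[ℝ] V)).eventually (lt_mem_nhds h1))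
    exact ⟨δ, hδ, fun T hT => h hT⟩
  set τ : ℝ := min δ 1 / (2 * (L + 1)) with hτ
  have hτ0 : 0 < τ := by positivity
  have hτL : τ * L < min δ 1 := by
    rw [hτ, div_mul_eq_mul_div, div_lt_iff₀ (by positivity)]
    have := L.coe_nonneg
    have : 0 < min δ 1 := by positivity
    nlinarith
  set t : ℕ → ℝ := fun i => τ / (i + 1) with ht
  have ht0 (i : ℕ) : 0 < t i := by positivity
  have htτ (i : ℕ) : t i * L < min δ 1 := by
    refine lt_of_le_of_lt ?_ hτL
    gcongr
    exact div_le_self hτ0.le (by simp)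
  have htinj : Function.Injective t := by
    intro i j hij
    have hij' : τ / (i + 1) = τ / (j + 1) := hij
    field_simp at hij'
    exact_mod_cast (add_right_cancel hij').symm
  have hvol (i : ℕ) : ∫ x in ball (0 : V) 1, (1 + t i • fderiv ℝ u x).det =
      (volume : Measure V).real (ball 0 1) := by
    set g : V → V := t i • (closedBall (0 : V) 1).indicator u with hg
    have hglip : LipschitzWith (Real.toNNReal (t i) * L) g := by
      refine LipschitzWith.of_dist_le_mul fun x y => ?_
      rw [hg, Pi.smul_apply, Pi.smul_apply, dist_smul₀, Real.norm_of_nonneg (ht0 i).le,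
        NNReal.coe_mul, Real.coe_toNNReal _ (ht0 i).le, mul_assoc]
      exact mul_le_mul_of_nonneg_left (hLip.dist_le_mul x y) (ht0 i).le
    have hbij : BijOn (fun x => x + g x) (ball 0 1) (ball 0 1) := by
      refine bijOn_ball_id_add hglip ?_ fun x hx => by simp [hg, hg0 x hx]
      rw [← NNReal.coe_lt_coe, NNReal.coe_mul, Real.coe_toNNReal _ (ht0 i).le]
      exact (htτ i).trans_le (min_le_right _ _)
    have hfd : ∀ x ∈ ball (0 : V) 1,
        HasFDerivWithinAt (fun x => x + g x) (1 + t i • fderiv ℝ u x) (ball 0 1) x := by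
      intro x hx
      refine HasFDerivAt.hasFDerivWithinAt ?_
      have h1 : HasFDerivAt (fun x => x + t i • u x) (1 + t i • fderiv ℝ u x) x :=
        (hasFDerivAt_id x).add ((hder x).const_smul (t i))
      refine h1.congr_of_eventuallyEq ?_
      filter_upwards [isOpen_ball.mem_nhds hx] with y hy
      simp [hg, indicator_of_mem (ball_subset_closedBall hy)]
    have hpos : ∀ x ∈ ball (0 : V) 1, 0 < (1 + t i • fderiv ℝ u x).det := by
      intro x hx
      refine hdet _ ?_
      rw [dist_eq_norm, add_sub_cancel_left, norm_smul, Real.norm_of_nonneg (ht0 i).le]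
      exact (mul_le_mul_of_nonneg_left (hbound x hx) (ht0 i).le).trans_lt
        ((htτ i).trans_le (min_le_left _ _))
    have := integral_image_eq_integral_abs_det_fderiv_smul volume measurableSet_ball hfd
      hbij.injOn (fun _ => (1 : ℝ))
    rw [hbij.image_eq] at this
    simp only [integral_const, smul_eq_mul, mul_one, measureReal_restrict_apply_univ] at this
    rw [this]
    exact setIntegral_congr_fun measurableSet_ball fun x hx => (abs_of_pos (hpos x hx)).symm
  have hzero : ∀ x ∈ ball (0 : V) 1, (1 + fderiv ℝ u x).det = 0 := by
    intro x hx
    have hrd : HasFDerivAt r (1 + fderiv ℝ u x) x := by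
      refine ((hasFDerivAt_id x).add (hder x)).congr_of_eventuallyEq (.of_forall fun y => ?_)
      simp [hu]
    have hconst : HasFDerivAt (fun y => inner ℝ (r y) (r y)) (0 : V →L[ℝ] ℝ) x := by
      refine (hasFDerivAt_const (1 : ℝ) x).congr_of_eventuallyEq ?_
      filter_upwards [isOpen_ball.mem_nhds hx] with y hy
      rw [real_inner_self_eq_norm_sq, hr1 y (ball_subset_closedBall hy), one_pow]
    have horth (v : V) : inner ℝ (r x) ((1 + fderiv ℝ u x) v) = 0 := by
      have h2 := congrArg (fun T => T v) ((hrd.inner ℝ hrd).unique hconst)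
      simp only [ContinuousLinearMap.comp_apply, ContinuousLinearMap.prod_apply,
        fderivInnerCLM_apply, zero_apply] at h2
      rw [real_inner_comm (r x) ((1 + fderiv ℝ u x) v)] at h2
      linarith
    by_contra hne
    obtain ⟨v, hv⟩ := (LinearMap.equivOfDetNeZero _ hne).surjective (r x)
    have h3 := horth v
    have hv' : (1 + fderiv ℝ u x) v = r x := hv
    rw [hv', real_inner_self_eq_norm_sq, hr1 x (ball_subset_closedBall hx)] at h3
    norm_num at h3
  obtain ⟨N, w, hw, hsum⟩ := exists_weights_continuousLinearMap_det V htinj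
  have hint (i : ℕ) : IntegrableOn (fun x => (1 + t i • fderiv ℝ u x).det) (ball (0 : V) 1) := by
    refine IntegrableOn.mono_set (ContinuousOn.integrableOn_compact
      (isCompact_closedBall (0 : V) 1) ?_) ball_subset_closedBall
    exact (ContinuousLinearMap.continuous_det.comp (by fun_prop)).continuousOn
  have hI : ∫ x in ball (0 : V) 1, (1 + fderiv ℝ u x).det =
      (volume : Measure V).real (ball 0 1) := by
    rw [funext fun x => hsum (fderiv ℝ u x)]
    rw [integral_finsetSum _ fun i _ => (hint i).const_mul _]
    simp_rw [integral_const_mul, hvol, ← Finset.sum_mul, hw, one_mul]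
  rw [setIntegral_congr_fun measurableSet_ball hzero, integral_zero] at hI
  exact (ENNReal.toReal_pos (measure_ball_pos volume (0 : V) one_pos).ne' measure_ball_lt_top.ne).ne hI

/-- A `C¹` map close to the identity on the closed unit ball has a zero there. -/
theorem exists_zero_of_contDiff_of_dist_lt {p : V → V} (hp : ContDiff ℝ 1 p)
    (hpd : ∀ x ∈ closedBall (0 : V) 1, dist (p x) x < 1 / 4) :
    ∃ x ∈ closedBall (0 : V) 1, p x = 0 := by
  by_contra! hp0
  let χ : ContDiffBump (0 : V) := ⟨1 / 2, 3 / 4, by norm_num, by norm_num⟩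
  set q : V → V := fun x => x + χ x • (p x - x) with hq
  have hqd : ContDiff ℝ 1 q := contDiff_id.add (χ.contDiff.smul (hp.sub contDiff_id))
  have hχ0 : ∀ x : V, 1 ≤ ‖x‖ → q x = x := by
    intro x hx
    have : χ x = 0 := χ.zero_of_le_dist (by
      rw [dist_zero_right]
      exact le_trans (by norm_num) hx)
    simp [hq, this]
  have hq0 (x : V) : q x ≠ 0 := by
    rcases le_or_gt 1 ‖x‖ with h1 | h1
    · rw [hχ0 x h1, ← norm_pos_iff]
      exact one_pos.trans_le h1
    have hx : x ∈ closedBall (0 : V) 1 := by simpa using h1.le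
    rcases le_or_gt ‖x‖ (1 / 2) with h2 | h2
    · have : χ x = 1 := χ.one_of_mem_closedBall (mem_closedBall_zero_iff.2 h2)
      simpa [hq, this] using hp0 x hx
    · intro h
      have h3 : ‖x‖ = ‖χ x • (p x - x)‖ := by
        rw [← norm_neg x]
        exact congrArg _ (neg_eq_of_add_eq_zero_right h)
      rw [norm_smul, Real.norm_of_nonneg χ.nonneg, ← dist_eq_norm] at h3
      have h4 := hpd x hx
      have h5 := mul_le_of_le_one_left (dist_nonneg (x := p x) (y := x)) (χ.le_one (x := x))
      linarith
  refine not_contDiff_retraction_sphere (r := fun x => ‖q x‖⁻¹ • q x)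
    (((hqd.norm ℝ hq0).inv fun x => norm_ne_zero_iff.2 (hq0 x)).smul hqd) (fun x _ => ?_)
    fun x hx => ?_
  · rw [norm_smul, norm_inv, norm_norm, inv_mul_cancel₀ (norm_ne_zero_iff.2 (hq0 x))]
  · have hx1 : ‖x‖ = 1 := by simpa using hx
    simp only [hχ0 x hx1.ge, hx1, inv_one, one_smul]

/-- The image of the closed unit ball under a continuous map close to the identity contains a
neighbourhood of the origin. -/
theorem ball_subset_image_closedBall_of_dist_lt {h : V → V} (hc : Continuous h)
    (hd : ∀ x ∈ closedBall (0 : V) 1, dist (h x) x < 1 / 16) :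
    ball (0 : V) (1 / 16) ⊆ h '' closedBall 0 1 := by
  intro y hy
  by_contra hyn
  obtain ⟨δ, hδ, hball⟩ := Metric.isOpen_iff.1
    ((isCompact_closedBall (0 : V) 1).image hc).isClosed.isOpen_compl y hyn
  obtain ⟨p, hp, hph, -⟩ := hc.exists_contDiff_approx 1 (ε := fun _ => min δ (1 / 16))
    continuous_const fun _ => by positivity
  obtain ⟨x, hx, hx0⟩ := exists_zero_of_contDiff_of_dist_lt (p := fun x => p x - y)
    (hp.sub contDiff_const) fun x hx => by
      have h1 := (hph x).trans_le (min_le_right _ _)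
      have h2 := hd x hx
      have h3 : dist (p x - y) (p x) < 1 / 16 := by simpa [dist_eq_norm] using hy
      have h4 := dist_triangle4 (p x - y) (p x) (h x) x
      linarith
  refine hball ?_ (mem_image_of_mem h hx)
  rw [mem_ball, dist_comm, ← sub_eq_zero.1 hx0]
  exact (hph x).trans_le (min_le_left _ _)

end Retraction

/-- The Tietze extension theorem for maps into a finite-dimensional real normed space. -/
theorem exists_extension_of_isClosedEmbedding {X Y V : Type*} [TopologicalSpace X]
    [TopologicalSpace Y] [NormalSpace Y] [NormedAddCommGroup V] [NormedSpace ℝ V]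
    [FiniteDimensional ℝ V] {e : X → Y} (he : Topology.IsClosedEmbedding e) (f : C(X, V)) :
    ∃ g : C(Y, V), g ∘ e = f :=
  have := TietzeExtension.of_tvs ℝ (E := V)
  f.exists_extension' he

/-- The Euclidean unit ball does not embed into a set of smaller Hausdorff dimension. -/
theorem not_injective_of_dimH_lt {V W : Type*} [NormedAddCommGroup V] [InnerProductSpace ℝ V]
    [FiniteDimensional ℝ V] [NormedAddCommGroup W] [NormedSpace ℝ W] [FiniteDimensional ℝ W]
    {K : Set W} (hdim : dimH K < Module.finrank ℝ V)
    {f : closedBall (0 : V) 1 → W} (hf : Continuous f) (hfK : ∀ x, f x ∈ K) :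
    ¬ Function.Injective f := by
  intro hinj
  have hclosed : Topology.IsClosedEmbedding f :=
    hf.isClosedEmbedding hinj
  obtain ⟨g, hg⟩ := exists_extension_of_isClosedEmbedding hclosed
    (⟨Subtype.val, continuous_subtype_val⟩ : C(closedBall (0 : V) 1, V))
  obtain ⟨G, hG, hGg, -⟩ := g.continuous.exists_contDiff_approx 1 (ε := fun _ => 1 / 16)
    continuous_const fun _ => by norm_num
  obtain ⟨H, hH⟩ := exists_extension_of_isClosedEmbedding
    (isClosed_closedBall (x := (0 : V)) (ε := 1)).isClosedEmbedding_subtypeVal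
    (⟨fun x => G (f x), hG.continuous.comp hf⟩ : C(closedBall (0 : V) 1, V))
  have hHf (x : V) (hx : x ∈ closedBall (0 : V) 1) : H x = G (f ⟨x, hx⟩) :=
    congrFun hH ⟨x, hx⟩
  have hsub := ball_subset_image_closedBall_of_dist_lt H.continuous fun x hx => by
    have hgx : g (f ⟨x, hx⟩) = x := congrFun hg ⟨x, hx⟩
    simpa only [hHf x hx, hgx] using hGg (f ⟨x, hx⟩)
  have hdense : Dense (G '' K)ᶜ :=
    hG.contDiffOn.dense_compl_image_of_dimH_lt_finrank convex_univ (subset_univ K) hdim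
  obtain ⟨y, hyK, hy⟩ := hdense.exists_mem_open isOpen_ball
    (⟨0, mem_ball_self (by norm_num)⟩ : (ball (0 : V) (1 / 16)).Nonempty)
  obtain ⟨x, hx, rfl⟩ := hsub hy
  exact hyK ⟨_, hfK ⟨x, hx⟩, (hHf x hx).symm⟩

theorem exists_continuous_injective_mapsTo_convexHull {W : Type*} [NormedAddCommGroup W]
    [NormedSpace ℝ W] {n : ℕ} {σ : Finset W} (hσ : AffineIndependent ℝ ((↑) : σ → W))
    (hcard : σ.card = n + 1) :
    ∃ f : EuclideanSpace ℝ (Fin n) → W, Continuous f ∧ Function.Injective f ∧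
      MapsTo f (closedBall 0 1) (convexHull ℝ (σ : Set W)) := by
  let e : Fin (n + 1) ≃ σ := (σ.equivFinOfCardEq hcard).symm
  have hlin : LinearIndependent ℝ fun i : Fin n => (e i.succ : W) - e 0 :=
    ((affineIndependent_iff_linearIndependent_vsub ℝ _ (e 0)).1 hσ).comp
      (fun i : Fin n => ⟨e i.succ, fun h => Fin.succ_ne_zero i (e.injective h)⟩) fun i j hij => by
        simpa using hij
  set c : ℝ := 1 / (2 * (n + 1)) with hc
  have hc0 : 0 < c := by positivity
  refine ⟨fun v => e 0 + ∑ i, (c * (1 + v i)) • ((e i.succ : W) - e 0), by fun_prop, ?_, ?_⟩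
  · intro v w hvw
    have h0 : ∑ i, (c * (v i - w i)) • ((e i.succ : W) - e 0) = 0 := by
      rw [← sub_eq_zero.2 (add_left_cancel hvw), ← Finset.sum_sub_distrib]
      refine Finset.sum_congr rfl fun i _ => ?_
      rw [← sub_smul]
      congr 1
      ring
    ext i
    have := Fintype.linearIndependent_iff.1 hlin _ h0 i
    exact sub_eq_zero.1 ((mul_eq_zero.1 this).resolve_left hc0.ne')
  · intro v hv
    have hv1 (i : Fin n) : |v i| ≤ 1 :=
      (PiLp.norm_apply_le v i).trans (by simpa using hv)
    let a : Fin (n + 1) → ℝ := Fin.cons (1 - ∑ i, c * (1 + v i)) fun i => c * (1 + v i)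
    have heq : (e 0 : W) + ∑ i, (c * (1 + v i)) • ((e i.succ : W) - e 0) =
        ∑ i, a i • (e i : W) := by
      simp only [a, Fin.sum_univ_succ, Fin.cons_zero, Fin.cons_succ, smul_sub,
        Finset.sum_sub_distrib, sub_smul, one_smul, Finset.sum_smul]
      abel
    have hmem : ∑ i, a i • (e i : W) ∈ convexHull ℝ (σ : Set W) := by
      refine (convex_convexHull ℝ _).sum_mem (fun i _ => ?_) ?_
        fun i _ => subset_convexHull ℝ _ (e i).2
      · refine Fin.cases ?_ (fun i => ?_) i
        · have : ∑ i, c * (1 + v i) ≤ ∑ _i : Fin n, c * 2 := by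
            gcongr with i
            linarith [(abs_le.1 (hv1 i)).2]
          have h2 : ∑ _i : Fin n, c * 2 ≤ 1 := by
            simp only [Finset.sum_const, Finset.card_univ, Fintype.card_fin, nsmul_eq_mul, hc]
            field_simp
            linarith
          simp only [a, Fin.cons_zero]
          linarith
        · simp only [a, Fin.cons_succ]
          exact mul_nonneg hc0.le (by linarith [(abs_le.1 (hv1 i)).1])
      · simp [a, Fin.sum_univ_succ]
    rwa [← heq] at hmem

section Polyhedra

variable {W : Type*} [NormedAddCommGroup W] [NormedSpace ℝ W]

theorem GeomComplex.dimH_space_le [FiniteDimensional ℝ W] (S : GeomComplex W) {m : ℕ}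
    (hS : ∀ σ ∈ S.faces, σ.card ≤ m + 1) : dimH S.space ≤ m := by
  rw [GeomComplex.space, show (⋃ σ ∈ S.faces, convexHull ℝ (σ : Set W)) =
    ⋃ σ ∈ (S.faces : Set (Finset W)), convexHull ℝ (σ : Set W) from rfl,
    dimH_bUnion S.faces.countable_toSet]
  refine iSup₂_le fun σ hσ => ?_
  have hne := S.nonempty_of_mem σ hσ
  rw [Real.Convex.dimH_eq_finrank_vectorSpan (convex_convexHull ℝ (σ : Set W))
    (convexHull_nonempty_iff.2 hne), ← direction_affineSpan (k := ℝ), affineSpan_convexHull,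
    direction_affineSpan]
  obtain ⟨k, hk⟩ := Nat.exists_eq_add_of_le' hne.card_pos
  have h := (S.indep σ hσ).finrank_vectorSpan (n := k) (by simpa using hk)
  rw [Subtype.range_coe_subtype] at h
  have hkm : k ≤ m := by have := hS σ hσ; omega
  have h' : Module.finrank ℝ (vectorSpan ℝ (σ : Set W)) = k := h
  rw [h']
  exact_mod_cast hkm

theorem GeomComplex.isEmpty_homeomorph_of_lt {W' : Type*} [NormedAddCommGroup W']
    [NormedSpace ℝ W'] [FiniteDimensional ℝ W'] {n m : ℕ} (S : GeomComplex W)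
    (Q : GeomComplex W') (hS : S.HasDim n) (hQ : Q.HasDim m) (hmn : m < n) :
    IsEmpty (S.space ≃ₜ Q.space) := by
  refine ⟨fun φ => ?_⟩
  obtain ⟨σ, hσ, hcard⟩ := hS.1
  obtain ⟨f, hf, hinj, hmaps⟩ :=
    exists_continuous_injective_mapsTo_convexHull (S.indep σ hσ) hcard
  have hfS (x : closedBall (0 : EuclideanSpace ℝ (Fin n)) 1) : f x ∈ S.space :=
    mem_biUnion (s := {τ | τ ∈ S.faces}) hσ (hmaps x.2)
  refine not_injective_of_dimH_lt (V := EuclideanSpace ℝ (Fin n)) ?_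
    (f := fun x => (φ ⟨f x, hfS x⟩ : W')) ?_ (fun x => (φ _).2) ?_
  · rw [finrank_euclideanSpace_fin]
    exact (Q.dimH_space_le hQ.2).trans_lt (by exact_mod_cast hmn)
  · exact continuous_subtype_val.comp (φ.continuous.comp
      ((hf.comp continuous_subtype_val).subtype_mk hfS))
  · intro x y hxy
    have h := φ.injective (Subtype.ext hxy)
    exact Subtype.ext (hinj (Subtype.ext_iff.1 h))

end Polyhedra

/-- Invariance of dimension for polyhedra: if geometric simplicial complexes `S` and
`Q` have dimensions `n ≠ m`, then their polyhedra are not homeomorphic. -/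
theorem invariance_of_dimension_polyhedra (d e n m : ℕ)
    (S : GeomComplex (EuclideanSpace ℝ (Fin d)))
    (Q : GeomComplex (EuclideanSpace ℝ (Fin e)))
    (hS : S.HasDim n) (hQ : Q.HasDim m) (hnm : n ≠ m) :
    IsEmpty (↥S.space ≃ₜ ↥Q.space) := by
  rcases lt_or_gt_of_ne hnm with h | h
  · have := Q.isEmpty_homeomorph_of_lt S hQ hS h
    exact ⟨fun φ => isEmptyElim φ.symm⟩
  · exact S.isEmpty_homeomorph_of_lt Q hS hQ h
end

section
/- Brouwer's invariance of domain theorem: Let Y, X ⊆ ℝ^n and let h: Y → X be a homeomorphism (with respect to the subspace topologies). If a point z belongs to the interior of Y in ℝ^n, then h(z) belongs to the interior of X in ℝ^n. In particular, if Y is open in ℝ^n, then X is open in ℝ^n. -/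
open Set Metric MeasureTheory Filter Topology
open scoped NNReal ContDiff

/-- A polynomial-in-`t` identity: `det (1 + A)` is a fixed affine combination of the values
`det (1 + t • A)`, where `t` ranges over a finite set with more than `dim E` elements. -/
theorem det_one_add_eq_sum_lagrange {E : Type*} [AddCommGroup E] [Module ℝ E]
    [FiniteDimensional ℝ E] {s : Finset ℝ} (hs : Module.finrank ℝ E < s.card) (A : E →ₗ[ℝ] E) :
    LinearMap.det (1 + A) =
      ∑ t ∈ s, (Lagrange.basis s id t).eval 1 * LinearMap.det (1 + t • A) := by
  classical
  let b := Module.finBasis ℝ E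
  let M := LinearMap.toMatrix b b A
  let p : Polynomial ℝ := Matrix.det
    ((Polynomial.X : Polynomial ℝ) • M.map Polynomial.C + (1 : Matrix _ _ ℝ).map Polynomial.C)
  have hp : ∀ t : ℝ, p.eval t = LinearMap.det (1 + t • A) := by
    intro t
    rw [← LinearMap.det_toMatrix b, ← Polynomial.coe_evalRingHom, RingHom.map_det]
    congr 1
    ext i j
    simp only [M, RingHom.mapMatrix_apply, Matrix.map_apply, Matrix.add_apply, Matrix.smul_apply,
      Matrix.one_apply, map_add, map_smul, LinearMap.toMatrix_one]
    split_ifs <;> simp [mul_comm t, add_comm]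
  have hdeg : p.degree < s.card := by
    refine lt_of_le_of_lt Polynomial.degree_le_natDegree ?_
    have := Polynomial.natDegree_det_X_add_C_le M 1
    rw [Fintype.card_fin] at this
    exact_mod_cast this.trans_lt hs
  have h := congrArg (Polynomial.eval 1)
    (Lagrange.eq_interpolate (v := id) (s := s) Function.injective_id.injOn hdeg)
  rw [hp, one_smul] at h
  rw [h, Lagrange.interpolate_apply, Polynomial.eval_finsetSum]
  refine Finset.sum_congr rfl fun t _ => ?_
  rw [Polynomial.eval_mul, Polynomial.eval_C, id, hp, mul_comm]

theorem ContinuousLinearMap.det_one_add_pos {E : Type*} [NormedAddCommGroup E] [NormedSpace ℝ E]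
    [FiniteDimensional ℝ E] {A : E →L[ℝ] E} (hA : ‖A‖ < 1) : 0 < (1 + A).det := by
  have hne : ∀ s ∈ Icc (0 : ℝ) 1, (1 + s • A).det ≠ 0 := by
    intro s hs h0
    obtain ⟨v, hv, hv0⟩ := Submodule.exists_mem_ne_zero_of_ne_bot
      (LinearMap.bot_lt_ker_of_det_eq_zero h0).ne'
    have h1 : v = -(s • A v) := by
      simpa [LinearMap.mem_ker, add_eq_zero_iff_eq_neg] using hv
    have h2 : ‖v‖ ≤ ‖A‖ * ‖v‖ := by
      calc ‖v‖ = s * ‖A v‖ := by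
            conv_lhs => rw [h1]
            rw [norm_neg, norm_smul, Real.norm_of_nonneg hs.1]
        _ ≤ 1 * ‖A v‖ := by gcongr; exact hs.2
        _ ≤ _ := by rw [one_mul]; exact A.le_opNorm v
    nlinarith [norm_pos_iff.2 hv0]
  by_contra! hle
  have hc : ContinuousOn (fun s : ℝ => (1 + s • A).det) (Icc 0 1) :=
    (ContinuousLinearMap.continuous_det.comp (by fun_prop)).continuousOn
  obtain ⟨s, hs, h0⟩ := intermediate_value_Icc' zero_le_one hc
    (show (0 : ℝ) ∈ Icc _ _ by
      refine ⟨by simpa using hle, ?_⟩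
      simp [ContinuousLinearMap.det])
  exact hne s hs h0

/-- A small Lipschitz perturbation of the identity supported in `s` restricts to a bijection
of `s`. -/
theorem LipschitzWith.bijOn_add_smul {E : Type*} [NormedAddCommGroup E] [NormedSpace ℝ E]
    [CompleteSpace E] {g : E → E} {K : ℝ≥0} (hg : LipschitzWith K g) {s : Set E}
    (hs : ∀ x ∉ s, g x = 0) {t : ℝ≥0} (ht : t * K < 1) :
    BijOn (fun x => x + (t : ℝ) • g x) s s := by
  have hinj : Function.Injective (fun x => x + (t : ℝ) • g x) := by
    intro x y hxy
    have h1 : x - y = (t : ℝ) • (g y - g x) := by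
      rw [smul_sub, sub_eq_sub_iff_add_eq_add, add_comm _ y]; exact hxy
    have h2 : ‖x - y‖ ≤ (t * K : ℝ) * ‖x - y‖ := by
      conv_lhs => rw [h1, norm_smul, NNReal.norm_eq, norm_sub_rev]
      rw [mul_assoc]
      gcongr
      exact hg.norm_sub_le x y
    have h3 : (t * K : ℝ) < 1 := mod_cast ht
    have := norm_nonneg (x - y)
    exact sub_eq_zero.1 (norm_eq_zero.1 (by nlinarith))
  refine ⟨fun x hx => ?_, hinj.injOn, fun y hy => ?_⟩
  · by_contra hy
    have : x + (t : ℝ) • g x = x := hinj (by simp [hs _ hy])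
    exact hy (by simpa only [this] using hx)
  · have hc : ContractingWith (t * K) (fun x => y - (t : ℝ) • g x) := by
      refine ⟨ht, LipschitzWith.of_dist_le_mul fun x z => ?_⟩
      rw [dist_sub_left, dist_smul₀, NNReal.norm_eq, NNReal.coe_mul, mul_assoc]
      gcongr
      exact hg.dist_le_mul x z
    obtain ⟨x, hx, -⟩ := hc.exists_fixedPoint y (edist_ne_top _ _)
    have hxy : x + (t : ℝ) • g x = y := by rw [← eq_sub_iff_add_eq]; exact hx.symm
    refine ⟨x, ?_, hxy⟩
    by_contra hxs
    rw [hs x hxs, smul_zero, add_zero] at hxy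
    exact hxs (hxy ▸ hy)

/-- Extension by zero outside the unit ball preserves the Lipschitz property, up to a factor `2`,
when the function vanishes on the unit sphere. -/
theorem LipschitzOnWith.indicator_closedBall {E F : Type*} [NormedAddCommGroup E] [NormedSpace ℝ E]
    [NormedAddCommGroup F] {g : E → F} {K : ℝ≥0}
    (hg : LipschitzOnWith K g (closedBall 0 1)) (h0 : ∀ x ∈ sphere (0 : E) 1, g x = 0) :
    LipschitzWith (K * 2) ((closedBall 0 1).indicator g) := by
  have key : ∀ x ∈ closedBall (0 : E) 1, ∀ y ∉ closedBall (0 : E) 1,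
      dist (g x) 0 ≤ K * 2 * dist x y := by
    intro x hx y hy
    rw [mem_closedBall_zero_iff] at hx
    rw [mem_closedBall_zero_iff, not_le] at hy
    have hz : ‖‖y‖⁻¹ • y‖ = 1 := norm_smul_inv_norm (𝕜 := ℝ) (norm_pos_iff.1 (one_pos.trans hy))
    have h1 : dist y (‖y‖⁻¹ • y) = ‖y‖ - 1 := by
      have hy0 : ‖y‖ ≠ 0 := by linarith
      have : y - ‖y‖⁻¹ • y = (1 - ‖y‖⁻¹) • y := by rw [sub_smul, one_smul]
      rw [dist_eq_norm, this, norm_smul, Real.norm_of_nonneg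
        (sub_nonneg.2 (inv_le_one_of_one_le₀ hy.le))]
      field_simp
    have h2 : ‖y‖ - ‖x‖ ≤ dist x y := by
      rw [dist_comm, dist_eq_norm]; exact norm_sub_norm_le y x
    have h3 := hg.dist_le_mul x (by simpa using hx) (‖y‖⁻¹ • y)
      (by rw [mem_closedBall_zero_iff, hz])
    rw [h0 (‖y‖⁻¹ • y) (by rwa [mem_sphere_zero_iff_norm])] at h3
    refine h3.trans ?_
    rw [mul_assoc]
    gcongr
    linarith [dist_triangle x y (‖y‖⁻¹ • y)]
  refine LipschitzWith.of_dist_le_mul fun x y => ?_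
  push_cast
  by_cases hx : x ∈ closedBall (0 : E) 1 <;> by_cases hy : y ∈ closedBall (0 : E) 1
  · rw [indicator_of_mem hx, indicator_of_mem hy]
    refine (hg.dist_le_mul x hx y hy).trans ?_
    gcongr
    linarith [K.coe_nonneg]
  · rw [indicator_of_mem hx, indicator_of_notMem hy]
    exact key x hx y hy
  · rw [indicator_of_notMem hx, indicator_of_mem hy, dist_comm, dist_comm x y]
    exact key y hy x hx
  · rw [indicator_of_notMem hx, indicator_of_notMem hy, dist_self]
    positivity

theorem ContinuousOn.exists_continuous_eqOn {X F : Type*} [TopologicalSpace X] [NormalSpace X]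
    [NormedAddCommGroup F] [NormedSpace ℝ F] [FiniteDimensional ℝ F] {f : X → F} {s : Set X}
    (hf : ContinuousOn f s) (hs : IsClosed s) : ∃ g : X → F, Continuous g ∧ EqOn g f s := by
  have : TietzeExtension F := .of_tvs ℝ
  obtain ⟨g, hg⟩ := ContinuousMap.exists_restrict_eq hs ⟨s.domRestrict f, hf.domRestrict⟩
  exact ⟨g, g.continuous, fun x hx => DFunLike.congr_fun hg ⟨x, hx⟩⟩

theorem ContinuousOn.continuousOn_invFunOn_image {X Y : Type*} [TopologicalSpace X] [Nonempty X]
    [TopologicalSpace Y] [T2Space Y] {f : X → Y} {s : Set X} (hf : ContinuousOn f s)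
    (hs : IsCompact s) (hinj : InjOn f s) : ContinuousOn (Function.invFunOn f s) (f '' s) := by
  have : CompactSpace s := isCompact_iff_compactSpace.1 hs
  have hemb : IsClosedEmbedding (s.domRestrict f) :=
    hf.domRestrict.isClosedEmbedding hinj.injective
  rw [continuousOn_iff_continuous_domRestrict]
  let e : s ≃ₜ range (s.domRestrict f) := hemb.isEmbedding.toHomeomorph
  have he : Continuous fun y : f '' s => (e.symm ⟨y, by rw [range_domRestrict]; exact y.2⟩ : X) := by
    fun_prop
  refine he.congr ?_
  rintro ⟨_, x, hx, rfl⟩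
  have h1 : e.symm ⟨f x, ⟨x, hx⟩, rfl⟩ = ⟨x, hx⟩ := e.symm_apply_eq.2 rfl
  simp only [Set.domRestrict_apply, hinj.leftInvOn_invFunOn hx]
  exact congrArg Subtype.val h1

section

variable {E : Type*} [NormedAddCommGroup E] [InnerProductSpace ℝ E] [FiniteDimensional ℝ E]

theorem det_fderiv_eq_zero_of_norm_eq_one {r : E → E} {x : E} (hr : DifferentiableAt ℝ r x)
    (h : ∀ᶠ y in 𝓝 x, ‖r y‖ = 1) : (fderiv ℝ r x).det = 0 := by
  by_contra hdet
  have hsurj : Function.Surjective (fderiv ℝ r x) :=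
    (LinearMap.equivOfDetNeZero _ hdet).surjective
  obtain ⟨v, hv⟩ := hsurj (r x)
  have h1 : HasFDerivAt (fun y => inner ℝ (r y) (r y)) (0 : E →L[ℝ] ℝ) x := by
    refine (hasFDerivAt_const (1 : ℝ) x).congr_of_eventuallyEq ?_
    filter_upwards [h] with y hy
    simp [hy]
  have h2 := DFunLike.congr_fun
    ((hr.hasFDerivAt.inner ℝ hr.hasFDerivAt).unique h1) v
  have h3 : ‖r x‖ = 1 := h.self_of_nhds
  simp [hv, h3] at h2

/-- There is no `C¹` retraction of the closed unit ball onto the unit sphere. -/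
theorem not_contDiff_retraction_sphere_s11 {r : E → E} (hr : ContDiff ℝ 1 r)
    (hnorm : ∀ x, ‖r x‖ = 1) (hid : ∀ x ∈ sphere (0 : E) 1, r x = x) : False := by
  borelize E
  set B := closedBall (0 : E) 1
  have hBc : IsCompact B := isCompact_closedBall 0 1
  let μ : Measure E := Measure.addHaar
  let A : E → E →L[ℝ] E := fun x => fderiv ℝ r x - 1
  have hAc : Continuous A := (hr.continuous_fderiv one_ne_zero).sub continuous_const
  have hg : ∀ x, HasFDerivAt (fun x => r x - x) (A x) x := fun x =>
    ((hr.differentiable one_ne_zero).differentiableAt.hasFDerivAt).sub (hasFDerivAt_id x)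
  obtain ⟨C, hC⟩ := hBc.exists_bound_of_continuousOn hAc.continuousOn
  let K : ℝ≥0 := C.toNNReal + 1
  have hK : ∀ x ∈ B, ‖A x‖₊ ≤ K := fun x hx => by
    rw [← NNReal.coe_le_coe, coe_nnnorm]
    have := Real.le_coe_toNNReal C
    have := hC x hx
    simp only [K, NNReal.coe_add, NNReal.coe_one]
    linarith
  have hLip : LipschitzWith (K * 2) (B.indicator fun x => r x - x) :=
    LipschitzOnWith.indicator_closedBall
      ((convex_closedBall 0 1).lipschitzOnWith_of_nnnorm_hasFDerivWithin_le
        (fun x _ => (hg x).hasFDerivWithinAt) hK)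
      (fun x hx => sub_eq_zero.2 (hid x hx))
  have hvol : ∀ t ∈ Ioo (0 : ℝ) (K * 2)⁻¹, ∫ x in B, (1 + t • A x).det ∂μ = μ.real B := by
    intro t ht
    have htK : t * (K * 2) < 1 := by
      have := mul_lt_mul_of_pos_right ht.2 (show (0 : ℝ) < K * 2 by positivity)
      rwa [inv_mul_cancel₀ (by positivity)] at this
    have hbij : BijOn (fun x => x + t • (r x - x)) B B := by
      refine (hLip.bijOn_add_smul (t := ⟨t, ht.1.le⟩)
        (fun x hx => indicator_of_notMem hx _) ?_).congr fun x hx => ?_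
      · rw [← NNReal.coe_lt_coe]; exact htK
      · simp only [indicator_of_mem hx]
        rfl
    have hder : ∀ x ∈ B, HasFDerivWithinAt (fun x => x + t • (r x - x)) (1 + t • A x) B x :=
      fun x _ => ((hasFDerivAt_id x).add ((hg x).const_smul t)).hasFDerivWithinAt
    have h := integral_image_eq_integral_abs_det_fderiv_smul μ hBc.measurableSet hder hbij.injOn
      (fun _ => (1 : ℝ))
    rw [hbij.image_eq] at h
    simp only [smul_eq_mul, mul_one, integral_const, measureReal_restrict_apply_univ] at h
    rw [h]
    refine setIntegral_congr_fun hBc.measurableSet fun x hx => (abs_of_pos ?_).symm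
    refine ContinuousLinearMap.det_one_add_pos ?_
    have h1 : ‖A x‖ ≤ K := hK x hx
    rw [norm_smul, Real.norm_of_nonneg ht.1.le]
    nlinarith [ht.1]
  obtain ⟨s, hs, hcard⟩ := (Ioo_infinite
    (show (0 : ℝ) < (K * 2)⁻¹ by positivity)).exists_subset_card_eq (Module.finrank ℝ E + 1)
  have hcard' : Module.finrank ℝ E < s.card := by omega
  have hint : ∀ t : ℝ, IntegrableOn (fun x => (1 + t • A x).det) B μ := fun t =>
    (ContinuousLinearMap.continuous_det.comp (by fun_prop)).continuousOn.integrableOn_compact hBc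
  have h1 : ∫ x in B, (fderiv ℝ r x).det ∂μ = μ.real B := by
    calc ∫ x in B, (fderiv ℝ r x).det ∂μ
        = ∫ x in B, ∑ t ∈ s, (Lagrange.basis s id t).eval 1 * (1 + t • A x).det ∂μ := by
          congr 1 with x
          have := det_one_add_eq_sum_lagrange hcard' (A x : E →ₗ[ℝ] E)
          have h2 : fderiv ℝ r x = 1 + A x := by simp [A]
          rw [h2]
          exact this
      _ = ∑ t ∈ s, (Lagrange.basis s id t).eval 1 * μ.real B := by
          rw [integral_finsetSum _ fun t _ => (hint t).const_mul _]
          refine Finset.sum_congr rfl fun t ht => ?_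
          rw [integral_const_mul, hvol t (hs ht)]
      _ = μ.real B := by
          rw [← Finset.sum_mul, ← Polynomial.eval_finsetSum, Lagrange.sum_basis
            Function.injective_id.injOn (Finset.card_pos.1 (by omega)), Polynomial.eval_one,
            one_mul]
  have h2 : ∀ x, (fderiv ℝ r x).det = 0 := fun x =>
    det_fderiv_eq_zero_of_norm_eq_one (hr.differentiable one_ne_zero).differentiableAt
      (Eventually.of_forall hnorm)
  simp only [h2, integral_zero] at h1
  exact (ENNReal.toReal_pos (measure_closedBall_pos μ 0 one_pos).ne' hBc.measure_lt_top.ne).ne h1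

/-- A continuous map that stays close to the identity on the closed unit ball has a zero there. -/
theorem exists_eq_zero_of_norm_sub_le {F : E → E} (hF : ContinuousOn F (closedBall 0 1))
    (hdist : ∀ x ∈ closedBall (0 : E) 1, ‖F x - x‖ ≤ 2 / 5) :
    ∃ x ∈ closedBall (0 : E) 1, F x = 0 := by
  by_contra! hne
  have hBc : IsCompact (closedBall (0 : E) 1) := isCompact_closedBall 0 1
  obtain ⟨F₁, hF₁, hF₁F⟩ := hF.exists_continuous_eqOn isClosed_closedBall
  obtain ⟨m, hm, hmF⟩ := hBc.exists_forall_le' hF.norm fun x hx => norm_pos_iff.2 (hne x hx)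
  have hδ : 0 < min m (1 / 10) := lt_min hm (by norm_num)
  obtain ⟨P, hP, hPF, -⟩ := hF₁.exists_contDiff_approx 1 (ε := fun _ => min m (1 / 10))
    continuous_const fun _ => hδ
  have hPF' : ∀ x ∈ closedBall (0 : E) 1, ‖P x - F x‖ < min m (1 / 10) := fun x hx => by
    rw [← hF₁F hx, ← dist_eq_norm]; exact hPF x
  let χ : ContDiffBump (0 : E) := ⟨1 / 2, 1, by norm_num, by norm_num⟩
  let H : E → E := fun x => χ x • P x + (1 - χ x) • x
  have hHsmooth : ContDiff ℝ 1 H :=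
    (χ.contDiff.smul hP).add ((contDiff_const.sub χ.contDiff).smul contDiff_id)
  have hHout : ∀ x, 1 ≤ ‖x‖ → H x = x := by
    intro x hx
    simp [H, χ.zero_of_le_dist (x := x) (by simpa [χ] using hx)]
  have hHne : ∀ x, H x ≠ 0 := by
    intro x
    rcases le_total 1 ‖x‖ with hx | hx
    · rw [hHout x hx]
      exact norm_pos_iff.1 (one_pos.trans_le hx)
    have hxB : x ∈ closedBall (0 : E) 1 := mem_closedBall_zero_iff.2 hx
    have h1 := hPF' x hxB
    rcases le_or_gt ‖x‖ (1 / 2) with hx' | hx'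
    · have : H x = P x := by
        simp [H, χ.one_of_mem_closedBall (x := x) (mem_closedBall_zero_iff.2 hx')]
      rw [this]
      intro h0
      rw [h0, zero_sub, norm_neg] at h1
      exact absurd (h1.trans_le (min_le_left _ _)) (hmF x hxB).not_gt
    · intro h0
      have h2 : x = -(χ x • (P x - x)) := by
        refine sub_eq_zero.1 (Eq.trans ?_ h0)
        simp only [H]
        module
      have h3 : ‖x‖ ≤ ‖P x - x‖ := by
        conv_lhs => rw [h2, norm_neg, norm_smul, Real.norm_of_nonneg χ.nonneg]
        exact mul_le_of_le_one_left (norm_nonneg _) χ.le_one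
      have h4 := norm_sub_le_norm_sub_add_norm_sub (P x) (F x) x
      have h5 := hdist x hxB
      have h6 := h1.trans_le (min_le_right _ _)
      linarith
  refine not_contDiff_retraction_sphere_s11 (r := fun x => ‖H x‖⁻¹ • H x)
    (((hHsmooth.norm ℝ hHne).inv fun x => norm_ne_zero_iff.2 (hHne x)).smul hHsmooth)
    (fun x => norm_smul_inv_norm (𝕜 := ℝ) (hHne x)) fun x hx => ?_
  rw [mem_sphere_zero_iff_norm] at hx
  simp only [hHout x hx.ge, hx, inv_one, one_smul]

theorem mem_interior_image_closedBall {f : E → E} (hf : ContinuousOn f (closedBall 0 1))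
    (hinj : InjOn f (closedBall 0 1)) : f 0 ∈ interior (f '' closedBall 0 1) := by
  borelize E
  have hBc : IsCompact (closedBall (0 : E) 1) := isCompact_closedBall 0 1
  have h0B : (0 : E) ∈ closedBall (0 : E) 1 := mem_closedBall_self zero_le_one
  set S := f '' closedBall (0 : E) 1
  have hSc : IsCompact S := hBc.image_of_continuousOn hf
  obtain ⟨G, hG, hGf⟩ : ∃ G : E → E, Continuous G ∧ ∀ x ∈ closedBall (0 : E) 1, G (f x) = x := by
    obtain ⟨G, hG, hGe⟩ :=
      (hf.continuousOn_invFunOn_image hBc hinj).exists_continuous_eqOn hSc.isClosed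
    exact ⟨G, hG, fun x hx => (hGe (mem_image_of_mem f hx)).trans (hinj.leftInvOn_invFunOn hx)⟩
  by_contra hint
  obtain ⟨η, hη, hGη⟩ := Metric.continuous_iff.1 hG (f 0) (1 / 10) (by norm_num)
  rw [hGf 0 h0B] at hGη
  simp only [dist_zero_right] at hGη
  let ε := η / 2
  have hε : 0 < ε := half_pos hη
  obtain ⟨c, hc, hcS⟩ : ∃ c ∈ ball (f 0) ε, c ∉ S := by
    by_contra! hsub
    exact hint (mem_interior_iff_mem_nhds.2 (mem_of_superset (ball_mem_nhds _ hε) hsub))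
  rw [mem_ball] at hc
  have hGc : ∀ y, ‖y - c‖ ≤ ε → ‖G y‖ < 1 / 10 := fun y hy => hGη y (by
    have := dist_triangle y c (f 0)
    rw [dist_eq_norm y c] at this
    simp only [ε] at *
    linarith)
  obtain ⟨m, hm, hmG⟩ := (hSc.diff isOpen_ball : IsCompact (S \ ball c ε)).exists_forall_le'
    hG.norm.continuousOn (a := 0) (by
      rintro _ ⟨⟨x, hx, rfl⟩, hxc⟩
      rw [hGf x hx, norm_pos_iff]
      rintro rfl
      exact hxc (by rwa [mem_ball, dist_comm]))
  let δ := min m (1 / 10)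
  have hδ : 0 < δ := lt_min hm (by norm_num)
  obtain ⟨P₀, hP₀, hP₀G, -⟩ := hG.exists_contDiff_approx 1 (ε := fun _ => δ / 2)
    continuous_const fun _ => half_pos hδ
  obtain ⟨p, hpδ, hp⟩ : ∃ p ∈ ball (0 : E) (δ / 2), p ∉ P₀ '' sphere c ε := by
    have hnull : (Measure.addHaar : Measure E) (P₀ '' sphere c ε) = 0 :=
      addHaar_image_eq_zero_of_differentiableOn_of_addHaar_eq_zero _
        (hP₀.differentiable one_ne_zero).differentiableOn
        (Measure.addHaar_sphere_of_ne_zero _ c hε.ne')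
    by_contra! hsub
    exact (measure_ball_pos Measure.addHaar (0 : E) (half_pos hδ)).ne'
      (measure_mono_null hsub hnull)
  let P : E → E := fun y => P₀ y - p
  have hPG : ∀ y, ‖P y - G y‖ < δ := by
    intro y
    have h1 := hP₀G y
    rw [dist_eq_norm] at h1
    rw [mem_ball_zero_iff] at hpδ
    have h2 : P y - G y = (P₀ y - G y) - p := by simp only [P]; abel
    rw [h2]
    linarith [norm_sub_le (P₀ y - G y) p]
  let Φ : E → E := fun y => c + max 1 (ε / ‖y - c‖) • (y - c)
  have hfc : ∀ x ∈ closedBall (0 : E) 1, ‖f x - c‖ ≠ 0 := fun x hx => by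
    rw [norm_ne_zero_iff, sub_ne_zero]
    rintro rfl
    exact hcS (mem_image_of_mem f hx)
  have hcont : ContinuousOn (fun x => P (Φ (f x))) (closedBall 0 1) := by
    have hsub : ContinuousOn (fun x => f x - c) (closedBall 0 1) := hf.sub continuousOn_const
    exact (hP₀.continuous.sub continuous_const).comp_continuousOn (continuousOn_const.add
      ((continuousOn_const.sup (continuousOn_const.div hsub.norm hfc)).smul hsub))
  have hcases : ∀ x ∈ closedBall (0 : E) 1,
      P (Φ (f x)) ≠ 0 ∧ ‖P (Φ (f x)) - x‖ ≤ 2 / 5 := by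
    intro x hx
    have hpos : 0 < ‖f x - c‖ := (norm_nonneg _).lt_of_ne' (hfc x hx)
    have hδ' : δ ≤ 1 / 10 := min_le_right _ _
    have hPGΦ := hPG (Φ (f x))
    rcases le_or_gt ε ‖f x - c‖ with hle | hlt
    · have hΦ : Φ (f x) = f x := by
        simp [Φ, max_eq_left ((div_le_one hpos).2 hle)]
      rw [hΦ, hGf x hx] at hPGΦ
      rw [hΦ]
      refine ⟨fun h0 => ?_, by linarith⟩
      have hmx := hmG (f x) ⟨mem_image_of_mem f hx, by simpa [dist_eq_norm] using hle⟩
      rw [hGf x hx] at hmx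
      rw [h0, zero_sub, norm_neg] at hPGΦ
      exact absurd (hPGΦ.trans_le (min_le_left _ _)) hmx.not_gt
    · have hΦ : ‖Φ (f x) - c‖ = ε := by
        simp only [Φ, add_sub_cancel_left]
        rw [max_eq_right ((one_le_div hpos).2 hlt.le), norm_smul,
          Real.norm_of_nonneg (by positivity), div_mul_cancel₀ _ hpos.ne']
      refine ⟨fun h0 => hp ⟨Φ (f x), by rwa [mem_sphere_iff_norm], sub_eq_zero.1 h0⟩, ?_⟩
      have h1 := hGc _ hΦ.le
      have h2 := hGc _ hlt.le
      rw [hGf x hx] at h2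
      have h3 := norm_sub_le_norm_sub_add_norm_sub (P (Φ (f x))) (G (Φ (f x))) x
      have h4 := norm_sub_le (G (Φ (f x))) x
      linarith
  obtain ⟨x, hx, hx0⟩ := exists_eq_zero_of_norm_sub_le hcont fun x hx => (hcases x hx).2
  exact (hcases x hx).1 hx0

/-- The image of an interior point under a continuous injection is interior to the image. -/
theorem ContinuousOn.mem_interior_image_of_injOn {f : E → E} {s : Set E} (hf : ContinuousOn f s)
    (hinj : InjOn f s) {z : E} (hz : z ∈ interior s) : f z ∈ interior (f '' s) := by
  obtain ⟨R, hR, hRs⟩ := nhds_basis_closedBall.mem_iff.1 (mem_interior_iff_mem_nhds.1 hz)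
  have hmaps : MapsTo (fun x : E => z + R • x) (closedBall 0 1) s := by
    intro x hx
    refine hRs ?_
    rw [mem_closedBall_zero_iff] at hx
    simpa [norm_smul, abs_of_pos hR] using mul_le_of_le_one_right hR.le hx
  have hinj' : Function.Injective (fun x : E => z + R • x) :=
    (add_right_injective z).comp (smul_right_injective E hR.ne')
  have h := mem_interior_image_closedBall (hf.comp (by fun_prop) hmaps)
    (hinj.comp hinj'.injOn hmaps)
  rw [image_comp] at h
  simpa using interior_mono (image_mono hmaps.image_subset) h

end


/-- Brouwer's invariance of domain theorem: if `h : Y → X` is a homeomorphism between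
subsets of `ℝ^n` and `z` belongs to the interior of `Y` in `ℝ^n`, then `h z` belongs to
the interior of `X` in `ℝ^n`.  In particular, if `Y` is open then `X` is open. -/
theorem invariance_of_domain (n : ℕ) (Y X : Set (EuclideanSpace ℝ (Fin n)))
    (h : ↥Y ≃ₜ ↥X) :
    (∀ (z : EuclideanSpace ℝ (Fin n)) (hz : z ∈ interior Y),
      (↑(h ⟨z, interior_subset hz⟩) : EuclideanSpace ℝ (Fin n)) ∈ interior X) ∧
    (IsOpen Y → IsOpen X) := by
  have key : ∀ (z : EuclideanSpace ℝ (Fin n)) (hz : z ∈ interior Y),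
      (↑(h ⟨z, interior_subset hz⟩) : EuclideanSpace ℝ (Fin n)) ∈ interior X := by
    intro z hz
    classical
    let f : EuclideanSpace ℝ (Fin n) → EuclideanSpace ℝ (Fin n) :=
      fun x => if hx : x ∈ Y then h ⟨x, hx⟩ else 0
    have hfY : ∀ x (hx : x ∈ Y), f x = h ⟨x, hx⟩ := fun x hx => dif_pos hx
    have hf : ContinuousOn f Y := by
      rw [continuousOn_iff_continuous_domRestrict]
      exact (continuous_subtype_val.comp h.continuous).congr fun x => (hfY x x.2).symm
    have hinj : InjOn f Y := by
      intro x hx y hy hxy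
      rw [hfY x hx, hfY y hy] at hxy
      exact congrArg Subtype.val (h.injective (Subtype.ext hxy))
    have himage : f '' Y ⊆ X := by
      rintro _ ⟨x, hx, rfl⟩
      rw [hfY x hx]
      exact (h ⟨x, hx⟩).2
    rw [← hfY z (interior_subset hz)]
    exact interior_mono himage (hf.mem_interior_image_of_injOn hinj hz)
  refine ⟨key, fun hY => subset_interior_iff_isOpen.1 fun x hx => ?_⟩
  have hmem : (h.symm ⟨x, hx⟩ : EuclideanSpace ℝ (Fin n)) ∈ interior Y := by
    rw [hY.interior_eq]
    exact (h.symm ⟨x, hx⟩).2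
  simpa using key _ hmem
end
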